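/- Let n ≥ 1, 1/4 < s < 1/2, θ > 1/2, and let p satisfy 1 − 2s < 1/p < 1/2. Then there exist ε₀ > 0 and C such that: if A_0, f, φ are Schwartz M_n(ℂ)-valued functions on ℝ^{1+2} satisfying △A_0 = −∂_1[A_0,∂_2 f] + ∂_2[A_0,∂_1 f] + ∂_1[∂_1 f,φ] + ∂_2[∂_2 f,φ] pointwise and ‖∇f‖_{H^{s,θ}} ≤ ε₀, then ‖A_0‖_{L^p_t L^∞_x} ≤ C·‖φ‖_{H^{s,θ}}·‖∇f‖_{H^{s,θ}}, where ‖A_0‖_{L^p_t L^∞_x} = ( ∫_ℝ (sup_{x∈ℝ²}‖A_0(t,x)‖)^p dt )^{1/p}. -/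

import Mathlib

noncomputable section

open MeasureTheory Real
open scoped ENNReal RealInnerProductSpace

/-- The spatial domain `ℝ²`. -/
abbrev V2 : Type := EuclideanSpace ℝ (Fin 2)

/-- Space-time Fourier transform on `ℝ^{1+2}`, convention `e^{-i(tτ + x·ξ)}`. -/
def ftST (u : ℝ × V2 → ℂ) (τ : ℝ) (ξ : V2) : ℂ :=
  ∫ p : ℝ × V2, Complex.exp (-Complex.I * ((p.1 * τ + ⟪p.2, ξ⟫ : ℝ) : ℂ)) * u p

/-- The weight `(1+|ξ|²)^{s/2} (1+||τ|-|ξ||)^θ`. -/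
def wgt (s θ τ : ℝ) (ξ : V2) : ℝ :=
  (1 + ‖ξ‖ ^ 2) ^ (s / 2) * (1 + |(|τ| - ‖ξ‖)|) ^ θ

/-- The Wave–Sobolev norm `H^{s,θ}` on `ℝ^{1+2}`. -/
def HN (s θ : ℝ) (u : ℝ × V2 → ℂ) : ℝ≥0∞ :=
  (∫⁻ q : ℝ × V2, (ENNReal.ofReal (wgt s θ q.1 q.2) * (‖ftST u q.1 q.2‖₊ : ℝ≥0∞)) ^ (2 : ℕ)) ^
    ((1 : ℝ) / 2)

/-- Time derivative `∂ₜ u`. -/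
def dtime (u : ℝ × V2 → ℂ) : ℝ × V2 → ℂ :=
  fun p => fderiv ℝ u p ((1 : ℝ), (0 : V2))

/-- The norm of `𝓗^{s,θ}`: `‖u‖_{H^{s,θ}} + ‖∂ₜu‖_{H^{s-1,θ}}`. -/
def HHN (s θ : ℝ) (u : ℝ × V2 → ℂ) : ℝ≥0∞ :=
  HN s θ u + HN (s - 1) θ (dtime u)

/-- Spatial partial derivative `∂ⱼ u`, `j = 0, 1`. -/
def pdx (j : Fin 2) (u : ℝ × V2 → ℂ) : ℝ × V2 → ℂ :=
  fun p => fderiv ℝ u p ((0 : ℝ), EuclideanSpace.single j 1)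

/-- Inverse space-time Fourier transform. -/
def iftST (F : ℝ → V2 → ℂ) (t : ℝ) (x : V2) : ℂ :=
  ((((2 * π) ^ 3)⁻¹ : ℝ) : ℂ) *
    ∫ q : ℝ × V2, Complex.exp (Complex.I * ((t * q.1 + ⟪x, q.2⟫ : ℝ) : ℂ)) * F q.1 q.2

/-- The space-time Fourier multiplier with symbol `m`. -/
def mult (m : ℝ → V2 → ℂ) (u : ℝ × V2 → ℂ) : ℝ × V2 → ℂ :=
  fun p => iftST (fun τ ξ => m τ ξ * ftST u τ ξ) p.1 p.2

/-- Spatial Fourier transform on `ℝ²`, convention `e^{-i x·ξ}`. -/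
def ft2 (g : V2 → ℂ) (ξ : V2) : ℂ :=
  ∫ x : V2, Complex.exp (-Complex.I * ((⟪x, ξ⟫ : ℝ) : ℂ)) * g x

/-- Inverse spatial Fourier transform on `ℝ²`. -/
def ift2 (G : V2 → ℂ) (x : V2) : ℂ :=
  ((((2 * π) ^ 2)⁻¹ : ℝ) : ℂ) *
    ∫ ξ : V2, Complex.exp (Complex.I * ((⟪x, ξ⟫ : ℝ) : ℂ)) * G ξ

/-- The spatial Fourier multiplier `D_x^a` with symbol `|ξ|^a`, acting on functions
on space-time for each fixed time. -/
def DxA (a : ℝ) (u : ℝ × V2 → ℂ) : ℝ × V2 → ℂ :=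
  fun p => ift2 (fun ξ => ((‖ξ‖ ^ a : ℝ) : ℂ) * ft2 (fun y => u (p.1, y)) ξ) p.2

/-- Entrywise coercion of a Schwartz matrix-valued function to a matrix of functions. -/
def cF {n : ℕ} (A : Fin n → Fin n → SchwartzMap (ℝ × V2) ℂ) :
    Fin n → Fin n → (ℝ × V2 → ℂ) :=
  fun i k => ⇑(A i k)

/-- Entrywise commutator `[U,V] = UV - VU` of matrix-valued functions. -/
def mcomm {n : ℕ} (U V : Fin n → Fin n → (ℝ × V2 → ℂ)) (i k : Fin n) :
    ℝ × V2 → ℂ :=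
  fun p => (∑ l, U i l p * V l k p) - ∑ l, V i l p * U l k p

/-- The matrix `∂ⱼ f` of spatial partial derivatives of a Schwartz matrix-valued map. -/
def pdf {n : ℕ} (j : Fin 2) (f : Fin n → Fin n → SchwartzMap (ℝ × V2) ℂ) :
    Fin n → Fin n → (ℝ × V2 → ℂ) :=
  fun i k => pdx j ⇑(f i k)

/-- `H^{s,θ}` norm of a matrix-valued function, applied entrywise and summed. -/
def HNM {n : ℕ} (s θ : ℝ) (U : Fin n → Fin n → (ℝ × V2 → ℂ)) : ℝ≥0∞ :=
  ∑ i, ∑ k, HN s θ (U i k)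

/-- `‖∇f‖_{H^{s,θ}} = (‖∂₁f‖² + ‖∂₂f‖²)^{1/2}`. -/
def gradN {n : ℕ} (s θ : ℝ) (f : Fin n → Fin n → SchwartzMap (ℝ × V2) ℂ) : ℝ≥0∞ :=
  (HNM s θ (pdf 0 f) ^ (2 : ℕ) + HNM s θ (pdf 1 f) ^ (2 : ℕ)) ^ ((1 : ℝ) / 2)

/-- The elliptic equation
`△A₀ = -∂₁[A₀,∂₂f] + ∂₂[A₀,∂₁f] + ∂₁[∂₁f,φ] + ∂₂[∂₂f,φ]`, holding pointwise. -/
def EllipticEq {n : ℕ} (A0 f φ : Fin n → Fin n → SchwartzMap (ℝ × V2) ℂ) : Prop :=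
  ∀ (i k : Fin n) (p : ℝ × V2),
    pdx 0 (pdx 0 ⇑(A0 i k)) p + pdx 1 (pdx 1 ⇑(A0 i k)) p =
      -pdx 0 (mcomm (cF A0) (pdf 1 f) i k) p + pdx 1 (mcomm (cF A0) (pdf 0 f) i k) p +
        pdx 0 (mcomm (pdf 0 f) (cF φ) i k) p + pdx 1 (mcomm (pdf 1 f) (cF φ) i k) p

/-- Pointwise norm of a matrix of functions (entrywise and summed). -/
def mE {n : ℕ} (U : Fin n → Fin n → (ℝ × V2 → ℂ)) (p : ℝ × V2) : ℝ≥0∞ :=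
  ∑ i, ∑ k, (‖U i k p‖₊ : ℝ≥0∞)

/-- Entrywise application of the multiplier `D_x^a` to a matrix of functions. -/
def DxU {n : ℕ} (a : ℝ) (U : Fin n → Fin n → (ℝ × V2 → ℂ)) :
    Fin n → Fin n → (ℝ × V2 → ℂ) :=
  fun i k => DxA a (U i k)

/-- Spatial `L^q` norm of a matrix-valued function at fixed time `t`. -/
def LqAt {n : ℕ} (q : ℝ) (U : Fin n → Fin n → (ℝ × V2 → ℂ)) (t : ℝ) : ℝ≥0∞ :=
  (∫⁻ x : V2, mE U (t, x) ^ q) ^ q⁻¹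

/-- `L^p` norm in time, written in terms of `rp = 1/p ∈ [0,1]`; `rp = 0` is `L^∞`. -/
def LtR (rp : ℝ) (F : ℝ → ℝ≥0∞) : ℝ≥0∞ :=
  if rp = 0 then essSup F volume else (∫⁻ t : ℝ, F t ^ rp⁻¹) ^ rp

/-- `L^p` norm in time, `p` finite. -/
def Ltp (p : ℝ) (F : ℝ → ℝ≥0∞) : ℝ≥0∞ :=
  (∫⁻ t : ℝ, F t ^ p) ^ p⁻¹

/-- `L^p_t L^∞_x` bound for `A₀` (Corollary 5.4): for `1/4 < s < 1/2`, `θ > 1/2` and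
`1 - 2s < 1/p < 1/2`, there exist `ε₀ > 0` and `C` such that any Schwartz
matrix-valued solution of
`△A₀ = -∂₁[A₀,∂₂f] + ∂₂[A₀,∂₁f] + ∂₁[∂₁f,φ] + ∂₂[∂₂f,φ]` with
`‖∇f‖_{H^{s,θ}} ≤ ε₀` satisfies
`‖A₀‖_{L^p_t L^∞_x} = (∫ (sup_x ‖A₀(t,x)‖)^p dt)^{1/p} ≤ C ‖φ‖_{H^{s,θ}} ‖∇f‖_{H^{s,θ}}`. -/
local notation "SM" => SchwartzMap (ℝ × V2) ℂ
local notation "oR" => ENNReal.ofReal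
local notation "EN" => ℝ≥0∞

abbrev E3 : Type := WithLp 2 (ℝ × V2)

def toE3 (u : SM) : SchwartzMap E3 ℂ :=
  SchwartzMap.compCLMOfContinuousLinearEquiv ℝ (WithLp.prodContinuousLinearEquiv 2 ℝ ℝ V2) u

lemma toE3_apply (u : SM) (x : E3) : toE3 u x = u (WithLp.ofLp x) := rfl

open FourierTransform in
lemma ftST_eq (u : SM) (q : ℝ × V2) :
    ftST u q.1 q.2 = (𝓕 (toE3 u)) ((2 * π)⁻¹ • WithLp.toLp 2 q) := by
  rw [SchwartzMap.fourier_coe, Real.fourier_eq']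
  rw [ftST, ← (WithLp.volume_preserving_ofLp ℝ V2).integral_comp
    (MeasurableEquiv.toLp 2 (ℝ × V2)).symm.measurableEmbedding]
  congr 1
  ext x
  rw [toE3_apply, smul_eq_mul]
  congr 2
  rw [inner_smul_right]
  simp only [WithLp.prod_inner_apply]
  have : (π : ℂ) ≠ 0 := by exact_mod_cast Real.pi_ne_zero
  simp [WithLp.ofLp_fst, WithLp.ofLp_snd]
  field_simp

open FourierTransform in
lemma ftST_integrable (u : SM) :
    Integrable (fun q : ℝ × V2 => ftST u q.1 q.2) := by
  have h : Integrable (fun x : E3 => (𝓕 (toE3 u)) ((2 * π)⁻¹ • x)) :=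
    (SchwartzMap.integrable (𝓕 (toE3 u))).comp_smul (by positivity)
  have h2 := (WithLp.volume_preserving_toLp ℝ V2).integrable_comp_emb
    (g := fun x : E3 => (𝓕 (toE3 u)) ((2 * π)⁻¹ • x))
    (MeasurableEquiv.toLp 2 (ℝ × V2)).measurableEmbedding
  refine (h2.2 h).congr (Filter.Eventually.of_forall fun q => ?_)
  simp only [Function.comp]
  rw [ftST_eq]

open FourierTransform in
lemma ftST_continuous (u : SM) :
    Continuous (fun q : ℝ × V2 => ftST u q.1 q.2) := by
  simp_rw [ftST_eq]
  have := (𝓕 (toE3 u)).continuous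
  have h2 : Continuous (fun q : ℝ × V2 => WithLp.toLp 2 q) := WithLp.prod_continuous_toLp 2 ℝ V2
  fun_prop

open FourierTransform in
lemma ftST_inv : ∃ c : ℂ, ∀ (u : SM) (p : ℝ × V2),
    u p = c * ∫ q : ℝ × V2, Complex.exp (Complex.I * ((p.1 * q.1 + ⟪p.2, q.2⟫ : ℝ) : ℂ)) *
      ftST u q.1 q.2 := by
  refine ⟨((|((2 * π)⁻¹ ^ Module.finrank ℝ E3)| : ℝ) : ℂ), fun u p => ?_⟩
  have h1 : u p = (𝓕⁻ (𝓕 (toE3 u))) (WithLp.toLp 2 p) := by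
    rw [FourierTransform.fourierInv_fourier_eq, toE3_apply]
  rw [h1, SchwartzMap.fourierInv_coe, Real.fourierInv_eq']
  have h2 := Measure.integral_comp_smul (volume : Measure E3) 
    (fun v : E3 => Complex.exp (((2 * π * ⟪v, WithLp.toLp 2 p⟫ : ℝ) : ℂ) * Complex.I) • (𝓕 (toE3 u)) v) ((2 * π)⁻¹)
  have h3 : (∫ q : ℝ × V2, Complex.exp (Complex.I * ((p.1 * q.1 + ⟪p.2, q.2⟫ : ℝ) : ℂ)) *
      ftST u q.1 q.2) = ∫ v : E3, Complex.exp (((2 * π * ⟪((2 * π)⁻¹ • v : E3), WithLp.toLp 2 p⟫ : ℝ) : ℂ) * Complex.I) • (𝓕 (toE3 u)) ((2 * π)⁻¹ • v) := by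
    rw [← (WithLp.volume_preserving_ofLp ℝ V2).integral_comp
      (MeasurableEquiv.toLp 2 (ℝ × V2)).symm.measurableEmbedding]
    congr 1
    ext x
    rw [ftST_eq, smul_eq_mul]
    congr 2
    rw [inner_smul_left]
    simp only [WithLp.prod_inner_apply]
    have : (π : ℂ) ≠ 0 := by exact_mod_cast Real.pi_ne_zero
    simp [WithLp.ofLp_fst, WithLp.ofLp_snd]
    field_simp
    simp [real_inner_comm]
  rw [h3, h2]
  rw [Complex.real_smul, ← mul_assoc]
  have h4 : ((|((2 * π)⁻¹ ^ Module.finrank ℝ E3)| : ℝ) : ℂ) * ((|((2 * π)⁻¹ ^ Module.finrank ℝ E3)⁻¹| : ℝ) : ℂ) = 1 := by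
    rw [← Complex.ofReal_mul, ← abs_mul, mul_inv_cancel₀ (by positivity)]; simp
  rw [h4, one_mul]

def mk2 : (ℝ × ℝ) ≃ᵐ V2 :=
  (MeasurableEquiv.finTwoArrow (α := ℝ)).symm.trans (MeasurableEquiv.toLp 2 (Fin 2 → ℝ))



lemma mk2_mp : MeasurePreserving mk2 :=
  (PiLp.volume_preserving_toLp (Fin 2)).comp (volume_preserving_finTwoArrow ℝ).symm

def pol (r φ : ℝ) : V2 := !₂[r * cos φ, r * sin φ]

lemma norm_pol (r φ : ℝ) : ‖pol r φ‖ = |r| := by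
  rw [pol, EuclideanSpace.norm_eq]
  simp only [Fin.sum_univ_two, Real.norm_eq_abs, sq_abs]
  simp only [PiLp.toLp_apply, Matrix.cons_val_zero, Matrix.cons_val_one]
  rw [← Real.sqrt_sq_eq_abs]
  congr 1
  nlinarith [sin_sq_add_cos_sq φ]

lemma inner_pol (y : V2) (r φ : ℝ) : ⟪y, pol r φ⟫ = r * (y 0 * cos φ + y 1 * sin φ) := by
  rw [pol, PiLp.inner_apply]
  simp [Fin.sum_univ_two]
  ring

lemma integral_polar (f : V2 → ℂ) :
    ∫ ξ, f ξ = ∫ p in Set.Ioi (0:ℝ) ×ˢ Set.Ioo (-π) π, p.1 • f (pol p.1 p.2) := by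
  rw [← mk2_mp.integral_comp mk2.measurableEmbedding, ← integral_comp_polarCoord_symm]
  rfl

lemma lintegral_polar (f : V2 → EN) :
    ∫⁻ ξ, f ξ = ∫⁻ p in Set.Ioi (0:ℝ) ×ˢ Set.Ioo (-π) π, oR p.1 * f (pol p.1 p.2) := by
  rw [← mk2_mp.lintegral_comp_emb mk2.measurableEmbedding, ← lintegral_comp_polarCoord_symm]
  rfl

lemma intOn_r_exp {b : ℝ} (hb : 0 < b) : IntegrableOn (fun r : ℝ => r * rexp (-b * r)) (Set.Ioi 0) := by
  have := integrableOn_rpow_mul_exp_neg_mul_rpow (p := 1) (s := 1) (by norm_num) (by norm_num) hb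
  simpa using this

lemma integral_r_exp {a : ℂ} (ha : 0 < a.re) :
    ∫ r : ℝ in Set.Ioi 0, (r : ℂ) * Complex.exp (-a * r) = (a ^ 2)⁻¹ := by
  have ha0 : a ≠ 0 := by rintro rfl; simp at ha
  have hd : ∀ r ∈ Set.Ici (0:ℝ), HasDerivAt (fun r : ℝ => -((r : ℂ) / a + (a^2)⁻¹) * Complex.exp (-a * r))
      ((r : ℂ) * Complex.exp (-a * r)) r := by
    intro r _
    have h1 : HasDerivAt (fun r : ℝ => (r : ℂ)) 1 r := Complex.ofRealCLM.hasDerivAt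
    have h2 := (((h1.div_const a).add_const ((a^2)⁻¹)).neg).mul ((h1.const_mul (-a)).cexp)
    refine h2.congr_deriv ?_
    simp only [Pi.neg_apply]
    field_simp
    ring
  have hint : IntegrableOn (fun r : ℝ => (r : ℂ) * Complex.exp (-a * r)) (Set.Ioi 0) := by
    refine (intOn_r_exp ha).mono' (by fun_prop) ?_
    filter_upwards [self_mem_ae_restrict measurableSet_Ioi] with r hr
    rw [norm_mul, Complex.norm_exp, Complex.norm_real, Real.norm_eq_abs, abs_of_pos hr]
    simp
  have hlim : Filter.Tendsto (fun r : ℝ => -((r : ℂ) / a + (a^2)⁻¹) * Complex.exp (-a * r)) Filter.atTop (nhds 0) := by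
    rw [tendsto_zero_iff_norm_tendsto_zero]
    have h1 : Filter.Tendsto (fun r : ℝ => (‖a‖⁻¹ * (r ^ (1:ℝ) * rexp (-a.re * r)) + ‖(a^2)⁻¹‖ * (r ^ (0:ℝ) * rexp (-a.re * r)))) Filter.atTop (nhds (‖a‖⁻¹ * 0 + ‖(a^2)⁻¹‖ * 0)) :=
      ((tendsto_rpow_mul_exp_neg_mul_atTop_nhds_zero 1 _ ha).const_mul _).add ((tendsto_rpow_mul_exp_neg_mul_atTop_nhds_zero 0 _ ha).const_mul _)
    simp only [mul_zero, add_zero] at h1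
    refine squeeze_zero' (Filter.Eventually.of_forall fun r => norm_nonneg _) ?_ h1
    filter_upwards [Filter.eventually_gt_atTop 0] with r hr
    rw [norm_mul, Complex.norm_exp, norm_neg]
    have : ‖(r:ℂ) / a + (a^2)⁻¹‖ ≤ ‖a‖⁻¹ * r + ‖(a^2)⁻¹‖ := by
      refine (norm_add_le _ _).trans ?_
      rw [norm_div, Complex.norm_real, Real.norm_eq_abs, abs_of_pos hr, div_eq_inv_mul]
    have h3 : (-a * (r:ℂ)).re = -a.re * r := by simp
    rw [h3]
    simp only [rpow_one, rpow_zero]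
    nlinarith [exp_pos (-a.re * r)]
  have := integral_Ioi_of_hasDerivAt_of_tendsto' hd hint hlim
  rw [this]; simp

def cc (y : V2) (φ : ℝ) : ℝ := y 0 * cos φ + y 1 * sin φ
def cs (y : V2) (φ : ℝ) : ℝ := -(y 0 * sin φ) + y 1 * cos φ

lemma cc_deriv (y : V2) (φ : ℝ) : HasDerivAt (cc y) (cs y φ) φ := by
  have := ((hasDerivAt_cos φ).const_mul (y 0)).add ((hasDerivAt_sin φ).const_mul (y 1))
  refine this.congr_deriv ?_
  simp only [cs]; ring
lemma cs_deriv (y : V2) (φ : ℝ) : HasDerivAt (cs y) (-cc y φ) φ := by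
  have := ((hasDerivAt_sin φ).const_mul (y 0)).neg.add ((hasDerivAt_cos φ).const_mul (y 1))
  refine this.congr_deriv ?_
  simp only [cc]; ring
lemma norm_sq_V2 (y : V2) : ‖y‖ ^ 2 = y 0 ^ 2 + y 1 ^ 2 := by
  rw [EuclideanSpace.norm_sq_eq]; simp [Fin.sum_univ_two]
lemma cc_cs (y : V2) (φ : ℝ) : cc y φ ^ 2 + cs y φ ^ 2 = ‖y‖ ^ 2 := by
  rw [norm_sq_V2]; simp only [cc, cs]; linear_combination (y 0 ^ 2 + y 1 ^ 2) * sin_sq_add_cos_sq φ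
lemma cc_cont (y : V2) : Continuous (cc y) := by unfold cc; fun_prop

def DD (z : ℂ) (y : V2) (l φ : ℝ) : ℂ := z + Complex.I * (l : ℂ) * (cc y φ : ℂ)

lemma DD_re (z : ℂ) (y : V2) (l φ : ℝ) : (DD z y l φ).re = z.re := by
  simp [DD]

lemma DD_ne {z : ℂ} (hz : 0 < z.re) (y : V2) (l φ : ℝ) : DD z y l φ ≠ 0 := by
  intro h; have := DD_re z y l φ; rw [h] at this; simp at this; linarith

lemma DD_norm {z : ℂ} (y : V2) (l φ : ℝ) : z.re ≤ ‖DD z y l φ‖ := by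
  rw [← DD_re z y l φ]; exact Complex.re_le_norm _

def JJ (z : ℂ) (y : V2) (l : ℝ) : ℂ := ∫ φ in (-π)..π, (DD z y l φ ^ 2)⁻¹
def JJ' (z : ℂ) (y : V2) (l : ℝ) : ℂ := ∫ φ in (-π)..π, -(2 * Complex.I * (cc y φ : ℂ)) * (DD z y l φ ^ 3)⁻¹

lemma DD_cont (z : ℂ) (y : V2) (l : ℝ) : Continuous (DD z y l) := by
  have := cc_cont y
  unfold DD; fun_prop

lemma JJ_deriv {z : ℂ} (hz : 0 < z.re) (y : V2) (l : ℝ) : HasDerivAt (JJ z y) (JJ' z y l) l := by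
  have hc := cc_cont y
  have key := intervalIntegral.hasDerivAt_integral_of_dominated_loc_of_deriv_le (μ := volume) (a := -π) (b := π)
    (F := fun l φ => (DD z y l φ ^ 2)⁻¹) (F' := fun l φ => -(2 * Complex.I * (cc y φ : ℂ)) * (DD z y l φ ^ 3)⁻¹)
    (x₀ := l) (s := Set.univ) (bound := fun φ => 2 * |cc y φ| * (z.re ^ 3)⁻¹) Filter.univ_mem ?_ ?_ ?_ ?_ ?_ ?_
  · exact key.2
  · refine Filter.Eventually.of_forall fun l => Continuous.aestronglyMeasurable ?_
    exact ((DD_cont z y l).pow 2).inv₀ fun φ => pow_ne_zero _ (DD_ne hz y l φ)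
  · refine Continuous.intervalIntegrable ?_ _ _
    exact ((DD_cont z y l).pow 2).inv₀ fun φ => pow_ne_zero _ (DD_ne hz y l φ)
  · refine Continuous.aestronglyMeasurable ?_
    refine Continuous.mul (by fun_prop) ?_
    exact ((DD_cont z y l).pow 3).inv₀ fun φ => pow_ne_zero _ (DD_ne hz y l φ)
  · refine Filter.Eventually.of_forall fun φ _ l _ => ?_
    rw [norm_mul, norm_neg, norm_mul, norm_mul, Complex.norm_I, norm_inv, norm_pow, Complex.norm_real]
    simp only [Real.norm_eq_abs, Complex.norm_ofNat, mul_one]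
    gcongr
    exact DD_norm y l φ
  · refine Continuous.intervalIntegrable ?_ _ _
    fun_prop
  · refine Filter.Eventually.of_forall fun φ _ l _ => ?_
    have h1 : HasDerivAt (fun r : ℝ => (r : ℂ)) 1 l := Complex.ofRealCLM.hasDerivAt
    have h2 : HasDerivAt (fun l => DD z y l φ) (Complex.I * (cc y φ : ℂ)) l := by
      have := ((h1.const_mul Complex.I).mul_const (cc y φ : ℂ)).const_add z
      simpa [DD] using this
    have h3 := (h2.pow 2).inv (pow_ne_zero _ (DD_ne hz y l φ))
    refine h3.congr_deriv ?_
    have := DD_ne hz y l φ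
    field_simp
    simp; ring

lemma JJ_ode {z : ℂ} (hz : 0 < z.re) (y : V2) (l : ℝ) :
    (z ^ 2 + (l : ℂ) ^ 2 * (‖y‖ : ℂ) ^ 2) * JJ' z y l + 3 * l * (‖y‖ : ℂ) ^ 2 * JJ z y l = 0 := by
  have hc := cc_cont y
  have hI : ∀ k : ℕ, Continuous fun φ => (DD z y l φ ^ k)⁻¹ := fun k =>
    ((DD_cont z y l).pow k).inv₀ fun φ => pow_ne_zero _ (DD_ne hz y l φ)
  have hI2 := hI 2
  have hI3 := hI 3
  rw [JJ, JJ', ← intervalIntegral.integral_const_mul, ← intervalIntegral.integral_const_mul,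
    ← intervalIntegral.integral_add]
  rotate_left
  · exact Continuous.intervalIntegrable (by fun_prop) _ _
  · exact Continuous.intervalIntegrable (by fun_prop) _ _
  have hd : ∀ φ ∈ Set.uIcc (-π) π, HasDerivAt (fun φ => (cs y φ : ℂ) * (2 * Complex.I * z - l * (cc y φ : ℂ)) * (DD z y l φ ^ 2)⁻¹)
     ((z ^ 2 + (l : ℂ) ^ 2 * (‖y‖ : ℂ) ^ 2) * (-(2 * Complex.I * (cc y φ : ℂ)) * (DD z y l φ ^ 3)⁻¹) + 3 * l * (‖y‖ : ℂ) ^ 2 * (DD z y l φ ^ 2)⁻¹) φ := by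
    intro φ _
    have h1 := (cc_deriv y φ).ofReal_comp
    have h2 := (cs_deriv y φ).ofReal_comp
    have hD : HasDerivAt (DD z y l) (Complex.I * l * (cs y φ : ℂ)) φ := (h1.const_mul _).const_add z
    have h3 := (hD.pow 2).inv (pow_ne_zero _ (DD_ne hz y l φ))
    have h4 := (h2.mul ((h1.const_mul (l : ℂ)).const_sub (2 * Complex.I * z))).mul h3
    refine h4.congr_deriv ?_
    have hne := DD_ne hz y l φ
    have hcs : (‖y‖ : ℂ) ^ 2 = (cc y φ : ℂ) ^ 2 + (cs y φ : ℂ) ^ 2 := by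
      exact_mod_cast (cc_cs y φ).symm
    rw [hcs]
    simp only [Pi.mul_apply, Pi.pow_apply, Pi.inv_apply]
    have hDe : DD z y l φ = z + Complex.I * l * (cc y φ : ℂ) := rfl
    set D := DD z y l φ
    set c := (cc y φ : ℂ)
    set e := (cs y φ : ℂ)
    have hi : Complex.I ^ 2 = -1 := Complex.I_sq
    have hz' : z = D - Complex.I * l * c := by rw [hDe]; ring
    push_cast
    rw [hz']
    generalize Complex.I = i at *
    field_simp
    linear_combination (-2 * (D-i*l*c) * l * e^2 - 2*D*l*c^2 - 2*D*l*e^2 + 2*c*i*l^2*e^2 + 2*c^3*i*l^2) * hi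
  rw [intervalIntegral.integral_eq_sub_of_hasDerivAt hd]
  · simp [cs, cc, DD]
  · exact Continuous.intervalIntegrable (by fun_prop) _ _

lemma JJ_eval {z : ℂ} (hz : 0 < z.re) (y : V2) :
    JJ z y 1 ^ 2 * (z ^ 2 + (‖y‖ : ℂ) ^ 2) ^ 3 = (2 * π * z) ^ 2 := by
  have hd : ∀ l : ℝ, HasDerivAt (fun l : ℝ => JJ z y l ^ 2 * (z ^ 2 + (l : ℂ) ^ 2 * (‖y‖ : ℂ) ^ 2) ^ 3) 0 l := by
    intro l
    have h1 : HasDerivAt (fun r : ℝ => (r : ℂ)) 1 l := Complex.ofRealCLM.hasDerivAt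
    have h2 := ((JJ_deriv hz y l).pow 2).mul ((((h1.pow 2).mul_const ((‖y‖ : ℂ) ^ 2)).const_add (z ^ 2)).pow 3)
    refine h2.congr_deriv ?_
    simp only [Pi.pow_apply]
    push_cast
    linear_combination (2 * JJ z y l * (z ^ 2 + (l : ℂ) ^ 2 * (‖y‖ : ℂ) ^ 2) ^ 2) * JJ_ode hz y l
  have hc := is_const_of_deriv_eq_zero (fun l => (hd l).differentiableAt) (fun l => (hd l).deriv) 1 0
  have h0 : JJ z y 0 = 2 * π * (z ^ 2)⁻¹ := by
    simp [JJ, DD]; left; ring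
  have hz0 : z ≠ 0 := by rintro rfl; simp at hz
  simp only [h0] at hc
  simp at hc
  rw [hc]; field_simp

lemma JJ_norm {z : ℂ} (hz : 0 < z.re) (y : V2) :
    ‖JJ z y 1‖ * (‖z ^ 2 + (‖y‖ : ℂ) ^ 2‖) ^ (3 / 2 : ℝ) = 2 * π * ‖z‖ := by
  have h := congrArg norm (JJ_eval hz y)
  simp only [norm_mul, norm_pow, Complex.norm_real, Complex.norm_ofNat] at h
  rw [← sq_eq_sq₀ (by positivity) (by positivity), mul_pow, ← Real.rpow_natCast (_ ^ (3 / 2 : ℝ)), ← Real.rpow_mul (by positivity)]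
  rw [norm_eq_abs, abs_of_pos pi_pos] at h
  rw [← h]
  norm_num

lemma poisson_JJ {z : ℂ} (hz : 0 < z.re) (y : V2) :
    ∫ ξ : V2, Complex.exp (-z * (‖ξ‖ : ℂ)) * Complex.exp (-Complex.I * ((⟪y, ξ⟫ : ℝ) : ℂ)) = JJ z y 1 := by
  rw [integral_polar]
  have h1 : ∀ p ∈ Set.Ioi (0:ℝ) ×ˢ Set.Ioo (-π) π, p.1 • (Complex.exp (-z * (‖pol p.1 p.2‖ : ℂ)) * Complex.exp (-Complex.I * ((⟪y, pol p.1 p.2⟫ : ℝ) : ℂ)))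
     = (p.1 : ℂ) * Complex.exp (-(DD z y 1 p.2) * p.1) := by
    intro p hp
    rw [norm_pol, abs_of_pos hp.1, inner_pol, Complex.real_smul, ← Complex.exp_add]
    congr 2
    simp only [DD, cc]; push_cast; ring
  rw [setIntegral_congr_fun (measurableSet_Ioi.prod measurableSet_Ioo) h1]
  rw [Measure.volume_eq_prod, ← Measure.prod_restrict, integral_prod_symm]
  · rw [JJ, intervalIntegral.integral_of_le (by linarith [pi_pos]), integral_Ioc_eq_integral_Ioo]
    congr 1
    ext φ
    exact integral_r_exp (a := DD z y 1 φ) (by rw [DD_re]; exact hz)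
  · have hint : Integrable (fun p : ℝ × ℝ => (p.1 * rexp (-z.re * p.1)) * 1) ((volume.restrict (Set.Ioi 0)).prod (volume.restrict (Set.Ioo (-π) π))) := by
      refine Integrable.mul_prod (f := fun r : ℝ => r * rexp (-z.re * r)) (g := fun _ => (1:ℝ)) (intOn_r_exp hz) ?_
      exact integrable_const _
    refine hint.mono' ?_ ?_
    · refine Continuous.aestronglyMeasurable ?_
      have := DD_cont z y 1
      fun_prop
    · rw [Measure.prod_restrict]
      filter_upwards [self_mem_ae_restrict (measurableSet_Ioi.prod measurableSet_Ioo)] with p hp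
      rw [norm_mul, Complex.norm_exp, Complex.norm_real, Real.norm_eq_abs, abs_of_pos hp.1]
      have : (-(DD z y 1 p.2) * (p.1:ℂ)).re = -z.re * p.1 := by
        simp [DD_re]
      rw [this]; simp

/-- Modulus of the Poisson kernel at complex height. -/
def QQ (ρ T r : ℝ) : ℝ := √(ρ ^ 2 + T ^ 2) * (((r - T) ^ 2 + ρ ^ 2) * ((r + T) ^ 2 + ρ ^ 2)) ^ (-(3 / 4 : ℝ))



lemma poisson_norm {ρ : ℝ} (hρ : 0 < ρ) (T : ℝ) (y : V2) :
    ‖∫ ξ : V2, Complex.exp (-((ρ : ℂ) + Complex.I * T) * (‖ξ‖ : ℂ)) * Complex.exp (-Complex.I * ((⟪y, ξ⟫ : ℝ) : ℂ))‖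
      = 2 * π * QQ ρ T ‖y‖ := by
  have hz : 0 < ((ρ : ℂ) + Complex.I * T).re := by simpa using hρ
  rw [poisson_JJ hz]
  have h := JJ_norm hz y
  set r := ‖y‖
  have h1 : ‖(ρ : ℂ) + Complex.I * T‖ = √(ρ ^ 2 + T ^ 2) := by
    rw [mul_comm, Complex.norm_add_mul_I]
  have h2 : ‖((ρ : ℂ) + Complex.I * T) ^ 2 + (r : ℂ) ^ 2‖ = √(((r - T) ^ 2 + ρ ^ 2) * ((r + T) ^ 2 + ρ ^ 2)) := by
    have : ((ρ : ℂ) + Complex.I * T) ^ 2 + (r : ℂ) ^ 2 = ((ρ ^ 2 - T ^ 2 + r ^ 2 : ℝ) : ℂ) + ((2 * ρ * T : ℝ) : ℂ) * Complex.I := by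
      push_cast
      linear_combination ((T : ℂ) ^ 2) * Complex.I_sq
    rw [this, Complex.norm_add_mul_I]
    congr 1; ring
  rw [h1, h2] at h
  set S := ((r - T) ^ 2 + ρ ^ 2) * ((r + T) ^ 2 + ρ ^ 2) with hS
  have hSpos : 0 < S := by positivity
  have h3 : √S ^ (3 / 2 : ℝ) * S ^ (-(3 / 4 : ℝ)) = 1 := by
    rw [Real.sqrt_eq_rpow, ← Real.rpow_mul hSpos.le, ← Real.rpow_add hSpos]; norm_num
  calc _ = ‖JJ ((ρ : ℂ) + Complex.I * T) y 1‖ * (√S ^ (3 / 2 : ℝ) * S ^ (-(3 / 4 : ℝ))) := by rw [h3, mul_one]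
    _ = _ := by rw [← mul_assoc, h, QQ]; ring

lemma lint_cs {α : Type*} [MeasurableSpace α] (μ : Measure α) {f g : α → EN}
    (hf : AEMeasurable f μ) (hg : AEMeasurable g μ) :
    (∫⁻ a, f a * g a ∂μ) ^ 2 ≤ (∫⁻ a, f a ^ 2 ∂μ) * ∫⁻ a, g a ^ 2 ∂μ := by
  have h := ENNReal.lintegral_mul_le_Lp_mul_Lq μ Real.HolderConjugate.two_two hf hg
  simp only [Pi.mul_apply, ENNReal.rpow_two] at h
  calc _ ≤ _ := pow_le_pow_left₀ (zero_le) h 2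
    _ = _ := by
      rw [mul_pow, ← ENNReal.rpow_natCast, ← ENNReal.rpow_mul, ← ENNReal.rpow_natCast, ← ENNReal.rpow_mul]
      norm_num

lemma exp_norm_integrable {ρ : ℝ} (hρ : 0 < ρ) : Integrable (fun ξ : V2 => rexp (-ρ * ‖ξ‖)) := by
  have := (MeasureTheory.integrable_fun_norm_addHaar (μ := (volume : Measure V2)) (f := fun r => rexp (-ρ * r))).2 ?_
  · exact this
  · simp
    simpa using intOn_r_exp hρ

/-- phase -/
def ph (p q : ℝ × V2) : ℂ := Complex.exp (Complex.I * ((p.1 * q.1 + ⟪p.2, q.2⟫ : ℝ) : ℂ))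

lemma ph_norm (p q) : ‖ph p q‖ = 1 := by
  rw [ph, mul_comm, Complex.norm_exp_ofReal_mul_I]

lemma ph_cont : Continuous fun z : (ℝ × V2) × (ℝ × V2) => ph z.1 z.2 := by
  unfold ph; fun_prop

/-- adjoint transform -/
def HH (m : Measure (ℝ × V2)) (G : ℝ × V2 → ℂ) (q : ℝ × V2) : ℂ := ∫ p, ph p q * G p ∂m

lemma HH_norm {m : Measure (ℝ × V2)} {G : ℝ × V2 → ℂ} (q) : ‖HH m G q‖ ≤ ∫ p, ‖G p‖ ∂m := by
  refine (norm_integral_le_integral_norm _).trans (le_of_eq ?_)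
  simp [ph_norm]

lemma HH_cont {m : Measure (ℝ × V2)} {G : ℝ × V2 → ℂ} (hG : Integrable G m) : Continuous (HH m G) := by
  refine continuous_of_dominated (bound := fun p => ‖G p‖) ?_ ?_ hG.norm ?_
  · intro q
    refine AEStronglyMeasurable.mul ?_ hG.1
    exact (ph_cont.comp (by fun_prop : Continuous fun p => (p, q))).aestronglyMeasurable
  · intro q; refine Filter.Eventually.of_forall fun p => ?_
    simp [ph_norm]
  · refine Filter.Eventually.of_forall fun p => ?_
    exact (ph_cont.comp (by fun_prop : Continuous fun q => (p, q))).mul continuous_const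

lemma duality : ∃ c : ℂ, ∀ (u : SM) (m : Measure (ℝ × V2)) [SFinite m] (G : ℝ × V2 → ℂ),
    Integrable G m → ∫ p, u p * G p ∂m = c * ∫ q : ℝ × V2, ftST u q.1 q.2 * HH m G q := by
  obtain ⟨c, hc⟩ := ftST_inv
  refine ⟨c, fun u m _ G hG => ?_⟩
  have h1 : ∀ p, u p * G p = c * ∫ q : ℝ × V2, ph p q * ftST u q.1 q.2 * G p := by
    intro p
    rw [hc u p, integral_mul_const, mul_assoc]; rfl
  simp_rw [h1]
  rw [integral_const_mul, integral_integral_swap]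
  · congr 2; ext q
    rw [HH, ← integral_const_mul]
    congr 1; ext p; ring
  · have h2 := hG.mul_prod (ftST_integrable u)
    refine h2.mono ?_ ?_
    · have : (Function.uncurry fun p (q : ℝ × V2) => ph p q * ftST u q.1 q.2 * G p) = fun z => ph z.1 z.2 * (G z.1 * ftST u z.2.1 z.2.2) := by
        ext z; simp [Function.uncurry]; ring
      rw [this]
      exact ph_cont.aestronglyMeasurable.mul h2.1
    · refine Filter.Eventually.of_forall fun z => ?_
      simp [Function.uncurry, ph_norm, mul_comm]

lemma QQ_even (ρ T r : ℝ) : QQ ρ (-T) r = QQ ρ T r := by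
  unfold QQ; congr 1
  · congr 1; ring
  · congr 1; ring

lemma QQ_eps (ρ T r : ℝ) {ε : ℝ} (hε : ε = 1 ∨ ε = -1) : QQ ρ (ε * T) r = QQ ρ T r := by
  rcases hε with rfl | rfl
  · simp
  · simp [QQ_even]

lemma QQ_cont {ρ : ℝ} (hρ : 0 < ρ) : Continuous fun z : ℝ × ℝ => QQ ρ z.1 z.2 := by
  unfold QQ
  refine Continuous.mul (by fun_prop) ?_
  refine Continuous.rpow_const (by fun_prop) fun z => Or.inl ?_
  positivity

/-- the bilinear form -/
def KK (m : Measure (ℝ × V2)) (G : ℝ × V2 → ℂ) (ρ : ℝ) : EN :=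
  ∫⁻ z : (ℝ × V2) × (ℝ × V2), ‖G z.1‖ₑ * ‖G z.2‖ₑ * oR (QQ ρ (z.1.1 - z.2.1) ‖z.1.2 - z.2.2‖) ∂(m.prod m)

lemma cone_bound (m : Measure (ℝ × V2)) [SFinite m] (G : ℝ × V2 → ℂ) (hG : Integrable G m)
    {ρ : ℝ} (hρ : 0 < ρ) (σ : ℝ) {ε : ℝ} (hε : ε = 1 ∨ ε = -1) :
    ∫⁻ ξ : V2, oR (rexp (-ρ * ‖ξ‖)) * ‖HH m G (σ + ε * ‖ξ‖, ξ)‖ₑ ^ 2 ≤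
      oR (2 * π) * KK m G ρ := by
  have hHc : Continuous fun ξ : V2 => HH m G (σ + ε * ‖ξ‖, ξ) := (HH_cont hG).comp (by fun_prop)
  -- the complex integral
  have hE := exp_norm_integrable hρ
  set B := ∫ p, ‖G p‖ ∂m
  have hint : Integrable fun ξ : V2 => rexp (-ρ * ‖ξ‖) * ‖HH m G (σ + ε * ‖ξ‖, ξ)‖ ^ 2 := by
    refine (hE.mul_const (B ^ 2)).mono' ?_ ?_
    · exact Continuous.aestronglyMeasurable (by fun_prop)
    · refine Filter.Eventually.of_forall fun ξ => ?_
      rw [Real.norm_eq_abs, abs_of_nonneg (by positivity)]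
      gcongr
      exact HH_norm _
  have e1 : ∫⁻ ξ : V2, oR (rexp (-ρ * ‖ξ‖)) * ‖HH m G (σ + ε * ‖ξ‖, ξ)‖ₑ ^ 2
      = oR (∫ ξ : V2, rexp (-ρ * ‖ξ‖) * ‖HH m G (σ + ε * ‖ξ‖, ξ)‖ ^ 2) := by
    rw [ofReal_integral_eq_lintegral_ofReal hint (Filter.Eventually.of_forall fun ξ => by positivity)]
    congr 1; ext ξ
    rw [ENNReal.ofReal_mul (by positivity), ENNReal.ofReal_pow (by positivity), ofReal_norm]
  rw [e1]
  let F : ((ℝ × V2) × (ℝ × V2)) → V2 → ℂ := fun z ξ =>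
    (G z.1 * (starRingEnd ℂ) (G z.2)) * ((rexp (-ρ * ‖ξ‖) : ℂ) * (ph z.1 (σ + ε * ‖ξ‖, ξ) * (starRingEnd ℂ) (ph z.2 (σ + ε * ‖ξ‖, ξ))))
  have hGG : Integrable (fun z : (ℝ × V2) × (ℝ × V2) => G z.1 * (starRingEnd ℂ) (G z.2)) (m.prod m) :=
    hG.mul_prod (g := fun p => (starRingEnd ℂ) (G p)) (Complex.conjCLE.toContinuousLinearMap.integrable_comp hG)
  have hphc1 : Continuous fun w : ((ℝ × V2) × (ℝ × V2)) × V2 => ph w.1.1 (σ + ε * ‖w.2‖, w.2) :=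
    ph_cont.comp (by fun_prop : Continuous fun w : ((ℝ × V2) × (ℝ × V2)) × V2 => (w.1.1, ((σ + ε * ‖w.2‖, w.2) : ℝ × V2)))
  have hphc2 : Continuous fun w : ((ℝ × V2) × (ℝ × V2)) × V2 => ph w.1.2 (σ + ε * ‖w.2‖, w.2) :=
    ph_cont.comp (by fun_prop : Continuous fun w : ((ℝ × V2) × (ℝ × V2)) × V2 => (w.1.2, ((σ + ε * ‖w.2‖, w.2) : ℝ × V2)))
  have hFint : Integrable (Function.uncurry F) ((m.prod m).prod volume) := by
    have h := hGG.mul_prod (hE.ofReal (𝕜 := ℂ))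
    refine h.mono ?_ ?_
    · have : Function.uncurry F = fun w => ((G w.1.1 * (starRingEnd ℂ) (G w.1.2)) * ((rexp (-ρ * ‖w.2‖) : ℝ) : ℂ)) * (ph w.1.1 (σ + ε * ‖w.2‖, w.2) * (starRingEnd ℂ) (ph w.1.2 (σ + ε * ‖w.2‖, w.2))) := by
        ext w; simp only [Function.uncurry, F]; ring
      rw [this]
      refine h.1.mul (Continuous.aestronglyMeasurable ?_)
      exact hphc1.mul (Complex.continuous_conj.comp hphc2)
    · refine Filter.Eventually.of_forall fun w => ?_
      simp [Function.uncurry, F, ph_norm]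
  have e2 : ((∫ ξ : V2, rexp (-ρ * ‖ξ‖) * ‖HH m G (σ + ε * ‖ξ‖, ξ)‖ ^ 2 : ℝ) : ℂ) = ∫ z, (∫ ξ, F z ξ) ∂(m.prod m) := by
    rw [integral_integral_swap hFint, ← integral_complex_ofReal]
    congr 1; ext ξ
    have : ∀ z : (ℝ × V2) × (ℝ × V2), F z ξ = (rexp (-ρ * ‖ξ‖) : ℂ) * ((ph z.1 (σ + ε * ‖ξ‖, ξ) * G z.1) * (starRingEnd ℂ) (ph z.2 (σ + ε * ‖ξ‖, ξ) * G z.2)) := by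
      intro z; simp only [F, map_mul]; ring
    simp_rw [this]
    rw [integral_const_mul, integral_prod_mul (fun p => ph p (σ + ε * ‖ξ‖, ξ) * G p) (fun p => (starRingEnd ℂ) (ph p (σ + ε * ‖ξ‖, ξ) * G p)), integral_conj]
    change _ = _ * (HH m G _ * (starRingEnd ℂ) (HH m G _))
    rw [Complex.mul_conj, Complex.normSq_eq_norm_sq]
    push_cast; rfl
  have e3 : ∀ z : (ℝ × V2) × (ℝ × V2), ‖∫ ξ, F z ξ‖ = ‖G z.1‖ * ‖G z.2‖ * (2 * π * QQ ρ (z.1.1 - z.2.1) ‖z.1.2 - z.2.2‖) := by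
    intro z
    rw [integral_const_mul, norm_mul, norm_mul, RCLike.norm_conj]
    congr 1
    rw [← QQ_eps ρ (z.1.1 - z.2.1) _ hε, ← QQ_even, ← norm_sub_rev, ← poisson_norm hρ]
    have : ∀ ξ : V2, (rexp (-ρ * ‖ξ‖) : ℂ) * (ph z.1 (σ + ε * ‖ξ‖, ξ) * (starRingEnd ℂ) (ph z.2 (σ + ε * ‖ξ‖, ξ)))
      = Complex.exp (Complex.I * (σ * (z.1.1 - z.2.1) : ℝ)) * (Complex.exp (-((ρ : ℂ) + Complex.I * (-(ε * (z.1.1 - z.2.1)) : ℝ)) * (‖ξ‖ : ℂ)) * Complex.exp (-Complex.I * ((⟪z.2.2 - z.1.2, ξ⟫ : ℝ) : ℂ))) := by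
      intro ξ
      rw [ph, ph, ← Complex.exp_conj, Complex.ofReal_exp, ← Complex.exp_add, ← Complex.exp_add, ← Complex.exp_add, ← Complex.exp_add]
      congr 1
      rw [inner_sub_left]
      simp only [map_mul, Complex.conj_I, Complex.conj_ofReal]
      push_cast
      ring
    simp_rw [this]
    rw [integral_const_mul, norm_mul, mul_comm Complex.I, Complex.norm_exp_ofReal_mul_I, one_mul]
  have e4 : oR (∫ ξ : V2, rexp (-ρ * ‖ξ‖) * ‖HH m G (σ + ε * ‖ξ‖, ξ)‖ ^ 2) = ‖∫ z, (∫ ξ, F z ξ) ∂(m.prod m)‖ₑ := by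
    rw [← e2, ← ofReal_norm, Complex.norm_real, Real.norm_eq_abs, abs_of_nonneg (integral_nonneg fun ξ => by positivity)]
  rw [e4]
  refine (enorm_integral_le_lintegral_enorm _).trans ?_
  rw [KK, ← lintegral_const_mul' _ _ ENNReal.ofReal_ne_top]
  refine lintegral_mono fun z => le_of_eq ?_
  rw [← ofReal_norm, e3, ENNReal.ofReal_mul (by positivity), ENNReal.ofReal_mul (by positivity), ENNReal.ofReal_mul (by positivity), ofReal_norm, ofReal_norm]
  ring

lemma m_lower {s : ℝ} (hs : 0 < s) {r : ℝ} (hr : 0 ≤ r) :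
    oR ((1 + r) ^ (-(2 * s))) ≤ oR (rexp 1 * (2 * s)) *
      ∫⁻ ρ in Set.Ioo (0:ℝ) 1, oR (ρ ^ (2 * s - 1)) * oR (rexp (-ρ * r)) := by
  set a := (1 + r)⁻¹ with ha
  have ha0 : 0 < a := by positivity
  have ha1 : a ≤ 1 := inv_le_one_of_one_le₀ (by linarith)
  have h1 : ∫⁻ ρ in Set.Ioo (0:ℝ) a, oR (ρ ^ (2 * s - 1)) * oR (rexp (-1)) ≤
      ∫⁻ ρ in Set.Ioo (0:ℝ) 1, oR (ρ ^ (2 * s - 1)) * oR (rexp (-ρ * r)) := by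
    refine le_trans ?_ (lintegral_mono_set (Set.Ioo_subset_Ioo_right ha1))
    refine setLIntegral_mono' measurableSet_Ioo fun ρ hρ => ?_
    gcongr
    have : ρ * r ≤ a * (1 + r) := by
      have := hρ.1; have := hρ.2
      nlinarith
    rw [ha, inv_mul_cancel₀ (by positivity)] at this
    linarith
  have h2 : ∫⁻ ρ in Set.Ioo (0:ℝ) a, oR (ρ ^ (2 * s - 1)) = oR (a ^ (2 * s) / (2 * s)) := by
    have hi : IntervalIntegrable (fun x : ℝ => x ^ (2 * s - 1)) volume 0 a :=
      intervalIntegral.intervalIntegrable_rpow' (by linarith)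
    rw [← ofReal_integral_eq_lintegral_ofReal]
    · rw [← integral_Ioc_eq_integral_Ioo, ← intervalIntegral.integral_of_le ha0.le, integral_rpow (Or.inl (by linarith))]
      rw [Real.zero_rpow (by linarith)]; congr 1; ring_nf
    · exact (intervalIntegrable_iff_integrableOn_Ioo_of_le ha0.le).1 hi
    · filter_upwards [self_mem_ae_restrict measurableSet_Ioo] with ρ hρ
      exact Real.rpow_nonneg hρ.1.le _
  rw [lintegral_mul_const' _ _ ENNReal.ofReal_ne_top, h2] at h1
  refine le_trans (le_of_eq ?_) (mul_le_mul_right h1 _)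
  rw [← ENNReal.ofReal_mul (by positivity), ← ENNReal.ofReal_mul (by positivity)]
  congr 1
  rw [ha, Real.inv_rpow (by positivity), Real.rpow_neg (by positivity), Real.exp_neg]
  field_simp

lemma wgt_bound {s θ : ℝ} (hs : 0 < s) (τ : ℝ) (ξ : V2) :
    oR (wgt s θ τ ξ ^ 2)⁻¹ ≤ oR (2 ^ s * (rexp 1 * (2 * s))) *
      ∫⁻ ρ in Set.Ioo (0:ℝ) 1, oR (ρ ^ (2 * s - 1)) * oR (rexp (-ρ * ‖ξ‖)) *
        (oR ((1 + |τ - 1 * ‖ξ‖|) ^ (-(2 * θ))) + oR ((1 + |τ - (-1) * ‖ξ‖|) ^ (-(2 * θ)))) := by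
  set S := (oR ((1 + |τ - 1 * ‖ξ‖|) ^ (-(2 * θ))) + oR ((1 + |τ - (-1) * ‖ξ‖|) ^ (-(2 * θ)))) with hS
  have hSt : S ≠ ⊤ := by simp [hS]
  rw [lintegral_mul_const' _ _ hSt, ENNReal.ofReal_mul (by positivity)]
  have hm := m_lower hs (norm_nonneg ξ)
  have h1 : oR ((1 + |(|τ| - ‖ξ‖)|) ^ (-(2 * θ))) ≤ S := by
    rcases le_total 0 τ with h | h
    · rw [abs_of_nonneg h]; refine le_trans (le_of_eq ?_) le_self_add; simp
    · rw [abs_of_nonpos h]; refine le_trans (le_of_eq ?_) le_add_self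
      congr 3
      rw [← abs_neg]; congr 1; ring
  have h2 : oR ((1 + ‖ξ‖ ^ 2) ^ (-s)) ≤ oR (2 ^ s) * oR ((1 + ‖ξ‖) ^ (-(2 * s))) := by
    rw [← ENNReal.ofReal_mul (by positivity)]
    apply ENNReal.ofReal_le_ofReal
    have h3 : (1 + ‖ξ‖) ^ (-(2 * s)) = ((1 + ‖ξ‖) ^ 2) ^ (-s) := by
      rw [← Real.rpow_natCast, ← Real.rpow_mul (by positivity)]; congr 1; push_cast; ring
    have h4 : (2:ℝ) ^ s = (2⁻¹) ^ (-s) := by rw [Real.rpow_neg (by norm_num), Real.inv_rpow (by norm_num), inv_inv]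
    rw [h3, h4, ← Real.mul_rpow (by positivity) (by positivity)]
    apply Real.rpow_le_rpow_of_nonpos (by positivity) _ (by linarith)
    nlinarith [sq_nonneg (1 - ‖ξ‖)]
  have h5 : (wgt s θ τ ξ ^ 2)⁻¹ = (1 + ‖ξ‖ ^ 2) ^ (-s) * (1 + |(|τ| - ‖ξ‖)|) ^ (-(2 * θ)) := by
    have hp : ∀ (x a : ℝ), 0 ≤ x → ((x ^ a) ^ 2)⁻¹ = x ^ (-(a * 2)) := by
      intro x a hx
      rw [← Real.rpow_natCast, ← Real.rpow_mul hx, ← Real.rpow_neg hx]; norm_num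
    rw [wgt, mul_pow, mul_inv, hp _ _ (by positivity), hp _ _ (by positivity)]
    congr 2 <;> ring
  rw [h5, ENNReal.ofReal_mul (by positivity)]
  calc _ ≤ (oR (2 ^ s) * oR ((1 + ‖ξ‖) ^ (-(2 * s)))) * S := mul_le_mul' h2 h1
    _ ≤ _ := by
      rw [mul_assoc, mul_assoc (oR (2 ^ s)), ← mul_assoc (oR (rexp 1 * (2 * s)))]
      gcongr

lemma HN_sq (s θ : ℝ) (u : ℝ × V2 → ℂ) : HN s θ u ^ 2 = ∫⁻ q : ℝ × V2, (oR (wgt s θ q.1 q.2) * ‖ftST u q.1 q.2‖ₑ) ^ 2 := by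
  rw [HN, ← ENNReal.rpow_natCast, ← ENNReal.rpow_mul]; norm_num; rfl

lemma wgt_pos (s θ τ : ℝ) (ξ : V2) : 0 < wgt s θ τ ξ := by unfold wgt; positivity

lemma wgt_cont (s θ : ℝ) : Continuous fun q : ℝ × V2 => wgt s θ q.1 q.2 := by
  unfold wgt
  refine Continuous.mul ?_ ?_
  · exact Continuous.rpow_const (by fun_prop) fun q => Or.inl (by positivity)
  · exact Continuous.rpow_const (by fun_prop) fun q => Or.inl (by positivity)

lemma japanese {θ : ℝ} (hθ : 1 / 2 < θ) : ∫⁻ σ : ℝ, oR ((1 + |σ|) ^ (-(2 * θ))) ≠ ⊤ := by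
  have := integrable_one_add_norm (E := ℝ) (μ := volume) (r := 2 * θ) (by simp; linarith)
  exact this.lintegral_lt_top.ne

lemma side_bound {s θ : ℝ} (hθ : 1 / 2 < θ) (m : Measure (ℝ × V2)) [SFinite m] (G : ℝ × V2 → ℂ) (hG : Integrable G m)
    {ε : ℝ} (hε : ε = 1 ∨ ε = -1) :
    ∫⁻ q : ℝ × V2, (∫⁻ ρ in Set.Ioo (0:ℝ) 1, oR (ρ ^ (2 * s - 1)) * oR (rexp (-ρ * ‖q.2‖)) *
        oR ((1 + |q.1 - ε * ‖q.2‖|) ^ (-(2 * θ)))) * ‖HH m G q‖ₑ ^ 2 ≤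
    (∫⁻ σ : ℝ, oR ((1 + |σ|) ^ (-(2 * θ)))) * oR (2 * π) *
      ∫⁻ ρ in Set.Ioo (0:ℝ) 1, oR (ρ ^ (2 * s - 1)) * KK m G ρ := by
  have hHm : Measurable fun q => ‖HH m G q‖ₑ ^ 2 := ((HH_cont hG).measurable.enorm).pow_const _
  have hρm : Measurable fun ρ : ℝ => oR (ρ ^ (2 * s - 1)) := by fun_prop
  have hJ : Measurable fun σ : ℝ => oR ((1 + |σ|) ^ (-(2 * θ))) := by fun_prop
  have e1 : ∀ q : ℝ × V2, (∫⁻ ρ in Set.Ioo (0:ℝ) 1, oR (ρ ^ (2 * s - 1)) * oR (rexp (-ρ * ‖q.2‖)) *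
        oR ((1 + |q.1 - ε * ‖q.2‖|) ^ (-(2 * θ)))) * ‖HH m G q‖ₑ ^ 2 =
      ∫⁻ ρ in Set.Ioo (0:ℝ) 1, oR (ρ ^ (2 * s - 1)) * (oR (rexp (-ρ * ‖q.2‖)) *
        oR ((1 + |q.1 - ε * ‖q.2‖|) ^ (-(2 * θ))) * ‖HH m G q‖ₑ ^ 2) := by
    intro q
    rw [← lintegral_mul_const _ (by fun_prop)]
    congr 1; ext ρ; ring
  simp_rw [e1]
  rw [lintegral_lintegral_swap (by
    refine Measurable.aemeasurable ?_
    have := hHm.comp (measurable_fst : Measurable (Prod.fst : (ℝ × V2) × ℝ → ℝ × V2))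
    simp only [Function.uncurry_def]
    refine Measurable.mul (by fun_prop) (Measurable.mul (by fun_prop) this))]
  rw [← lintegral_const_mul' _ _ (ENNReal.mul_ne_top (japanese hθ) ENNReal.ofReal_ne_top)]
  refine setLIntegral_mono' measurableSet_Ioo fun ρ hρ => ?_
  rw [lintegral_const_mul' _ _ ENNReal.ofReal_ne_top, mul_left_comm]
  gcongr
  rw [Measure.volume_eq_prod, lintegral_prod_symm _ (by
    refine Measurable.aemeasurable ?_
    exact Measurable.mul (by fun_prop) hHm)]
  calc _ = ∫⁻ ξ : V2, ∫⁻ σ : ℝ, oR (rexp (-ρ * ‖ξ‖)) *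
        oR ((1 + |σ|) ^ (-(2 * θ))) * ‖HH m G (σ + ε * ‖ξ‖, ξ)‖ₑ ^ 2 := by
        refine lintegral_congr fun ξ => ?_
        rw [← lintegral_add_right_eq_self _ (ε * ‖ξ‖)]
        simp
    _ = ∫⁻ σ : ℝ, ∫⁻ ξ : V2, oR (rexp (-ρ * ‖ξ‖)) *
        oR ((1 + |σ|) ^ (-(2 * θ))) * ‖HH m G (σ + ε * ‖ξ‖, ξ)‖ₑ ^ 2 := by
        refine lintegral_lintegral_swap (Measurable.aemeasurable ?_)
        have := hHm.comp (by fun_prop : Measurable fun z : V2 × ℝ => ((z.2 + ε * ‖z.1‖, z.1) : ℝ × V2))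
        simp only [Function.uncurry_def]
        exact Measurable.mul (by fun_prop) this
    _ ≤ ∫⁻ σ : ℝ, oR ((1 + |σ|) ^ (-(2 * θ))) * (oR (2 * π) * KK m G ρ) := by
        refine lintegral_mono fun σ => ?_
        refine le_trans (le_of_eq ?_) (mul_le_mul_right (cone_bound m G hG hρ.1 σ hε) _)
        rw [← lintegral_const_mul' _ _ ENNReal.ofReal_ne_top]
        congr 1; ext ξ; ring
    _ = _ := by
        rw [lintegral_mul_const _ hJ]; ring

theorem TTstar {s θ : ℝ} (hs : 0 < s) (hθ : 1 / 2 < θ) : ∃ C : EN, C ≠ ⊤ ∧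
    ∀ (u : SM) (m : Measure (ℝ × V2)) [SFinite m] (G : ℝ × V2 → ℂ), Integrable G m →
    ‖∫ p, u p * G p ∂m‖ₑ ^ 2 ≤ C * HN s θ u ^ 2 * ∫⁻ ρ in Set.Ioo (0:ℝ) 1, oR (ρ ^ (2 * s - 1)) * KK m G ρ := by
  obtain ⟨c, hc⟩ := duality
  refine ⟨‖c‖ₑ ^ 2 * (oR (2 ^ s * (rexp 1 * (2 * s))) * (2 * ((∫⁻ σ : ℝ, oR ((1 + |σ|) ^ (-(2 * θ)))) * oR (2 * π)))), ?_, ?_⟩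
  · have := japanese hθ
    finiteness
  intro u m _ G hG
  rw [hc u m G hG, enorm_mul, mul_pow]
  have hHm : Measurable fun q => ‖HH m G q‖ₑ := (HH_cont hG).measurable.enorm
  have hum : Measurable fun q : ℝ × V2 => ‖ftST u q.1 q.2‖ₑ := (ftST_continuous u).measurable.enorm
  have hwm : Measurable fun q : ℝ × V2 => wgt s θ q.1 q.2 := (wgt_cont s θ).measurable
  have h1 : ‖∫ q : ℝ × V2, ftST u q.1 q.2 * HH m G q‖ₑ ^ 2 ≤ HN s θ u ^ 2 * ∫⁻ q : ℝ × V2, oR (wgt s θ q.1 q.2 ^ 2)⁻¹ * ‖HH m G q‖ₑ ^ 2 := by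
    calc _ ≤ (∫⁻ q : ℝ × V2, (oR (wgt s θ q.1 q.2) * ‖ftST u q.1 q.2‖ₑ) * (oR (wgt s θ q.1 q.2)⁻¹ * ‖HH m G q‖ₑ)) ^ 2 := by
          gcongr
          refine (enorm_integral_le_lintegral_enorm _).trans (le_of_eq ?_)
          congr 1; ext q
          rw [enorm_mul]
          have : oR (wgt s θ q.1 q.2) * oR (wgt s θ q.1 q.2)⁻¹ = 1 := by
            rw [← ENNReal.ofReal_mul (wgt_pos _ _ _ _).le, mul_inv_cancel₀ (wgt_pos _ _ _ _).ne', ENNReal.ofReal_one]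
          rw [mul_mul_mul_comm, this, one_mul]
      _ ≤ _ := by
          refine (lint_cs _ (by fun_prop) (by fun_prop)).trans (le_of_eq ?_)
          rw [HN_sq]
          congr 2; ext q
          rw [mul_pow, ← ENNReal.ofReal_pow (inv_nonneg.2 (wgt_pos _ _ _ _).le), inv_pow]
  have hρm : ∀ (ε : ℝ), Measurable fun z : (ℝ × V2) × ℝ => oR (z.2 ^ (2 * s - 1)) * oR (rexp (-z.2 * ‖z.1.2‖)) * oR ((1 + |z.1.1 - ε * ‖z.1.2‖|) ^ (-(2 * θ))) := by
    intro ε; fun_prop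
  have h2 : ∫⁻ q : ℝ × V2, oR (wgt s θ q.1 q.2 ^ 2)⁻¹ * ‖HH m G q‖ₑ ^ 2 ≤
      oR (2 ^ s * (rexp 1 * (2 * s))) * (2 * ((∫⁻ σ : ℝ, oR ((1 + |σ|) ^ (-(2 * θ)))) * oR (2 * π))) * ∫⁻ ρ in Set.Ioo (0:ℝ) 1, oR (ρ ^ (2 * s - 1)) * KK m G ρ := by
    have s1 := side_bound (s := s) hθ m G hG (Or.inl rfl : (1:ℝ) = 1 ∨ (1:ℝ) = -1)
    have s2 := side_bound (s := s) hθ m G hG (Or.inr rfl : (-1:ℝ) = 1 ∨ (-1:ℝ) = -1)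
    calc _ ≤ ∫⁻ q : ℝ × V2, oR (2 ^ s * (rexp 1 * (2 * s))) * ((∫⁻ ρ in Set.Ioo (0:ℝ) 1, oR (ρ ^ (2 * s - 1)) * oR (rexp (-ρ * ‖q.2‖)) *
        oR ((1 + |q.1 - 1 * ‖q.2‖|) ^ (-(2 * θ)))) * ‖HH m G q‖ₑ ^ 2 + (∫⁻ ρ in Set.Ioo (0:ℝ) 1, oR (ρ ^ (2 * s - 1)) * oR (rexp (-ρ * ‖q.2‖)) *
        oR ((1 + |q.1 - (-1) * ‖q.2‖|) ^ (-(2 * θ)))) * ‖HH m G q‖ₑ ^ 2) := by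
          refine lintegral_mono fun q => ?_
          rw [← add_mul, ← mul_assoc]
          gcongr
          refine (wgt_bound hs q.1 q.2).trans (le_of_eq ?_)
          rw [← lintegral_add_left (by fun_prop)]
          congr 2; ext ρ; ring
      _ = oR (2 ^ s * (rexp 1 * (2 * s))) * (_ + _) := by
          rw [lintegral_const_mul' _ _ ENNReal.ofReal_ne_top, lintegral_add_left]
          exact Measurable.mul ((hρm 1).lintegral_prod_right') (hHm.pow_const _)
      _ ≤ _ := (mul_le_mul_right (add_le_add s1 s2) _).trans (le_of_eq (by ring))
  exact (mul_le_mul_right (h1.trans (mul_le_mul_right h2 _)) _).trans (le_of_eq (by ring))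

lemma lintegral_scale {E : Type*} [NormedAddCommGroup E] [NormedSpace ℝ E] [MeasurableSpace E] [BorelSpace E]
    [FiniteDimensional ℝ E] (μ : Measure E) [μ.IsAddHaarMeasure] (f : E → EN) {R : ℝ} (hR : 0 < R) :
    ∫⁻ x, f x ∂μ = oR (R ^ Module.finrank ℝ E) * ∫⁻ x, f (R • x) ∂μ := by
  have h1 := (Homeomorph.smulOfNeZero R hR.ne' : E ≃ₜ E).measurableEmbedding.lintegral_map (μ := μ) f
  have h2 : Measure.map (⇑(Homeomorph.smulOfNeZero R hR.ne' : E ≃ₜ E)) μ = oR |(R ^ Module.finrank ℝ E)⁻¹| • μ :=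
    Measure.map_addHaar_smul μ hR.ne'
  rw [h2, lintegral_smul_measure] at h1
  change _ = ∫⁻ x, f (R • x) ∂μ at h1
  rw [← h1, smul_eq_mul, ← mul_assoc, ← ENNReal.ofReal_mul (by positivity), abs_of_pos (by positivity), mul_inv_cancel₀ (by positivity)]
  simp

lemma erpow_anti {a : ℝ} (ha : a ≤ 0) {x y : EN} (h : x ≤ y) : y ^ a ≤ x ^ a := by
  obtain ⟨b, rfl⟩ : ∃ b, a = -b := ⟨-a, by ring⟩
  rw [ENNReal.rpow_neg, ENNReal.rpow_neg, ENNReal.inv_le_inv]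
  exact ENNReal.rpow_le_rpow h (by linarith)

lemma rpowabs_lt_top {a : ℝ} (ha : a < 1) (R : ℝ) :
    ∫⁻ x in Set.Ioo (-R) R, (‖x‖ₑ) ^ (-a) < ⊤ := by
  have h1 : IntervalIntegrable (fun x : ℝ => |x| ^ (-a)) volume 0 R := by
    have h := intervalIntegral.intervalIntegrable_rpow' (a := 0) (b := |R|) (r := -a) (by linarith)
    have h2 : IntervalIntegrable (fun x : ℝ => |x| ^ (-a)) volume 0 |R| := by
      refine h.congr ?_
      intro x hx
      rw [Set.uIoc_of_le (abs_nonneg _)] at hx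
      simp only [abs_of_pos hx.1]
    rcases abs_cases R with ⟨h3, _⟩ | ⟨h3, _⟩
    · rwa [h3] at h2
    · rw [h3] at h2
      have := (IntervalIntegrable.iff_comp_neg (f := fun x : ℝ => |x| ^ (-a))).1 h2
      simpa using this
  have h2 : IntervalIntegrable (fun x : ℝ => |x| ^ (-a)) volume (-R) 0 := by
    have := (IntervalIntegrable.iff_comp_neg (f := fun x : ℝ => |x| ^ (-a))).1 h1
    simpa using this.symm
  have h3 := h2.trans h1
  rcases le_total R 0 with hR | hR
  · rw [Set.Ioo_eq_empty (by linarith)]; simp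
  have h4 := (intervalIntegrable_iff_integrableOn_Ioo_of_le (by linarith)).1 h3
  refine lt_of_le_of_lt (le_of_eq ?_) h4.lintegral_lt_top
  refine lintegral_congr_ae (ae_restrict_of_ae ?_)
  have : ∀ᵐ x : ℝ, x ≠ 0 := by simp [ae_iff]
  filter_upwards [this] with x hx
  rw [← ofReal_norm, Real.norm_eq_abs, ENNReal.ofReal_rpow_of_pos (abs_pos.2 hx)]

lemma rpowabs_shift_lt_top {a : ℝ} (ha : a < 1) (R c : ℝ) :
    ∫⁻ x in Set.Ioo (-R) R, (‖x - c‖ₑ) ^ (-a) < ⊤ := by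
  refine lt_of_le_of_lt ?_ (rpowabs_lt_top ha (R + |c|))
  rw [← lintegral_indicator measurableSet_Ioo, ← lintegral_indicator measurableSet_Ioo]
  rw [← lintegral_add_right_eq_self _ c]
  refine lintegral_mono fun x => ?_
  by_cases hx : x + c ∈ Set.Ioo (-R) R
  · rw [Set.indicator_of_mem hx, Set.indicator_of_mem]
    · simp
    · constructor <;> linarith [hx.1, hx.2, le_abs_self c, neg_abs_le c]
  · rw [Set.indicator_of_notMem hx]; exact zero_le

lemma exists_pol (b : V2) : ∃ β ψ : ℝ, 0 ≤ β ∧ |ψ| ≤ π ∧ b = pol β ψ := by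
  refine ⟨‖(⟨b 0, b 1⟩ : ℂ)‖, (⟨b 0, b 1⟩ : ℂ).arg, norm_nonneg _, Complex.abs_arg_le_pi _, ?_⟩
  ext i
  fin_cases i
  · simp [pol, Complex.norm_mul_cos_arg]
  · simp [pol, Complex.norm_mul_sin_arg]

lemma pol_sub_sq (r φ β ψ : ℝ) : ‖pol r φ - pol β ψ‖ ^ 2 = r ^ 2 + β ^ 2 - 2 * r * β * cos (φ - ψ) := by
  rw [norm_sq_V2, cos_sub]
  simp [pol]
  linear_combination r ^ 2 * sin_sq_add_cos_sq φ + β ^ 2 * sin_sq_add_cos_sq ψ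

lemma pol_sub_ge1 (r φ β ψ : ℝ) (hr : 0 ≤ r) (hβ : 0 ≤ β) : |r - β| ≤ ‖pol r φ - pol β ψ‖ := by
  refine abs_le_of_sq_le_sq ?_ (norm_nonneg _)
  rw [pol_sub_sq]
  nlinarith [cos_le_one (φ - ψ), mul_nonneg hr hβ]

lemma pol_sub_ge2 (r φ β ψ : ℝ) : |r * sin (φ - ψ)| ≤ ‖pol r φ - pol β ψ‖ := by
  refine abs_le_of_sq_le_sq ?_ (norm_nonneg _)
  rw [pol_sub_sq]
  nlinarith [sq_nonneg (β - r * cos (φ - ψ)), sin_sq_add_cos_sq (φ - ψ)]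

lemma ker_bound {δ : ℝ} (h0 : 0 < δ) (h1 : δ < 1) (r φ β ψ : ℝ) (hr : 0 ≤ r) (hβ : 0 ≤ β) :
    ‖pol r φ - pol β ψ‖ₑ⁻¹ ≤ ‖r‖ₑ ^ (-(1 - δ)) * ‖sin (φ - ψ)‖ₑ ^ (-(1 - δ)) * ‖r - β‖ₑ ^ (-δ) := by
  have e1 : ‖r - β‖ₑ ≤ ‖pol r φ - pol β ψ‖ₑ := by
    rw [← ofReal_norm, ← ofReal_norm]; exact ENNReal.ofReal_le_ofReal (pol_sub_ge1 r φ β ψ hr hβ)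
  have e2 : ‖r * sin (φ - ψ)‖ₑ ≤ ‖pol r φ - pol β ψ‖ₑ := by
    rw [← ofReal_norm, ← ofReal_norm]; exact ENNReal.ofReal_le_ofReal (pol_sub_ge2 r φ β ψ)
  rw [← ENNReal.mul_rpow_of_ne_top (by simp) (by simp), ← enorm_mul]
  have e3 : ‖pol r φ - pol β ψ‖ₑ⁻¹ ≤ ‖pol r φ - pol β ψ‖ₑ ^ (-(1 - δ)) * ‖pol r φ - pol β ψ‖ₑ ^ (-δ) := by
    by_cases hz : ‖pol r φ - pol β ψ‖ₑ = 0
    · rw [hz, ENNReal.zero_rpow_of_neg (by linarith), ENNReal.zero_rpow_of_neg (by linarith)]; simp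
    · rw [← ENNReal.rpow_add _ _ hz (by simp), ← ENNReal.rpow_neg_one]
      apply le_of_eq; congr 1; ring
  refine e3.trans (mul_le_mul' ?_ ?_)
  · exact erpow_anti (by linarith) e2
  · exact erpow_anti (by linarith) e1

lemma sin_int {a : ℝ} (h0 : 0 < a) (ha : a < 1) : ∃ C : EN, C ≠ ⊤ ∧ ∀ ψ : ℝ, |ψ| ≤ π →
    ∫⁻ φ in Set.Ioo (-π) π, ‖sin (φ - ψ)‖ₑ ^ (-a) ≤ C := by
  let g : ℝ → EN := fun x => ∑ k ∈ Finset.Icc (-2 : ℤ) 2, (oR (2 / π)) ^ (-a) * ‖x - k * π‖ₑ ^ (-a)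
  have hpi := pi_pos
  refine ⟨∫⁻ x in Set.Ioo (-(2 * π)) (2 * π), g x, ?_, fun ψ hψ => ?_⟩
  · rw [lintegral_finsetSum' _ (fun k _ => by fun_prop)]
    rw [ENNReal.sum_ne_top]
    intro k _
    have : oR (2 / π) ^ (-a) ≠ ⊤ := by
      refine ENNReal.rpow_ne_top_of_ne_zero ?_ ENNReal.ofReal_ne_top
      simp; positivity
    rw [lintegral_const_mul' _ _ this]
    exact ENNReal.mul_ne_top this (rpowabs_shift_lt_top ha _ _).ne
  · have hb : ∀ x ∈ Set.Ioo (-(2 * π)) (2 * π), ‖sin x‖ₑ ^ (-a) ≤ g x := by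
      intro x hx
      have hk := abs_sub_round (x / π)
      set k := round (x / π)
      have h1 : |x - k * π| ≤ π / 2 := by
        have : x - k * π = (x / π - k) * π := by field_simp
        rw [this, abs_mul, abs_of_pos hpi]; nlinarith
      have hk2 : k ∈ Finset.Icc (-2 : ℤ) 2 := by
        have h2 := abs_le.1 h1
        have l1 : (-3 : ℝ) < k := by
          by_contra hcon; push Not at hcon
          nlinarith [hx.1]
        have l2 : (k : ℝ) < 3 := by
          by_contra hcon; push Not at hcon
          nlinarith [hx.2]
        have l1' : (-3 : ℤ) < k := by exact_mod_cast l1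
        have l2' : k < (3 : ℤ) := by exact_mod_cast l2
        rw [Finset.mem_Icc]; omega
      have h3 : 2 / π * |x - k * π| ≤ |sin x| := by
        have := Real.mul_abs_le_abs_sin h1
        have h4 : |sin (x - k * π)| = |sin x| := by
          rw [Real.sin_sub_int_mul_pi, abs_mul, abs_zpow]; simp
        rwa [h4] at this
      refine le_trans ?_ (Finset.single_le_sum (f := fun k : ℤ => (oR (2 / π)) ^ (-a) * ‖x - k * π‖ₑ ^ (-a)) (fun _ _ => zero_le) hk2)
      rw [← ENNReal.mul_rpow_of_ne_top (by simp) (by simp)]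
      refine erpow_anti (by linarith) ?_
      rw [← ofReal_norm, ← ofReal_norm, ← ENNReal.ofReal_mul (by positivity)]
      exact ENNReal.ofReal_le_ofReal h3
    rw [← lintegral_indicator measurableSet_Ioo, ← lintegral_indicator measurableSet_Ioo]
    rw [← lintegral_add_right_eq_self _ ψ]
    refine lintegral_mono fun x => ?_
    by_cases hx : x + ψ ∈ Set.Ioo (-π) π
    · have hx2 : x ∈ Set.Ioo (-(2 * π)) (2 * π) := by
        have := abs_le.1 hψ
        constructor <;> linarith [hx.1, hx.2]
      rw [Set.indicator_of_mem hx, Set.indicator_of_mem hx2]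
      simpa using hb x hx2
    · rw [Set.indicator_of_notMem hx]; exact zero_le

lemma radial_one {δ : ℝ} (h0 : 0 < δ) (h1 : δ < 1) : ∃ C : EN, C ≠ ⊤ ∧ ∀ T β : ℝ,
    ∫⁻ r : ℝ, oR (((r - T) ^ 2 + 1) ^ (-(3 / 4 : ℝ))) * ‖r - β‖ₑ ^ (-δ) ≤ C := by
  refine ⟨(∫⁻ r : ℝ, oR ((r ^ 2 + 1) ^ (-(3 / 4 : ℝ)))) + ∫⁻ x in Set.Ioo (-1:ℝ) 1, (‖x‖ₑ) ^ (-δ), ?_, ?_⟩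
  · refine ENNReal.add_ne_top.2 ⟨?_, (rpowabs_lt_top h1 1).ne⟩
    have := integrable_rpow_neg_one_add_norm_sq (E := ℝ) (μ := volume) (r := 3 / 2) (by simp; norm_num)
    convert this.lintegral_lt_top.ne using 3
    · congr 2
      · rw [Real.norm_eq_abs, sq_abs]; ring
      · norm_num
  intro T β
  rw [← lintegral_sub_right_eq_self (fun r : ℝ => oR ((r ^ 2 + 1) ^ (-(3 / 4 : ℝ)))) T, ← lintegral_indicator measurableSet_Ioo,
    ← lintegral_sub_right_eq_self (Set.indicator _ _) β, ← lintegral_add_left (by fun_prop)]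
  refine lintegral_mono fun r => ?_
  by_cases hx : r - β ∈ Set.Ioo (-1:ℝ) 1
  · rw [Set.indicator_of_mem hx]
    refine le_trans ?_ le_add_self
    refine mul_le_of_le_one_left' ?_
    rw [ENNReal.ofReal_le_one]
    exact Real.rpow_le_one_of_one_le_of_nonpos (by nlinarith [sq_nonneg (r - T)]) (by norm_num)
  · rw [Set.indicator_of_notMem hx, add_zero]
    refine mul_le_of_le_one_right' ?_
    rw [ENNReal.rpow_neg]
    refine ENNReal.inv_le_one.2 (ENNReal.one_le_rpow ?_ h0)
    have : 1 ≤ |r - β| := by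
      by_contra hcon; push Not at hcon
      exact hx (abs_lt.1 hcon)
    rw [← ofReal_norm]; exact ENNReal.one_le_ofReal.2 this

lemma radial {δ : ℝ} (h0 : 0 < δ) (h1 : δ < 1) : ∃ C : EN, C ≠ ⊤ ∧ ∀ T β ρ : ℝ, 0 < ρ →
    ∫⁻ r : ℝ, oR (((r - T) ^ 2 + ρ ^ 2) ^ (-(3 / 4 : ℝ))) * ‖r - β‖ₑ ^ (-δ) ≤ C * oR (ρ ^ (-(1 / 2) - δ)) := by
  obtain ⟨C, hC, h⟩ := radial_one h0 h1
  refine ⟨C, hC, fun T β ρ hρ => ?_⟩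
  rw [lintegral_scale volume _ hρ]
  have : ∀ x : ℝ, oR (((ρ • x - T) ^ 2 + ρ ^ 2) ^ (-(3 / 4 : ℝ))) * ‖ρ • x - β‖ₑ ^ (-δ) =
      oR (ρ ^ (-(3 / 2) - δ)) * (oR (((x - T / ρ) ^ 2 + 1) ^ (-(3 / 4 : ℝ))) * ‖x - β / ρ‖ₑ ^ (-δ)) := by
    intro x
    have e1 : (ρ • x - T) ^ 2 + ρ ^ 2 = ρ ^ 2 * ((x - T / ρ) ^ 2 + 1) := by
      simp only [smul_eq_mul]; field_simp
    have e2 : ρ • x - β = ρ * (x - β / ρ) := by simp only [smul_eq_mul]; field_simp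
    rw [e1, e2, enorm_mul, ENNReal.mul_rpow_of_ne_top (by simp) (by simp), Real.mul_rpow (by positivity) (by positivity),
      ENNReal.ofReal_mul (by positivity)]
    have e3 : (ρ ^ 2) ^ (-(3 / 4) : ℝ) = ρ ^ (-(3 / 2) : ℝ) := by
      rw [← Real.rpow_natCast, ← Real.rpow_mul hρ.le]; norm_num
    have e4 : ‖ρ‖ₑ ^ (-δ) = oR (ρ ^ (-δ)) := by
      rw [← ofReal_norm, Real.norm_of_nonneg hρ.le, ENNReal.ofReal_rpow_of_pos hρ]
    rw [e3, e4, sub_eq_add_neg (-(3/2)) δ, Real.rpow_add hρ, ENNReal.ofReal_mul (by positivity)]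
    ring
  simp_rw [this]
  rw [lintegral_const_mul' _ _ ENNReal.ofReal_ne_top, ← mul_assoc, ← ENNReal.ofReal_mul (by positivity), mul_comm C]
  refine mul_le_mul' (le_of_eq ?_) (h _ _)
  congr 1
  have e5 : ρ ^ (-(1 / 2) - δ) = ρ ^ (1:ℝ) * ρ ^ (-(3 / 2) - δ) := by
    rw [← Real.rpow_add hρ]; congr 1; ring
  rw [e5]; simp

lemma QQ_abs (ρ T r : ℝ) : QQ ρ |T| r = QQ ρ T r := by
  rcases abs_choice T with h | h <;> rw [h]
  exact QQ_even _ _ _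

lemma QQ_le {ρ T r δ : ℝ} (hρ : 0 < ρ) (hT : 0 ≤ T) (hr : 0 ≤ r) (h0 : 0 < δ) (h1 : δ < 1 / 2) :
    r ^ δ * QQ ρ T r ≤ 2 ^ (3 / 4 : ℝ) * (ρ + T) ^ (δ - 1 / 2) * ((r - T) ^ 2 + ρ ^ 2) ^ (-(3 / 4 : ℝ)) := by
  unfold QQ
  rw [Real.mul_rpow (by positivity) (by positivity)]
  set A := ((r - T) ^ 2 + ρ ^ 2) ^ (-(3 / 4 : ℝ))
  have hA : 0 ≤ A := by positivity
  have h2 : √(ρ ^ 2 + T ^ 2) ≤ ρ + T := by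
    rw [Real.sqrt_le_iff]; constructor
    · positivity
    · nlinarith [mul_nonneg hρ.le hT]
  set S := r + (ρ + T) with hS
  have hSp : 0 < S := by positivity
  have h3 : ((r + T) ^ 2 + ρ ^ 2) ^ (-(3 / 4 : ℝ)) ≤ 2 ^ (3 / 4 : ℝ) * S ^ (-(3 / 2 : ℝ)) := by
    have e : 2 ^ (3 / 4 : ℝ) * S ^ (-(3 / 2 : ℝ)) = (2⁻¹ * S ^ 2) ^ (-(3 / 4 : ℝ)) := by
      rw [Real.mul_rpow (by positivity) (by positivity), ← Real.rpow_natCast S, ← Real.rpow_mul hSp.le, Real.inv_rpow (by positivity), Real.rpow_neg (by positivity : (0:ℝ) ≤ 2), inv_inv]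
      norm_num
    rw [e]
    apply Real.rpow_le_rpow_of_nonpos (by positivity) _ (by norm_num)
    rw [hS]; nlinarith [sq_nonneg (r + T - ρ)]
  have h4 : r ^ δ ≤ S ^ δ := Real.rpow_le_rpow hr (by rw [hS]; linarith) h0.le
  have h5 : S ^ (δ - 3 / 2) ≤ (ρ + T) ^ (δ - 3 / 2) :=
    Real.rpow_le_rpow_of_nonpos (by positivity) (by rw [hS]; linarith) (by linarith)
  have h6 : S ^ δ * S ^ (-(3 / 2 : ℝ)) = S ^ (δ - 3 / 2) := by rw [← Real.rpow_add hSp]; congr 1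
  have h7 : (ρ + T) * (ρ + T) ^ (δ - 3 / 2) = (ρ + T) ^ (δ - 1 / 2) := by
    nth_rw 1 [← Real.rpow_one (ρ + T)]
    rw [← Real.rpow_add (by positivity)]; congr 1; ring
  calc _ ≤ S ^ δ * ((ρ + T) * (A * (2 ^ (3 / 4 : ℝ) * S ^ (-(3 / 2 : ℝ))))) := by gcongr
    _ = 2 ^ (3 / 4 : ℝ) * ((ρ + T) * S ^ (δ - 3 / 2)) * A := by rw [← h6]; ring
    _ ≤ 2 ^ (3 / 4 : ℝ) * ((ρ + T) * (ρ + T) ^ (δ - 3 / 2)) * A := by gcongr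
    _ = _ := by rw [h7]

lemma L4 {δ : ℝ} (h0 : 0 < δ) (h1 : δ < 1 / 2) : ∃ C : EN, C ≠ ⊤ ∧ ∀ (ρ T : ℝ) (b : V2), 0 < ρ →
    ∫⁻ x : V2, oR (QQ ρ T ‖x‖) * ‖x - b‖ₑ⁻¹ ≤
      C * oR ((ρ + |T|) ^ (δ - 1 / 2) * ρ ^ (-(1 / 2) - δ)) := by
  obtain ⟨C1, hC1, hr⟩ := radial h0 (by linarith)
  obtain ⟨C2, hC2, hs⟩ := sin_int (a := 1 - δ) (by linarith) (by linarith)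
  refine ⟨C2 * (oR (2 ^ (3 / 4 : ℝ)) * C1), by finiteness, fun ρ T b hρ => ?_⟩
  simp_rw [← QQ_abs ρ T]
  obtain ⟨β, ψ, hβ, hψ, rfl⟩ := exists_pol b
  rw [lintegral_polar, Measure.volume_eq_prod, ← Measure.prod_restrict]
  calc _ ≤ ∫⁻ p : ℝ × ℝ, (oR (2 ^ (3 / 4 : ℝ)) * oR ((ρ + |T|) ^ (δ - 1 / 2)) *
          (oR (((p.1 - |T|) ^ 2 + ρ ^ 2) ^ (-(3 / 4 : ℝ))) * ‖p.1 - β‖ₑ ^ (-δ))) * (‖sin (p.2 - ψ)‖ₑ ^ (-(1 - δ)))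
          ∂((volume.restrict (Set.Ioi 0)).prod (volume.restrict (Set.Ioo (-π) π))) := by
        rw [Measure.prod_restrict]
        refine setLIntegral_mono' (measurableSet_Ioi.prod measurableSet_Ioo) fun p hp => ?_
        have hp1 : 0 < p.1 := hp.1
        rw [norm_pol, abs_of_pos hp1]
        refine (mul_le_mul_right (mul_le_mul_right (ker_bound h0 (by linarith) p.1 p.2 β ψ hp1.le hβ) _) _).trans ?_
        have e1 : oR p.1 * ‖p.1‖ₑ ^ (-(1 - δ)) = oR (p.1 ^ δ) := by
          rw [← ofReal_norm, Real.norm_of_nonneg hp1.le, ENNReal.ofReal_rpow_of_pos hp1, ← ENNReal.ofReal_mul hp1.le]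
          congr 1
          nth_rw 1 [← Real.rpow_one p.1]
          rw [← Real.rpow_add hp1]; congr 1; ring
        calc _ = (oR p.1 * ‖p.1‖ₑ ^ (-(1 - δ))) * oR (QQ ρ |T| p.1) * ‖p.1 - β‖ₑ ^ (-δ) * ‖sin (p.2 - ψ)‖ₑ ^ (-(1 - δ)) := by ring
          _ ≤ oR (2 ^ (3 / 4 : ℝ) * (ρ + |T|) ^ (δ - 1 / 2) * ((p.1 - |T|) ^ 2 + ρ ^ 2) ^ (-(3 / 4 : ℝ))) * ‖p.1 - β‖ₑ ^ (-δ) * ‖sin (p.2 - ψ)‖ₑ ^ (-(1 - δ)) := by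
            rw [e1, ← ENNReal.ofReal_mul (by positivity)]
            refine mul_le_mul_left (mul_le_mul_left (ENNReal.ofReal_le_ofReal ?_) _) _
            exact QQ_le hρ (abs_nonneg _) hp1.le h0 h1
          _ = _ := by
            rw [ENNReal.ofReal_mul (by positivity), ENNReal.ofReal_mul (by positivity)]; ring
    _ = _ := lintegral_prod_mul (f := fun r : ℝ => (oR (2 ^ (3 / 4 : ℝ)) * oR ((ρ + |T|) ^ (δ - 1 / 2)) *
          (oR (((r - |T|) ^ 2 + ρ ^ 2) ^ (-(3 / 4 : ℝ))) * ‖r - β‖ₑ ^ (-δ)))) (g := fun φ => ‖sin (φ - ψ)‖ₑ ^ (-(1 - δ))) (by fun_prop) (by fun_prop)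
    _ ≤ (oR (2 ^ (3 / 4 : ℝ)) * oR ((ρ + |T|) ^ (δ - 1 / 2)) * (C1 * oR (ρ ^ (-(1 / 2) - δ)))) * C2 := by
        gcongr
        · rw [lintegral_const_mul' _ _ (by finiteness)]
          gcongr
          exact (lintegral_mono' Measure.restrict_le_self le_rfl).trans (hr _ _ _ hρ)
        · exact hs ψ hψ
    _ = _ := by rw [ENNReal.ofReal_mul (by positivity)]; ring

lemma QQ0_int : ∃ C : EN, C ≠ ⊤ ∧ ∀ (ρ : ℝ), 0 < ρ → ∫⁻ x : V2, oR (QQ ρ 0 ‖x‖) ≤ C := by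
  have hq : ∀ ρ : ℝ, 0 < ρ → ∀ r, QQ ρ 0 r = ρ * (r ^ 2 + ρ ^ 2) ^ (-(3 / 2) : ℝ) := by
    intro ρ hρ r
    unfold QQ
    simp only [ne_eq, OfNat.ofNat_ne_zero, not_false_eq_true, zero_pow, add_zero, sub_zero]
    rw [Real.sqrt_sq hρ.le, ← pow_two, ← Real.rpow_natCast (_ + _), ← Real.rpow_mul (by positivity)]
    norm_num
  refine ⟨∫⁻ x : V2, oR (QQ 1 0 ‖x‖), ?_, fun ρ hρ => ?_⟩
  · have := integrable_rpow_neg_one_add_norm_sq (E := V2) (μ := volume) (r := 3) (by simp; norm_num)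
    convert this.lintegral_lt_top.ne using 3
    rw [hq 1 one_pos]; norm_num [add_comm]
  · rw [lintegral_scale volume _ hρ, ← lintegral_const_mul' _ _ ENNReal.ofReal_ne_top]
    refine lintegral_mono fun x => ?_
    rw [← ENNReal.ofReal_mul (by positivity)]
    apply le_of_eq; congr 1
    rw [hq ρ hρ, hq 1 one_pos, norm_smul, Real.norm_of_nonneg hρ.le]
    have : (ρ * ‖x‖) ^ 2 + ρ ^ 2 = ρ ^ 2 * (‖x‖ ^ 2 + 1 ^ 2) := by ring
    rw [this, Real.mul_rpow (by positivity) (by positivity)]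
    have e : (ρ ^ 2) ^ (-(3 / 2) : ℝ) = (ρ ^ 3)⁻¹ := by
      rw [← Real.rpow_natCast, ← Real.rpow_natCast, ← Real.rpow_neg hρ.le, ← Real.rpow_mul hρ.le]; norm_num
    rw [e]; simp; field_simp

/-- the kernel 1 + |x|^{-1/2} -/
def kap (x : V2) : EN := 1 + ‖x‖ₑ ^ (-(1 / 2) : ℝ)

lemma kap_meas : Measurable kap := by unfold kap; fun_prop

lemma L4' : ∃ C : EN, C ≠ ⊤ ∧ ∀ (ρ : ℝ) (b : V2), 0 < ρ → ρ < 1 →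
    ∫⁻ x : V2, oR (QQ ρ 0 ‖x‖) * kap (x - b) ≤ C * oR (ρ ^ (-(1 / 2) : ℝ)) := by
  obtain ⟨C1, hC1, h1⟩ := QQ0_int
  obtain ⟨C2, hC2, h2⟩ := L4 (δ := 1 / 4) (by norm_num) (by norm_num)
  refine ⟨C1 + (C1 * C2) ^ (1 / 2 : ℝ), by finiteness, fun ρ b hρ hρ1 => ?_⟩
  have hQm : Measurable fun x : V2 => oR (QQ ρ 0 ‖x‖) := by
    have := (QQ_cont hρ).comp (by fun_prop : Continuous fun x : V2 => ((0:ℝ), ‖x‖))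
    exact this.measurable.ennreal_ofReal
  have hone : 1 ≤ oR (ρ ^ (-(1 / 2) : ℝ)) := by
    rw [ENNReal.one_le_ofReal]
    exact Real.one_le_rpow_of_pos_of_le_one_of_nonpos hρ hρ1.le (by norm_num)
  simp only [kap, mul_add, mul_one]
  rw [lintegral_add_left hQm, add_mul]
  refine add_le_add ((h1 ρ hρ).trans (le_mul_of_one_le_right' hone)) ?_
  have hsq : (∫⁻ x : V2, oR (QQ ρ 0 ‖x‖) * ‖x - b‖ₑ ^ (-(1 / 2) : ℝ)) ^ 2 ≤ (C1 * C2) * oR (ρ ^ (-1 : ℝ)) := by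
    have e : ∀ x : V2, oR (QQ ρ 0 ‖x‖) * ‖x - b‖ₑ ^ (-(1 / 2) : ℝ) =
        oR (QQ ρ 0 ‖x‖) ^ (1 / 2 : ℝ) * (oR (QQ ρ 0 ‖x‖) ^ (1 / 2 : ℝ) * ‖x - b‖ₑ ^ (-(1 / 2) : ℝ)) := by
      intro x
      rw [← mul_assoc, ← ENNReal.rpow_add_of_nonneg _ _ (by norm_num) (by norm_num)]; norm_num
    have e2 : ∀ y : EN, (y ^ (1 / 2 : ℝ)) ^ 2 = y := by
      intro y; rw [← ENNReal.rpow_natCast, ← ENNReal.rpow_mul]; norm_num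
    have e3 : ∀ y : EN, (y ^ (-(1 / 2) : ℝ)) ^ 2 = y⁻¹ := by
      intro y; rw [← ENNReal.rpow_natCast, ← ENNReal.rpow_mul]; norm_num [ENNReal.rpow_neg_one]
    simp_rw [e]
    refine (lint_cs _ (hQm.pow_const _).aemeasurable ((hQm.pow_const _).mul (by fun_prop)).aemeasurable).trans ?_
    simp only [Pi.mul_apply, mul_pow, e2, e3]
    rw [mul_assoc]
    refine mul_le_mul' (h1 ρ hρ) ((h2 ρ 0 b hρ).trans (le_of_eq ?_))
    congr 2
    rw [abs_zero, add_zero, ← Real.rpow_add hρ]; norm_num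
  have := ENNReal.rpow_le_rpow hsq (by norm_num : (0:ℝ) ≤ 1 / 2)
  rw [← ENNReal.rpow_natCast, ← ENNReal.rpow_mul, ENNReal.mul_rpow_of_nonneg _ _ (by norm_num : (0:ℝ) ≤ 1 / 2), ENNReal.ofReal_rpow_of_pos (by positivity), ← Real.rpow_mul hρ.le] at this
  norm_num at this ⊢
  exact this

lemma ehalf_sq (y : EN) : (y ^ (1 / 2 : ℝ)) ^ 2 = y := by
  rw [← ENNReal.rpow_natCast, ← ENNReal.rpow_mul]; norm_num

lemma esq_half (y : EN) : (y ^ 2) ^ (1 / 2 : ℝ) = y := by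
  rw [← ENNReal.rpow_natCast, ← ENNReal.rpow_mul]; norm_num

lemma le_of_esq {a b : EN} (h : a ^ 2 ≤ b ^ 2) : a ≤ b := by
  have := ENNReal.rpow_le_rpow h (by norm_num : (0:ℝ) ≤ 1 / 2)
  rwa [esq_half, esq_half] at this

lemma schur {k1 k2 u1 u2 Q : V2 → EN} (hk1 : Measurable k1) (hk2 : Measurable k2)
    (hu1 : Measurable u1) (hu2 : Measurable u2) (hQ : Measurable Q) (S : EN)
    (h1 : ∀ z, ∫⁻ y, k1 y * Q (y - z) ≤ S) (h2 : ∀ y, ∫⁻ z, k2 z * Q (y - z) ≤ S) :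
    ∫⁻ y, ∫⁻ z, (k1 y * u1 y) * (k2 z * u2 z) * Q (y - z) ≤
      S * (∫⁻ y, k1 y * u1 y ^ 2) ^ (1 / 2 : ℝ) * (∫⁻ y, k2 y * u2 y ^ 2) ^ (1 / 2 : ℝ) := by
  have hQ' : Measurable fun p : V2 × V2 => Q (p.1 - p.2) := hQ.comp (by fun_prop)
  apply le_of_esq
  rw [mul_pow, mul_pow, ehalf_sq, ehalf_sq]
  rw [← lintegral_prod (fun p : V2 × V2 => (k1 p.1 * u1 p.1) * (k2 p.2 * u2 p.2) * Q (p.1 - p.2)) (by fun_prop)]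
  have e : ∀ p : V2 × V2, (k1 p.1 * u1 p.1) * (k2 p.2 * u2 p.2) * Q (p.1 - p.2) =
     ((k1 p.1 * k2 p.2 * Q (p.1 - p.2)) ^ (1 / 2 : ℝ) * u1 p.1) * ((k1 p.1 * k2 p.2 * Q (p.1 - p.2)) ^ (1 / 2 : ℝ) * u2 p.2) := by
    intro p
    have := ehalf_sq (k1 p.1 * k2 p.2 * Q (p.1 - p.2))
    generalize (k1 p.1 * k2 p.2 * Q (p.1 - p.2)) ^ (1 / 2 : ℝ) = X at this ⊢
    rw [mul_mul_mul_comm X, ← pow_two, this]; ring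
  simp_rw [e]
  refine (lint_cs _ (f := fun p : V2 × V2 => (k1 p.1 * k2 p.2 * Q (p.1 - p.2)) ^ (1 / 2 : ℝ) * u1 p.1)
    (g := fun p : V2 × V2 => (k1 p.1 * k2 p.2 * Q (p.1 - p.2)) ^ (1 / 2 : ℝ) * u2 p.2) (by fun_prop) (by fun_prop)).trans ?_
  simp only [mul_pow, ehalf_sq]
  have a1 : ∫⁻ p : V2 × V2, k1 p.1 * k2 p.2 * Q (p.1 - p.2) * u1 p.1 ^ 2 ≤ S * ∫⁻ y, k1 y * u1 y ^ 2 := by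
    rw [Measure.volume_eq_prod, lintegral_prod _ (by fun_prop), ← lintegral_const_mul _ (by fun_prop)]
    refine lintegral_mono fun y => ?_
    have : ∀ z, k1 y * k2 z * Q (y - z) * u1 y ^ 2 = (k1 y * u1 y ^ 2) * (k2 z * Q (y - z)) := fun z => by ring
    simp_rw [this]
    rw [lintegral_const_mul _ (by fun_prop), mul_comm S]
    exact mul_le_mul_right (h2 y) _
  have a2 : ∫⁻ p : V2 × V2, k1 p.1 * k2 p.2 * Q (p.1 - p.2) * u2 p.2 ^ 2 ≤ S * ∫⁻ y, k2 y * u2 y ^ 2 := by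
    rw [Measure.volume_eq_prod, lintegral_prod_symm _ (by fun_prop), ← lintegral_const_mul _ (by fun_prop)]
    refine lintegral_mono fun y => ?_
    have : ∀ z, k1 z * k2 y * Q (z - y) * u2 y ^ 2 = (k2 y * u2 y ^ 2) * (k1 z * Q (z - y)) := fun z => by ring
    simp_rw [this]
    rw [lintegral_const_mul _ (by fun_prop), mul_comm S]
    exact mul_le_mul_right (h1 y) _
  refine (mul_le_mul' a1 a2).trans (le_of_eq (by ring))

set_option maxHeartbeats 1600000 in
/-- abstract TT* consequence -/
lemma TT2 {s θ : ℝ} (hs : 0 < s) (hθ : 1 / 2 < θ) : ∃ C : EN, C ≠ ⊤ ∧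
    ∀ (k : V2 → EN) (_ : Measurable k) (_ : ∀ y, k (-y) = k y) (_ : ∀ y, y ≠ 0 → k y ≠ ⊤)
      (S : ℝ → ℝ → EN) (_ : ∀ ρ T b, 0 < ρ → ρ < 1 → ∫⁻ x : V2, oR (QQ ρ T ‖x‖) * k (x - b) ≤ S ρ T)
      (u : SM) (μ : Measure ℝ) (_ : SFinite μ) (g : ℝ → EN) (_ : Measurable g) (_ : ∀ t, g t ≠ ⊤)
      (x : ℝ → V2) (_ : Measurable x)
      (_ : ∫⁻ t, g t * ∫⁻ y, k (x t - y) * ‖u (t, y)‖ₑ ∂volume ∂μ ≠ ⊤),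
      (∫⁻ t, g t * ∫⁻ y, k (x t - y) * ‖u (t, y)‖ₑ ^ 2 ∂volume ∂μ) ^ 2 ≤
        C * HN s θ u ^ 2 * ∫⁻ ρ in Set.Ioo (0:ℝ) 1, oR (ρ ^ (2*s-1)) *
          ∫⁻ t, ∫⁻ t', g t * g t' * (S ρ (t - t') * (∫⁻ y, k (x t - y) * ‖u (t, y)‖ₑ ^ 2) ^ (1 / 2 : ℝ) * (∫⁻ y, k (x t' - y) * ‖u (t', y)‖ₑ ^ 2) ^ (1 / 2 : ℝ)) ∂μ ∂μ := by
  obtain ⟨C, hC, H⟩ := TTstar hs hθ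
  refine ⟨C, hC, fun k hk hke hkf S hS u μ _ g hg hgf x hx hfin => ?_⟩
  have hu : Measurable fun p : ℝ × V2 => u p := u.continuous.measurable
  set w : ℝ × V2 → EN := fun p => g p.1 * k (x p.1 - p.2) with hw
  have hwm : Measurable w := by
    have : Measurable fun p : ℝ × V2 => k (x p.1 - p.2) := hk.comp (by fun_prop)
    fun_prop
  have hae : ∀ᵐ p ∂(μ.prod (volume : Measure V2)), w p ≠ ⊤ := by
    have hms : MeasurableSet {p | w p ≠ ⊤} := (measurableSet_eq_fun hwm measurable_const).compl
    refine (Measure.ae_prod_iff_ae_ae hms).2 ?_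
    refine Filter.Eventually.of_forall fun t => ?_
    have : ∀ᵐ y : V2, y ≠ x t := by simp [ae_iff, measure_singleton]
    filter_upwards [this] with y hy
    exact ENNReal.mul_ne_top (hgf t) (hkf _ (sub_ne_zero.2 (Ne.symm hy)))
  set G : ℝ × V2 → ℂ := fun p => ((w p).toReal : ℂ) * (starRingEnd ℂ) (u p) with hGdef
  have hGm : Measurable G := by
    have : Measurable fun p : ℝ × V2 => (starRingEnd ℂ) (u p) := Complex.continuous_conj.measurable.comp hu
    have h2 := hwm.ennreal_toReal
    exact (Complex.measurable_ofReal.comp h2).mul this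
  have hGn : ∀ᵐ p ∂(μ.prod (volume : Measure V2)), ‖G p‖ₑ = w p * ‖u p‖ₑ := by
    filter_upwards [hae] with p hp
    rw [hGdef]
    simp only [enorm_mul]
    congr 1
    · rw [← ofReal_norm]; simp [ENNReal.ofReal_toReal hp]
    · rw [← ofReal_norm, ← ofReal_norm]; simp
  have hGi : Integrable G (μ.prod (volume : Measure V2)) := by
    refine ⟨hGm.aestronglyMeasurable, ?_⟩
    rw [HasFiniteIntegral, lintegral_congr_ae hGn, lintegral_prod _ (by fun_prop)]
    refine lt_of_eq_of_lt (lintegral_congr fun t => ?_) hfin.lt_top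
    simp only [hw, mul_assoc]
    rw [lintegral_const_mul]
    have : Measurable fun p : V2 => k (x t - p) := hk.comp (by fun_prop)
    have h2 : Measurable fun p : V2 => u (t, p) := hu.comp (by fun_prop)
    fun_prop
  have key := H u (μ.prod volume) G hGi
  have hl : ‖∫ p, u p * G p ∂(μ.prod volume)‖ₑ = ∫⁻ t, g t * ∫⁻ y, k (x t - y) * ‖u (t, y)‖ₑ ^ 2 ∂volume ∂μ := by
    have e1 : ∀ p, u p * G p = (((w p).toReal * ‖u p‖ ^ 2 : ℝ) : ℂ) := by
      intro p
      rw [hGdef]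
      push_cast
      rw [← Complex.conj_mul']; ring
    simp_rw [e1]
    rw [integral_complex_ofReal, ← ofReal_norm, Complex.norm_real, Real.norm_of_nonneg (integral_nonneg fun p => by positivity),
      integral_eq_lintegral_of_nonneg_ae (Filter.Eventually.of_forall fun p => by positivity)
        (by apply Measurable.aestronglyMeasurable; exact hwm.ennreal_toReal.mul (hu.norm.pow_const 2))]
    have e2 : ∫⁻ p, oR ((w p).toReal * ‖u p‖ ^ 2) ∂(μ.prod volume) = ∫⁻ t, g t * ∫⁻ y, k (x t - y) * ‖u (t, y)‖ₑ ^ 2 ∂volume ∂μ := by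
      have : ∀ᵐ p ∂(μ.prod (volume : Measure V2)), oR ((w p).toReal * ‖u p‖ ^ 2) = w p * ‖u p‖ₑ ^ 2 := by
        filter_upwards [hae] with p hp
        rw [ENNReal.ofReal_mul (by positivity), ENNReal.ofReal_toReal hp, ENNReal.ofReal_pow (by positivity), ofReal_norm]
      rw [lintegral_congr_ae this, lintegral_prod _ (by fun_prop)]
      refine lintegral_congr fun t => ?_
      simp only [hw, mul_assoc]
      rw [lintegral_const_mul]
      have : Measurable fun p : V2 => k (x t - p) := hk.comp (by fun_prop)
      have h2 : Measurable fun p : V2 => u (t, p) := hu.comp (by fun_prop)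
      fun_prop
    rw [← e2, ENNReal.ofReal_toReal]
    obtain ⟨M, hM⟩ : ∃ M : ℝ, ∀ p, ‖u p‖ ≤ M := by
      obtain ⟨M, hM⟩ := u.decay 0 0
      exact ⟨M, fun p => by simpa using hM.2 p⟩
    refine ne_top_of_le_ne_top (b := oR M * ∫⁻ p, ‖G p‖ₑ ∂(μ.prod volume)) (by have := hGi.2; rw [HasFiniteIntegral] at this; finiteness) ?_
    rw [← lintegral_const_mul' _ _ ENNReal.ofReal_ne_top]
    refine lintegral_mono fun p => ?_
    rw [← ofReal_norm, ← ENNReal.ofReal_mul ((norm_nonneg _).trans (hM p))]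
    apply ENNReal.ofReal_le_ofReal
    simp only [hGdef, norm_mul, Complex.norm_real, RCLike.norm_conj, Real.norm_of_nonneg ENNReal.toReal_nonneg]
    rw [pow_two]
    nlinarith [mul_le_mul_of_nonneg_left (hM p) (mul_nonneg (ENNReal.toReal_nonneg (a := w p)) (norm_nonneg (u p)))]
  rw [hl] at key
  refine key.trans (mul_le_mul_right (lintegral_mono_ae ?_) _)
  filter_upwards [ae_restrict_mem measurableSet_Ioo] with ρ hρ
  refine mul_le_mul_right ?_ _
  unfold KK
  have hQm : Measurable fun z : ℝ × V2 => oR (QQ ρ z.1 ‖z.2‖) := by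
    exact ((QQ_cont hρ.1).comp (by fun_prop : Continuous fun x : ℝ × V2 => (x.1, ‖x.2‖))).measurable.ennreal_ofReal
  have hQm2 : Measurable fun z : (ℝ × V2) × (ℝ × V2) => oR (QQ ρ (z.1.1 - z.2.1) ‖z.1.2 - z.2.2‖) :=
    hQm.comp (g := fun z : ℝ × V2 => oR (QQ ρ z.1 ‖z.2‖)) (by fun_prop : Measurable fun z : (ℝ × V2) × (ℝ × V2) => (z.1.1 - z.2.1, z.1.2 - z.2.2))
  have c1 : ∫⁻ z : (ℝ×V2)×(ℝ×V2), ‖G z.1‖ₑ * ‖G z.2‖ₑ * oR (QQ ρ (z.1.1 - z.2.1) ‖z.1.2 - z.2.2‖) ∂((μ.prod volume).prod (μ.prod volume))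
     = ∫⁻ z : (ℝ×V2)×(ℝ×V2), (w z.1 * ‖u z.1‖ₑ) * (w z.2 * ‖u z.2‖ₑ) * oR (QQ ρ (z.1.1 - z.2.1) ‖z.1.2 - z.2.2‖) ∂((μ.prod volume).prod (μ.prod volume)) := by
    refine lintegral_congr_ae ?_
    filter_upwards [Measure.quasiMeasurePreserving_fst.ae hGn, Measure.quasiMeasurePreserving_snd.ae hGn] with z h1 h2
    rw [h1, h2]
  rw [c1, lintegral_prod _ (by fun_prop), lintegral_prod _ (Measurable.lintegral_prod_right'
    (f := fun z : (ℝ×V2)×(ℝ×V2) => (w z.1 * ‖u z.1‖ₑ) * (w z.2 * ‖u z.2‖ₑ) * oR (QQ ρ (z.1.1 - z.2.1) ‖z.1.2 - z.2.2‖)) (by fun_prop)).aemeasurable]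
  refine lintegral_mono fun t => ?_
  have c2 : ∀ y : V2, ∫⁻ z : ℝ × V2, (w (t, y) * ‖u (t, y)‖ₑ) * (w z * ‖u z‖ₑ) * oR (QQ ρ (t - z.1) ‖y - z.2‖) ∂(μ.prod volume)
      = ∫⁻ t', ∫⁻ z, (w (t, y) * ‖u (t, y)‖ₑ) * (w (t', z) * ‖u (t', z)‖ₑ) * oR (QQ ρ (t - t') ‖y - z‖) ∂volume ∂μ := by
    intro y
    rw [lintegral_prod]
    have := hQm2.comp (by fun_prop : Measurable fun z : ℝ × V2 => ((t, y), z))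
    simp only [Function.comp_def] at this
    fun_prop
  simp only [c2]
  have hQm3 : Measurable fun z : (V2 × ℝ) × V2 => oR (QQ ρ (t - z.1.2) ‖z.1.1 - z.2‖) :=
    hQm2.comp (by fun_prop : Measurable fun z : (V2 × ℝ) × V2 => ((t, z.1.1), (z.1.2, z.2)))
  rw [lintegral_lintegral_swap (by
    apply Measurable.aemeasurable
    apply Measurable.lintegral_prod_right' (f := fun z : (V2 × ℝ) × V2 => (w (t, z.1.1) * ‖u (t, z.1.1)‖ₑ) * (w (z.1.2, z.2) * ‖u (z.1.2, z.2)‖ₑ) * oR (QQ ρ (t - z.1.2) ‖z.1.1 - z.2‖))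
    fun_prop)]
  refine lintegral_mono fun t' => ?_
  have hut : ∀ t, Measurable fun y : V2 => ‖u (t, y)‖ₑ := fun t => (hu.comp (by fun_prop : Measurable fun y : V2 => (t, y))).enorm
  have hkt : ∀ t, Measurable fun y : V2 => k (x t - y) := fun t => hk.comp (by fun_prop)
  have hQt : Measurable fun y : V2 => oR (QQ ρ (t - t') ‖y‖) :=
    hQm.comp (by fun_prop : Measurable fun y : V2 => (t - t', y))
  have hS1 : ∀ t0 z, ∫⁻ y, k (x t0 - y) * oR (QQ ρ (t - t') ‖y - z‖) ≤ S ρ (t - t') := by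
    intro t0 z
    rw [← lintegral_add_right_eq_self _ z]
    refine le_trans (le_of_eq (lintegral_congr fun y => ?_)) (hS ρ (t - t') (x t0 - z) hρ.1 hρ.2)
    rw [mul_comm, ← hke]; congr 2; · congr 2; abel
    · abel
  have := schur (hkt t) (hkt t') (hut t) (hut t') hQt (S ρ (t - t')) (hS1 t) (by
    intro y
    refine le_trans (le_of_eq (lintegral_congr fun z => ?_)) (hS1 t' y)
    rw [norm_sub_rev])
  refine le_trans (le_of_eq ?_) (mul_le_mul_right this _)
  rw [← lintegral_const_mul' _ _ (ENNReal.mul_ne_top (hgf t) (hgf t'))]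
  refine lintegral_congr fun y => ?_
  rw [← lintegral_const_mul' _ _ (ENNReal.mul_ne_top (hgf t) (hgf t'))]
  refine lintegral_congr fun z => ?_
  simp only [hw]; ring

lemma near_fin {a : ℝ} (ha : a < 2) : ∫⁻ x in Metric.ball (0 : V2) 1, ‖x‖ₑ ^ (-a) ≠ ⊤ := by
  rw [← lintegral_indicator measurableSet_ball, lintegral_polar]
  have hsub : ∀ p ∈ Set.Ioi (0:ℝ) ×ˢ Set.Ioo (-π) π, oR p.1 * (Metric.ball (0:V2) 1).indicator (fun x => ‖x‖ₑ ^ (-a)) (pol p.1 p.2)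
      ≤ (Set.Ioo (-1:ℝ) 1).indicator (fun r => ‖r‖ₑ ^ (-(a-1))) p.1 * (1:EN) := by
    rintro ⟨r, φ⟩ ⟨hr, -⟩
    simp only [Set.mem_Ioi] at hr
    by_cases h : r < 1
    · rw [Set.indicator_of_mem (by simp [norm_pol, abs_of_pos hr, h]), Set.indicator_of_mem (by constructor <;> simp <;> linarith)]
      rw [← ofReal_norm, norm_pol, mul_one, ← ofReal_norm, Real.norm_eq_abs, abs_of_pos hr, ENNReal.ofReal_rpow_of_pos hr, ENNReal.ofReal_rpow_of_pos hr, ← ENNReal.ofReal_mul hr.le]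
      apply le_of_eq; congr 1
      nth_rw 1 [← Real.rpow_one r]
      rw [← Real.rpow_add hr]; ring_nf
    · rw [Set.indicator_of_notMem (by simp [norm_pol, abs_of_pos hr]; linarith)]; simp
  refine ne_top_of_le_ne_top ?_ (setLIntegral_mono' (measurableSet_Ioi.prod measurableSet_Ioo) hsub)
  rw [Measure.volume_eq_prod, ← Measure.prod_restrict, lintegral_prod_mul (f := fun r : ℝ => (Set.Ioo (-1:ℝ) 1).indicator (fun r => ‖r‖ₑ ^ (-(a-1))) r) (g := fun _ : ℝ => (1:EN)) (by
    apply Measurable.aemeasurable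
    exact Measurable.indicator (by fun_prop) measurableSet_Ioo) (by fun_prop)]
  refine ENNReal.mul_ne_top ?_ (by simp)
  refine ne_top_of_le_ne_top (rpowabs_lt_top (a := a - 1) (by linarith) 1).ne ?_
  rw [← lintegral_indicator measurableSet_Ioo]
  exact setLIntegral_le_lintegral _ _

lemma jap2_fin {b : ℝ} (hb : 2 < b) : ∫⁻ x : V2, oR ((1 + ‖x‖) ^ (-b)) ≠ ⊤ :=
  (integrable_one_add_norm (E := V2) (μ := volume) (r := b) (by simp; exact hb)).lintegral_lt_top.ne

lemma jap1_fin {b : ℝ} (hb : 1 < b) : ∫⁻ x : ℝ, oR ((1 + |x|) ^ (-b)) ≠ ⊤ :=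
  (integrable_one_add_norm (E := ℝ) (μ := volume) (r := b) (by simp; exact hb)).lintegral_lt_top.ne

lemma far_fin {b : ℝ} (hb : 2 < b) : ∫⁻ x in (Metric.ball (0 : V2) 1)ᶜ, ‖x‖ₑ ^ (-b) ≠ ⊤ := by
  refine ne_top_of_le_ne_top (ENNReal.mul_ne_top (a := oR (2 ^ b)) ENNReal.ofReal_ne_top (jap2_fin hb)) ?_
  rw [← lintegral_const_mul' _ _ ENNReal.ofReal_ne_top]
  refine (setLIntegral_mono' measurableSet_ball.compl fun x hx => ?_).trans (setLIntegral_le_lintegral _ _)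
  simp at hx
  rw [← ofReal_norm, ENNReal.ofReal_rpow_of_pos (by linarith), ← ENNReal.ofReal_mul (by positivity)]
  apply ENNReal.ofReal_le_ofReal
  have h2 : (2:ℝ) ^ b = (1/2) ^ (-b) := by
    rw [Real.rpow_neg (by norm_num), ← Real.inv_rpow (by norm_num)]; norm_num
  rw [h2, ← Real.mul_rpow (by norm_num) (by positivity)]
  exact Real.rpow_le_rpow_of_nonpos (by positivity) (by linarith) (by linarith)

lemma sch_decay (u : SM) : ∃ M : EN, M ≠ ⊤ ∧ ∀ t y,
    ‖u (t, y)‖ₑ ≤ M * (oR ((1 + |t|) ^ (-2 : ℝ)) * oR ((1 + ‖y‖) ^ (-3 : ℝ))) := by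
  have h := fun x => u.one_add_le_sup_seminorm_apply (𝕜 := ℝ) (m := (5, 0)) (k := 5) (n := 0) le_rfl le_rfl x
  refine ⟨oR (2 ^ 5 * (Finset.Iic (5, 0)).sup (fun m => SchwartzMap.seminorm ℝ m.1 m.2) u), by finiteness, fun t y => ?_⟩
  set M := 2 ^ 5 * (Finset.Iic (5, 0)).sup (fun m => SchwartzMap.seminorm ℝ m.1 m.2) u
  have h1 := h (t, y)
  simp only [norm_iteratedFDeriv_zero] at h1
  have hM : 0 ≤ M := le_trans (by positivity) h1
  rw [← ofReal_norm, ← ENNReal.ofReal_mul (by positivity), ← ENNReal.ofReal_mul hM]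
  apply ENNReal.ofReal_le_ofReal
  have e2 : (1 + |t|) ^ (-2 : ℝ) = ((1 + |t|) ^ 2)⁻¹ := by rw [Real.rpow_neg (by positivity)]; norm_cast
  have e3 : (1 + ‖y‖) ^ (-3 : ℝ) = ((1 + ‖y‖) ^ 3)⁻¹ := by rw [Real.rpow_neg (by positivity)]; norm_cast
  rw [e2, e3, ← mul_inv, ← div_eq_mul_inv, le_div_iff₀ (by positivity)]
  refine le_trans ?_ h1
  rw [mul_comm]
  refine mul_le_mul_of_nonneg_right ?_ (norm_nonneg _)
  have a1 : |t| ≤ ‖(t, y)‖ := norm_fst_le (t, y)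
  have a2 : ‖y‖ ≤ ‖(t, y)‖ := norm_snd_le (t, y)
  calc (1 + |t|) ^ 2 * (1 + ‖y‖) ^ 3 ≤ (1 + ‖(t, y)‖) ^ 2 * (1 + ‖(t, y)‖) ^ 3 := by gcongr
    _ = _ := by ring

lemma ker_split {a : ℝ} (ha : 0 ≤ a) (z : V2) : ‖z‖ₑ ^ (-a) ≤ 1 + (Metric.ball (0:V2) 1).indicator (fun z => ‖z‖ₑ ^ (-a)) z := by
  by_cases h : z ∈ Metric.ball (0:V2) 1
  · rw [Set.indicator_of_mem h]; exact le_add_self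
  · refine le_add_right ?_
    have : (1:EN) ≤ ‖z‖ₑ := by
      simp at h; rw [← ofReal_norm, ENNReal.one_le_ofReal]; exact h
    simpa using erpow_anti (a := -a) (by linarith) this

lemma ker_sch {a : ℝ} (ha : 0 ≤ a) (ha2 : a < 2) : ∃ M : EN, M ≠ ⊤ ∧ ∀ x : V2,
    ∫⁻ y, ‖x - y‖ₑ ^ (-a) * oR ((1 + ‖y‖) ^ (-3 : ℝ)) ≤ M := by
  refine ⟨(∫⁻ x : V2, oR ((1 + ‖x‖) ^ (-3:ℝ))) + ∫⁻ x in Metric.ball (0 : V2) 1, ‖x‖ₑ ^ (-a), ?_, fun x => ?_⟩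
  · have := jap2_fin (b := 3) (by norm_num); have := near_fin ha2; finiteness
  have h3 : ∀ y : V2, oR ((1 + ‖y‖) ^ (-3 : ℝ)) ≤ 1 := by
    intro y
    rw [← ENNReal.ofReal_one]
    exact ENNReal.ofReal_le_ofReal (Real.rpow_le_one_of_one_le_of_nonpos (by linarith [norm_nonneg y]) (by norm_num))
  rw [← lintegral_indicator measurableSet_ball, ← lintegral_sub_left_eq_self ((Metric.ball (0 : V2) 1).indicator fun x => ‖x‖ₑ ^ (-a)) x, ← lintegral_add_left (by fun_prop)]
  refine lintegral_mono fun y => ?_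
  refine (mul_le_mul_left (ker_split ha (x - y)) _).trans ?_
  rw [add_mul, one_mul]
  refine add_le_add le_rfl (mul_le_of_le_one_right' (h3 y))

lemma kap_sch : ∃ M : EN, M ≠ ⊤ ∧ ∀ x : V2,
    ∫⁻ y, kap (x - y) * oR ((1 + ‖y‖) ^ (-3 : ℝ)) ≤ M := by
  obtain ⟨M1, h1, H1⟩ := ker_sch (a := 0) le_rfl (by norm_num)
  obtain ⟨M2, h2, H2⟩ := ker_sch (a := 1/2) (by norm_num) (by norm_num)
  refine ⟨M1 + M2, by finiteness, fun x => ?_⟩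
  refine le_trans (le_of_eq ?_) (add_le_add (H1 x) (H2 x))
  rw [← lintegral_add_left (by fun_prop)]
  refine lintegral_congr fun y => ?_
  simp [kap, add_mul]

lemma sch_bdd (u : SM) : ∃ M : EN, M ≠ ⊤ ∧ ∀ p, ‖u p‖ₑ ≤ M := by
  obtain ⟨M, hM⟩ := u.decay 0 0
  refine ⟨oR M, by finiteness, fun p => ?_⟩
  rw [← ofReal_norm]
  exact ENNReal.ofReal_le_ofReal (by simpa using hM.2 p)

/-- finiteness from kernel decay -/
lemma ker_u (k : V2 → EN) {M : EN} (hM : M ≠ ⊤) (hk : ∀ x : V2,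
    ∫⁻ y, k (x - y) * oR ((1 + ‖y‖) ^ (-3 : ℝ)) ≤ M) (u : SM) :
    ∃ M' : EN, M' ≠ ⊤ ∧ ∀ t x, (∫⁻ y, k (x - y) * ‖u (t, y)‖ₑ ≤ M' * oR ((1 + |t|) ^ (-2 : ℝ))) ∧
       ∫⁻ y, k (x - y) * ‖u (t, y)‖ₑ ^ 2 ≤ M' * oR ((1 + |t|) ^ (-2 : ℝ)) := by
  obtain ⟨M1, h1, H1⟩ := sch_decay u
  obtain ⟨M2, h2, H2⟩ := sch_bdd u
  have a : ∀ t x, (∫⁻ y, k (x - y) * ‖u (t, y)‖ₑ ≤ M1 * M * oR ((1 + |t|) ^ (-2 : ℝ))) := by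
    intro t x
    calc ∫⁻ y, k (x - y) * ‖u (t, y)‖ₑ ≤ ∫⁻ y, (M1 * oR ((1 + |t|) ^ (-2 : ℝ))) * (k (x - y) * oR ((1 + ‖y‖) ^ (-3 : ℝ))) := by
          refine lintegral_mono fun y => (mul_le_mul_right (H1 t y) _).trans (le_of_eq (by ring))
      _ ≤ (M1 * oR ((1 + |t|) ^ (-2 : ℝ))) * M := by
          rw [lintegral_const_mul' _ _ (by finiteness)]
          exact mul_le_mul_right (hk x) _
      _ = _ := by ring
  refine ⟨M1 * M + M2 * (M1 * M), by finiteness, fun t x => ⟨(a t x).trans ?_, ?_⟩⟩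
  · exact mul_le_mul_left le_self_add _
  · calc ∫⁻ y, k (x - y) * ‖u (t, y)‖ₑ ^ 2 ≤ ∫⁻ y, M2 * (k (x - y) * ‖u (t, y)‖ₑ) := by
          refine lintegral_mono fun y => ?_
          rw [pow_two]
          refine le_trans (mul_le_mul_right (mul_le_mul_left (H2 _) _) _) (le_of_eq (by ring))
      _ ≤ M2 * (M1 * M * oR ((1 + |t|) ^ (-2 : ℝ))) := by
          rw [lintegral_const_mul' _ _ h2]
          exact mul_le_mul_right (a t x) _
      _ ≤ _ := by rw [← mul_assoc]; exact mul_le_mul_left le_add_self _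

lemma absorb_sq {X K : EN} (hX : X ≠ ⊤) (h : X ^ 2 ≤ K * X) : X ≤ K := by
  rcases eq_or_ne X 0 with h0 | h0
  · simp [h0]
  rw [pow_two] at h
  exact (ENNReal.mul_le_mul_iff_left h0 hX).1 h

lemma rho_fin {a : ℝ} (ha : -1 < a) : ∫⁻ ρ in Set.Ioo (0:ℝ) 1, oR (ρ ^ a) ≠ ⊤ := by
  have h := intervalIntegral.intervalIntegrable_rpow' (a := 0) (b := 1) ha
  rw [intervalIntegrable_iff_integrableOn_Ioo_of_le (by norm_num)] at h
  exact h.lintegral_lt_top.ne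

lemma hardy {s θ : ℝ} (hs : 1 / 4 < s) (hθ : 1 / 2 < θ) : ∃ C : EN, C ≠ ⊤ ∧
    ∀ (u : SM) t x, ∫⁻ y, kap (x - y) * ‖u (t, y)‖ₑ ^ 2 ≤ C * HN s θ u ^ 2 := by
  obtain ⟨C, hC, H⟩ := TT2 (s := s) (by linarith) hθ
  obtain ⟨C', hC', H'⟩ := L4'
  obtain ⟨M, hM, hk⟩ := kap_sch
  refine ⟨C * ((∫⁻ ρ in Set.Ioo (0:ℝ) 1, oR (ρ ^ (2*s-3/2))) * C'), ?_, fun u t x => ?_⟩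
  · have := rho_fin (a := 2*s-3/2) (by linarith)
    finiteness
  obtain ⟨M', hM', hu⟩ := ker_u kap hM hk u
  have h := H kap kap_meas (fun y => by simp [kap]) (fun y hy => by
      unfold kap
      refine ENNReal.add_ne_top.2 ⟨by simp, ?_⟩
      simp [ENNReal.rpow_eq_top_iff, hy]) (fun ρ T => if T = 0 then C' * oR (ρ ^ (-(1/2):ℝ)) else ⊤) (by
      intro ρ T b h0 h1
      split_ifs with hT
      · rw [hT]; exact H' ρ b h0 h1
      · simp) u (Measure.dirac t) inferInstance (fun _ => 1) measurable_const (by simp) (fun _ => x) measurable_const (by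
      simp only [lintegral_dirac, one_mul]
      exact ne_top_of_le_ne_top (by finiteness) (hu t x).1)
  simp only [lintegral_dirac, one_mul, sub_self, if_true] at h
  set X := ∫⁻ y, kap (x - y) * ‖u (t, y)‖ₑ ^ 2
  have hX : X ≠ ⊤ := ne_top_of_le_ne_top (by finiteness) (hu t x).2
  apply absorb_sq hX
  refine h.trans (le_of_eq ?_)
  have e : ∀ ρ ∈ Set.Ioo (0:ℝ) 1, oR (ρ ^ (2*s-1)) * (C' * oR (ρ ^ (-(1/2):ℝ)) * X ^ (1/2:ℝ) * X ^ (1/2:ℝ)) =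
     (C' * X) * oR (ρ ^ (2*s-3/2)) := by
    intro ρ hρ
    have := ehalf_sq X
    rw [mul_assoc (C' * _), ← pow_two, this]
    have : oR (ρ ^ (2*s-3/2)) = oR (ρ ^ (2*s-1)) * oR (ρ ^ (-(1/2):ℝ)) := by
      rw [← ENNReal.ofReal_mul (by have := hρ.1; positivity), ← Real.rpow_add hρ.1]; ring_nf
    rw [this]; ring
  rw [setLIntegral_congr_fun measurableSet_Ioo e, lintegral_const_mul' _ _ (by finiteness)]
  ring

/-- the Newtonian-type potential of `|u|²`. -/
def BB (u : ℝ × V2 → ℂ) (t : ℝ) (x : V2) : EN := ∫⁻ y, ‖x - y‖ₑ⁻¹ * ‖u (t, y)‖ₑ ^ 2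

lemma BB_meas {u : ℝ × V2 → ℂ} (hu : Measurable u) : Measurable fun p : ℝ × V2 => BB u p.1 p.2 := by
  unfold BB
  exact Measurable.lintegral_prod_right' (f := fun z : (ℝ × V2) × V2 => ‖z.1.2 - z.2‖ₑ⁻¹ * ‖u (z.1.1, z.2)‖ₑ ^ 2) (by fun_prop)

lemma BB_meas' {u : ℝ × V2 → ℂ} (hu : Measurable u) {x : ℝ → V2} (hx : Measurable x) : Measurable fun t => BB u t (x t) := by
  have h1 : Measurable fun t => (t, x t) := measurable_id.prodMk hx
  have := Measurable.comp (g := fun p : ℝ × V2 => BB u p.1 p.2) (f := fun t => (t, x t)) (BB_meas hu) h1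
  exact this

lemma hNorm {P δ : ℝ} (hP : 0 < P) (hδ : 1 < P * (1/2 - δ)) : ∃ J : EN, J ≠ ⊤ ∧ ∀ ρ : ℝ, 0 < ρ →
    (∫⁻ T : ℝ, oR ((ρ+|T|)^(δ-1/2) * ρ^(-(1/2)-δ)) ^ P) ^ (1 / P) ≤ J * oR (ρ ^ (1 / P - 1)) := by
  refine ⟨(∫⁻ x : ℝ, oR ((1 + |x|) ^ (-(P * (1/2-δ))))) ^ (1 / P), ?_, fun ρ hρ => ?_⟩
  · have := jap1_fin hδ; 
    exact ENNReal.rpow_ne_top_of_nonneg (by positivity) this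
  rw [lintegral_scale volume _ hρ]
  have e : ∀ x : ℝ, oR ((ρ+|ρ • x|)^(δ-1/2) * ρ^(-(1/2)-δ)) ^ P = oR (ρ ^ (-P)) * oR ((1 + |x|) ^ (-(P * (1/2-δ)))) := by
    intro x
    rw [ENNReal.ofReal_rpow_of_nonneg (by positivity) hP.le, ← ENNReal.ofReal_mul (by positivity)]
    congr 1
    have : ρ + |ρ • x| = ρ * (1 + |x|) := by rw [smul_eq_mul, abs_mul, abs_of_pos hρ]; ring
    rw [this, Real.mul_rpow hρ.le (by positivity), mul_right_comm, ← Real.rpow_add hρ, Real.mul_rpow (by positivity) (by positivity), ← Real.rpow_mul hρ.le, ← Real.rpow_mul (by positivity)]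
    congr 2 <;> ring
  simp_rw [e]
  rw [lintegral_const_mul' _ _ ENNReal.ofReal_ne_top, ← mul_assoc, ENNReal.mul_rpow_of_nonneg _ _ (by positivity), mul_comm]
  refine mul_le_mul_right (le_of_eq ?_) _
  rw [← ENNReal.ofReal_mul (by positivity), ENNReal.ofReal_rpow_of_nonneg (by positivity) (by positivity)]
  congr 1
  simp only [Module.finrank_self]
  rw [pow_one]
  nth_rw 1 [← Real.rpow_one ρ]
  rw [← Real.rpow_add hρ, ← Real.rpow_mul hρ.le]
  congr 1; field_simp; ring

lemma holder_conv {B h : ℝ → EN} (hB : Measurable B) (hh : Measurable h) {P : ℝ} (hP : 1 < P) :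
    ∫⁻ t, ∫⁻ t', B t ^ P * (B t' ^ (P - 1) * h (t - t')) ≤
      (∫⁻ t, B t ^ P) * ((∫⁻ t, B t ^ P) ^ (1 - 1 / P) * (∫⁻ t, h t ^ P) ^ (1 / P)) := by
  have hc : (P / (P - 1)).HolderConjugate P := (Real.HolderConjugate.conjExponent hP).symm
  rw [← lintegral_mul_const _ (by fun_prop)]
  refine lintegral_mono fun t => ?_
  have hht : Measurable fun t' => h (t - t') := hh.comp (by fun_prop)
  rw [lintegral_const_mul _ (by fun_prop)]
  refine mul_le_mul_right ?_ _
  refine (ENNReal.lintegral_mul_le_Lp_mul_Lq volume hc (f := fun t' => B t' ^ (P - 1)) (g := fun t' => h (t - t')) (by fun_prop) hht.aemeasurable).trans ?_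
  have e1 : ∀ y : EN, (y ^ (P - 1)) ^ (P / (P - 1)) = y ^ P := by
    intro y; rw [← ENNReal.rpow_mul]; congr 1; have : P - 1 ≠ 0 := by linarith
    field_simp
  have e2 : 1 / (P / (P - 1)) = 1 - 1 / P := by field_simp
  simp only [e1, e2]
  rw [lintegral_sub_left_eq_self (fun t' => h t' ^ P) t]

set_option maxHeartbeats 400000 in
lemma sym_conv {B h : ℝ → EN} (hBm : Measurable B) (hhm : Measurable h) (hhe : ∀ a b, h (a - b) = h (b - a))
    {P : ℝ} (hP : 1 < P) (C2 : EN) (hC2 : C2 ≠ ⊤) :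
    ∫⁻ t, ∫⁻ t', B t ^ (P - 1) * B t' ^ (P - 1) * (C2 * h (t - t') * B t ^ (1 / 2 : ℝ) * B t' ^ (1 / 2 : ℝ)) ≤
      C2 * (2 * ((∫⁻ t, B t ^ P) * ((∫⁻ t, B t ^ P) ^ (1 - 1 / P) * (∫⁻ t, h t ^ P) ^ (1 / P)))) := by
  have ePm : ∀ y : EN, y ^ (P - 1) * y = y ^ P := by
    intro y
    nth_rw 2 [← ENNReal.rpow_one y]
    rw [← ENNReal.rpow_add_of_nonneg _ _ (by linarith) (by linarith)]; congr 1; ring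
  have hcv := holder_conv hBm hhm hP
  set I := ∫⁻ t, ∫⁻ t', B t ^ P * (B t' ^ (P - 1) * h (t - t')) with hI
  have hm2 : Measurable fun z : ℝ × ℝ => h (z.1 - z.2) := hhm.comp (by fun_prop)
  have hpt : ∀ t t', B t ^ (P - 1) * B t' ^ (P - 1) * (C2 * h (t - t') * B t ^ (1 / 2 : ℝ) * B t' ^ (1 / 2 : ℝ)) ≤
      C2 * (B t ^ P * (B t' ^ (P - 1) * h (t - t')) + B t' ^ P * (B t ^ (P - 1) * h (t' - t))) := by
    intro t t'
    have hg : B t ^ (1 / 2 : ℝ) * B t' ^ (1 / 2 : ℝ) ≤ B t + B t' := by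
      have e : ∀ y : EN, y ^ (1 / 2 : ℝ) * y ^ (1 / 2 : ℝ) = y := fun y => by rw [← pow_two, ehalf_sq]
      rcases le_total (B t) (B t') with hle | hle
      · exact (mul_le_mul_left (ENNReal.rpow_le_rpow hle (by norm_num)) _).trans ((e _).le.trans le_add_self)
      · exact (mul_le_mul_right (ENNReal.rpow_le_rpow hle (by norm_num)) _).trans ((e _).le.trans le_self_add)
    calc _ = (C2 * h (t - t') * (B t ^ (P - 1) * B t' ^ (P - 1))) * (B t ^ (1 / 2 : ℝ) * B t' ^ (1 / 2 : ℝ)) := by ring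
      _ ≤ (C2 * h (t - t') * (B t ^ (P - 1) * B t' ^ (P - 1))) * (B t + B t') := mul_le_mul_right hg _
      _ = _ := by rw [hhe t' t, ← ePm (B t), ← ePm (B t')]; ring
  have hI2 : ∫⁻ t, ∫⁻ t', B t' ^ P * (B t ^ (P - 1) * h (t' - t)) = I := by
    rw [lintegral_lintegral_swap]
    have : Measurable fun z : ℝ × ℝ => h (z.2 - z.1) := hhm.comp (by fun_prop)
    apply Measurable.aemeasurable
    unfold Function.uncurry
    fun_prop
  have hle : ∫⁻ t, ∫⁻ t', B t ^ (P - 1) * B t' ^ (P - 1) * (C2 * h (t - t') * B t ^ (1 / 2 : ℝ) * B t' ^ (1 / 2 : ℝ)) ≤ C2 * (I + I) := by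
    refine (lintegral_mono fun t => lintegral_mono fun t' => hpt t t').trans (le_of_eq ?_)
    have : ∀ t, Measurable fun t' => h (t - t') := fun t => hhm.comp (by fun_prop)
    have e1 : ∀ t, ∫⁻ t', C2 * (B t ^ P * (B t' ^ (P - 1) * h (t - t')) + B t' ^ P * (B t ^ (P - 1) * h (t' - t))) =
       C2 * ((∫⁻ t', B t ^ P * (B t' ^ (P - 1) * h (t - t'))) + ∫⁻ t', B t' ^ P * (B t ^ (P - 1) * h (t' - t))) := by
      intro t
      rw [lintegral_const_mul' _ _ hC2, lintegral_add_left]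
      have := this t; fun_prop
    simp_rw [e1]
    rw [lintegral_const_mul' _ _ hC2, lintegral_add_left, hI2]
    exact Measurable.lintegral_prod_right' (f := fun z : ℝ × ℝ => B z.1 ^ P * (B z.2 ^ (P - 1) * h (z.1 - z.2))) (by fun_prop)
  refine hle.trans ?_
  rw [two_mul]; gcongr

lemma absorb_P {Y K : EN} {P : ℝ} (hP : 1 < P) (hY : Y ≠ ⊤) (h : Y ^ 2 ≤ K * (Y * Y ^ (1 - 1 / P))) : Y ≤ K ^ P := by
  rcases eq_or_ne Y 0 with h0 | h0
  · simp [h0]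
  have hP' : 1 / P < 1 := by rw [div_lt_one (by linarith)]; exact hP
  have hp0 : 0 < 1 / P := by positivity
  have h1 : Y ^ (1 / P) ≤ K := by
    have e : Y ^ 2 = Y ^ (1 / P) * (Y * Y ^ (1 - 1 / P)) := by
      have : Y * Y ^ (1 - 1 / P) = Y ^ (2 - 1 / P) := by
        nth_rw 1 [← ENNReal.rpow_one Y]
        rw [← ENNReal.rpow_add _ _ h0 hY]; congr 1; ring
      rw [this, ← ENNReal.rpow_add _ _ h0 hY, ← ENNReal.rpow_natCast]; congr 1; push_cast; ring
    rw [e] at h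
    refine (ENNReal.mul_le_mul_iff_left ?_ ?_).1 h
    · have : Y ^ (1 - 1 / P) ≠ 0 := by simp [ENNReal.rpow_eq_zero_iff, h0, hY]
      exact mul_ne_zero h0 this
    · have := ENNReal.rpow_ne_top_of_nonneg (by linarith : 0 ≤ 1 - 1 / P) hY
      finiteness
  have := ENNReal.rpow_le_rpow h1 (by linarith : 0 ≤ P)
  rwa [← ENNReal.rpow_mul, one_div_mul_cancel (by linarith), ENNReal.rpow_one] at this

set_option maxHeartbeats 400000 in
lemma lemA0 {s θ P : ℝ} (hs : 1 / 4 < s) (hθ : 1 / 2 < θ) (hP : 2 < P) (hP2 : 1 - 2 * s < 1 / P) :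
    ∃ C : EN, C ≠ ⊤ ∧ ∀ (u : SM) (x : ℝ → V2), Measurable x →
      ∫⁻ t, BB u t (x t) ^ P ≤ (C * HN s θ u ^ 2) ^ P := by
  have h1P : 1 / P < 1 / 2 := one_div_lt_one_div_of_lt (by norm_num) hP
  have hp0 : 0 < 1 / P := by positivity
  set δ := (1 / 2 - 1 / P) / 2 with hδdef
  have hδ0 : 0 < δ := by rw [hδdef]; linarith
  have hδ1 : δ < 1 / 2 := by rw [hδdef]; linarith
  have hδP : 1 < P * (1 / 2 - δ) := by
    have : 1 / 2 - δ = (1 / 2 + 1 / P) / 2 := by rw [hδdef]; ring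
    rw [this]
    have : P * (1 / P) = 1 := by field_simp
    nlinarith
  obtain ⟨C1, hC1, H1⟩ := TT2 (s := s) (by linarith) hθ
  obtain ⟨C2, hC2, H2⟩ := L4 hδ0 hδ1
  obtain ⟨J, hJ, HJ⟩ := hNorm (by linarith : 0 < P) hδP
  obtain ⟨M, hM, hk⟩ := ker_sch (a := 1) (by norm_num) (by norm_num)
  simp only [ENNReal.rpow_neg_one] at hk
  refine ⟨C1 * (2 * C2 * J * ∫⁻ ρ in Set.Ioo (0:ℝ) 1, oR (ρ ^ (2*s-1 + (1 / P - 1)))), ?_, fun u x hx => ?_⟩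
  · have := rho_fin (a := 2*s-1 + (1 / P - 1)) (by linarith)
    finiteness
  obtain ⟨M', hM', hu⟩ := ker_u (fun z => ‖z‖ₑ⁻¹) hM hk u
  set B : ℝ → EN := fun t => BB u t (x t) with hB
  have hBm : Measurable B := BB_meas' u.continuous.measurable hx
  have hBle : ∀ t, B t ≤ M' * oR ((1 + |t|) ^ (-2 : ℝ)) := fun t => (hu t (x t)).2
  have hone : ∀ t : ℝ, oR ((1 + |t|) ^ (-2 : ℝ)) ≤ 1 := by
    intro y
    rw [← ENNReal.ofReal_one]
    exact ENNReal.ofReal_le_ofReal (Real.rpow_le_one_of_one_le_of_nonpos (by linarith [abs_nonneg y]) (by norm_num))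
  have hBM : ∀ t, B t ≤ M' := fun t => (hBle t).trans (mul_le_of_le_one_right' (hone t))
  have hjap := jap1_fin (b := 2) (by norm_num)
  have hbP : ∀ t, B t ^ (P - 1) ≤ M' ^ (P - 1) := fun t => ENNReal.rpow_le_rpow (hBM t) (by linarith)
  have hMP : M' ^ (P - 1) ≠ ⊤ := ENNReal.rpow_ne_top_of_nonneg (by linarith) hM'
  have key := H1 (fun z => ‖z‖ₑ⁻¹) (by fun_prop) (by simp) (by intro y hy; simp [hy])
    (fun ρ T => C2 * oR ((ρ+|T|)^(δ-1/2) * ρ^(-(1/2)-δ))) (fun ρ T b h0 _ => H2 ρ T b h0) u volume inferInstance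
    (fun t => B t ^ (P - 1)) (by fun_prop) (fun t => ne_top_of_le_ne_top hMP (hbP t)) x hx (by
      refine ne_top_of_le_ne_top (b := ∫⁻ t, M' ^ (P - 1) * M' * oR ((1 + |t|) ^ (-2 : ℝ))) ?_ (lintegral_mono fun t => ?_)
      · rw [lintegral_const_mul' _ _ (by finiteness)]; finiteness
      · rw [mul_assoc]
        exact mul_le_mul' (hbP t) (hu t (x t)).1)
  change (∫⁻ t, B t ^ (P - 1) * B t) ^ 2 ≤ C1 * HN s θ u ^ 2 * ∫⁻ ρ in Set.Ioo (0:ℝ) 1, oR (ρ ^ (2*s-1)) *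
          ∫⁻ t, ∫⁻ t', B t ^ (P - 1) * B t' ^ (P - 1) * (C2 * oR ((ρ+|t - t'|)^(δ-1/2) * ρ^(-(1/2)-δ)) * B t ^ (1 / 2 : ℝ) * B t' ^ (1 / 2 : ℝ)) at key
  have ePm : ∀ y : EN, y ^ (P - 1) * y = y ^ P := by
    intro y
    nth_rw 2 [← ENNReal.rpow_one y]
    rw [← ENNReal.rpow_add_of_nonneg _ _ (by linarith) (by linarith)]; congr 1; ring
  simp only [ePm] at key
  set Y := ∫⁻ t, B t ^ P with hY
  have hYf : Y ≠ ⊤ := by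
    refine ne_top_of_le_ne_top (b := ∫⁻ t, M' ^ (P - 1) * M' * oR ((1 + |t|) ^ (-2 : ℝ))) ?_ (lintegral_mono fun t => ?_)
    · rw [lintegral_const_mul' _ _ (by finiteness)]; finiteness
    · rw [← ePm, mul_assoc]; exact mul_le_mul' (hbP t) (hBle t)
  apply absorb_P (by linarith) hYf
  refine key.trans ?_
  have hin : ∀ ρ ∈ Set.Ioo (0:ℝ) 1, oR (ρ ^ (2*s-1)) *
          ∫⁻ t, ∫⁻ t', B t ^ (P - 1) * B t' ^ (P - 1) * (C2 * oR ((ρ+|t - t'|)^(δ-1/2) * ρ^(-(1/2)-δ)) * B t ^ (1 / 2 : ℝ) * B t' ^ (1 / 2 : ℝ)) ≤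
        (2 * C2 * J * (Y * Y ^ (1 - 1 / P))) * oR (ρ ^ (2*s-1 + (1 / P - 1))) := by
    intro ρ hρ
    set h : ℝ → EN := fun T => oR ((ρ+|T|)^(δ-1/2) * ρ^(-(1/2)-δ)) with hh
    have hhm : Measurable h := by fun_prop
    have hhe : ∀ a b, h (a - b) = h (b - a) := fun a b => by simp only [hh, abs_sub_comm]
    have hle := sym_conv hBm hhm hhe (by linarith : 1 < P) C2 hC2
    calc _ ≤ oR (ρ ^ (2*s-1)) * (C2 * (2 * (Y * (Y ^ (1 - 1 / P) * (∫⁻ t, h t ^ P) ^ (1 / P))))) := mul_le_mul_right hle _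
      _ ≤ oR (ρ ^ (2*s-1)) * (C2 * (2 * (Y * (Y ^ (1 - 1 / P) * (J * oR (ρ ^ (1 / P - 1))))))) := by
          have := HJ ρ hρ.1
          gcongr
      _ = _ := by
          have := hρ.1
          rw [Real.rpow_add hρ.1, ENNReal.ofReal_mul (by positivity)]; ring
  refine (mul_le_mul_right (setLIntegral_mono' measurableSet_Ioo hin) _).trans (le_of_eq ?_)
  rw [lintegral_const_mul' _ _ (by
    have := ENNReal.rpow_ne_top_of_nonneg (by linarith : 0 ≤ 1 - 1 / P) hYf
    finiteness)]
  ring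

/-- a dense sequence -/
@[irreducible] def dsq : ℕ → V2 := (TopologicalSpace.exists_dense_seq V2).choose

lemma dsq_dense : DenseRange dsq := by
  unfold dsq; exact (TopologicalSpace.exists_dense_seq V2).choose_spec

/-- `sup_x` of the potential -/
def NN (u : ℝ × V2 → ℂ) (t : ℝ) : EN := ⨆ i : ℕ, BB u t (dsq i)

lemma NN_meas {u : ℝ × V2 → ℂ} (hu : Measurable u) : Measurable (NN u) := by
  unfold NN
  exact Measurable.iSup fun i => BB_meas' hu measurable_const

lemma BB_le_NN {u : ℝ × V2 → ℂ} (hu : Measurable u) (t : ℝ) (x : V2) : BB u t x ≤ NN u t := by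
  have hd := dsq_dense
  obtain ⟨z, hz, hlim⟩ := mem_closure_iff_seq_limit.1 (hd x)
  have h1 : BB u t x ≤ Filter.liminf (fun n => BB u t (z n)) Filter.atTop := by
    unfold BB
    refine le_trans (lintegral_mono fun y => ?_) (lintegral_liminf_le fun n => by fun_prop)
    by_cases h0 : ‖u (t, y)‖ₑ = 0
    · simp [h0]
    apply le_of_eq
    symm
    apply Filter.Tendsto.liminf_eq
    have hc : Continuous fun w : V2 => ‖w - y‖ₑ⁻¹ := by fun_prop
    exact ENNReal.Tendsto.mul_const ((hc.tendsto x).comp hlim) (Or.inr (by finiteness))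
  refine h1.trans ?_
  refine Filter.liminf_le_of_le (by isBoundedDefault) fun b hb => ?_
  obtain ⟨n, hn⟩ := hb.exists
  obtain ⟨i, hi⟩ := hz n
  refine hn.trans ?_
  rw [← hi]
  exact le_iSup (fun i => BB u t (dsq i)) i

set_option maxHeartbeats 400000 in
lemma lemA {s θ P : ℝ} (hs : 1 / 4 < s) (hθ : 1 / 2 < θ) (hP : 2 < P) (hP2 : 1 - 2 * s < 1 / P) :
    ∃ C : EN, C ≠ ⊤ ∧ ∀ (u : SM),
      ∫⁻ t, NN u t ^ P ≤ (C * HN s θ u ^ 2) ^ P := by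
  obtain ⟨C, hC, H⟩ := lemA0 hs hθ hP hP2
  refine ⟨C, hC, fun u => ?_⟩
  have hum : Measurable u := u.continuous.measurable
  have hBi : ∀ x : ℝ → V2, Measurable x → Measurable fun t => BB u t (x t) := fun x hx =>
    BB_meas' hum hx
  have hch : ∀ n : ℕ, ∃ x : ℝ → V2, Measurable x ∧ ∀ t, ∀ i ≤ n, BB u t (dsq i) ≤ BB u t (x t) := by
    intro n
    induction n with
    | zero => exact ⟨fun _ => dsq 0, measurable_const, fun t i hi => by rw [Nat.le_zero.1 hi]⟩
    | succ n ih =>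
      obtain ⟨x, hx, hx2⟩ := ih
      refine ⟨fun t => if BB u t (x t) < BB u t (dsq (n+1)) then dsq (n+1) else x t, ?_, fun t i hi => ?_⟩
      · exact Measurable.ite (measurableSet_lt (hBi x hx) (hBi _ measurable_const)) measurable_const hx
      · rcases Nat.lt_or_ge n i with h | h
        · have : i = n + 1 := by omega
          subst this
          dsimp only; split_ifs with h3
          · exact le_rfl
          · exact not_lt.1 h3
        · dsimp only; split_ifs with h3
          · exact (hx2 t i h).trans h3.le
          · exact hx2 t i h
  have hps : ∀ t, NN u t = ⨆ n, partialSups (fun i => BB u t (dsq i)) n := fun t => by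
    rw [iSup_partialSups_eq]; rfl
  have hpow : ∀ t, NN u t ^ P = ⨆ n, (partialSups (fun i => BB u t (dsq i)) n) ^ P := by
    intro t
    rw [hps]
    exact (ENNReal.orderIsoRpow P (by linarith)).map_iSup _
  simp_rw [hpow]
  rw [lintegral_iSup]
  · refine iSup_le fun n => ?_
    obtain ⟨x, hx, hx2⟩ := hch n
    refine le_trans (lintegral_mono fun t => ?_) (H u x hx)
    refine ENNReal.rpow_le_rpow ?_ (by linarith)
    exact partialSups_le _ _ _ fun i hi => hx2 t i hi
  · intro n
    refine Measurable.pow_const ?_ _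
    have : ∀ n, Measurable fun t => partialSups (fun i => BB u t (dsq i)) n := by
      intro n
      induction n with
      | zero => simpa using hBi _ measurable_const
      | succ n ih =>
        have e : ∀ t, partialSups (fun i => BB u t (dsq i)) (n+1) = partialSups (fun i => BB u t (dsq i)) n ⊔ BB u t (dsq (n+1)) := fun t => partialSups_add_one _ _
        simp_rw [e]
        exact ih.sup (hBi _ measurable_const)
    exact this n
  · intro a b hab t
    exact ENNReal.rpow_le_rpow ((partialSups (fun i => BB u t (dsq i))).monotone hab) (by linarith)

lemma rad_scale (S : Set V2) (hS : MeasurableSet S) (a : ℝ) (x : V2) {R : ℝ} (hR : 0 < R) :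
    ∫⁻ y in (fun y => R⁻¹ • (x - y)) ⁻¹' S, ‖x - y‖ₑ ^ (-a) = oR (R ^ (2 - a)) * ∫⁻ z in S, ‖z‖ₑ ^ (-a) := by
  have hpre : MeasurableSet ((fun y : V2 => R⁻¹ • (x - y)) ⁻¹' S) := by
    have : Measurable fun y : V2 => R⁻¹ • (x - y) := by fun_prop
    exact this hS
  rw [← lintegral_indicator hpre, ← lintegral_indicator hS]
  have h1 := lintegral_sub_left_eq_self (μ := volume) (fun z : V2 => S.indicator (fun z => ‖R • z‖ₑ ^ (-a)) (R⁻¹ • z)) x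
  have h2 : ∀ y, ((fun y => R⁻¹ • (x - y)) ⁻¹' S).indicator (fun y => ‖x - y‖ₑ ^ (-a)) y = S.indicator (fun z => ‖R • z‖ₑ ^ (-a)) (R⁻¹ • (x - y)) := by
    intro y
    by_cases h : R⁻¹ • (x - y) ∈ S
    · rw [Set.indicator_of_mem h, Set.indicator_of_mem (by exact h), smul_inv_smul₀ hR.ne']
    · rw [Set.indicator_of_notMem h, Set.indicator_of_notMem (by exact h)]
  simp_rw [h2]
  rw [h1, lintegral_scale volume _ hR]
  have h3 : ∀ z : V2, S.indicator (fun z => ‖R • z‖ₑ ^ (-a)) (R⁻¹ • R • z) = oR (R ^ (-a)) * S.indicator (fun z => ‖z‖ₑ ^ (-a)) z := by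
    intro z
    rw [inv_smul_smul₀ hR.ne']
    by_cases h : z ∈ S
    · rw [Set.indicator_of_mem h, Set.indicator_of_mem h, enorm_smul, ENNReal.mul_rpow_of_ne_top (by simp) (by simp)]
      congr 1
      rw [← ofReal_norm, Real.norm_of_nonneg hR.le, ENNReal.ofReal_rpow_of_pos hR]
    · simp [h]
  simp_rw [h3]
  rw [lintegral_const_mul' _ _ ENNReal.ofReal_ne_top, ← mul_assoc, ← ENNReal.ofReal_mul (by positivity)]
  congr 2
  rw [show (2:ℝ) - a = 2 + -a by ring, Real.rpow_add hR]; simp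

lemma hls_half {r : ℝ} (h1 : 1 < r) (h2 : r < 2) : ∃ C : EN, C ≠ ⊤ ∧ ∀ (D : V2 → EN), Measurable D → ∫⁻ y, D y ≤ 1 →
    ∀ (A : EN) (x : V2), A ≠ ⊤ →
      ∫⁻ y in {y | D y ≤ A}, ‖x - y‖ₑ⁻¹ * D y ^ (1 / r) ≤ C * A ^ (1 / r - 1 / 2) := by
  have hr0 : 0 < r := by linarith
  have hir : 1 / 2 < 1 / r := one_div_lt_one_div_of_lt (by linarith) h2
  set r' := r / (r - 1) with hr'
  have hc : r'.HolderConjugate r := (Real.HolderConjugate.conjExponent h1).symm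
  have hr'2 : 2 < r' := by rw [hr', lt_div_iff₀ (by linarith)]; linarith
  have hinv : 1 / r' = 1 - 1 / r := by rw [hr']; field_simp
  set c1 := ∫⁻ x in Metric.ball (0 : V2) 1, ‖x‖ₑ ^ (-(1:ℝ)) with hc1
  set c2 := ∫⁻ x in (Metric.ball (0 : V2) 1)ᶜ, ‖x‖ₑ ^ (-r') with hc2
  have f1 : c1 ≠ ⊤ := near_fin (by norm_num)
  have f2 : c2 ≠ ⊤ := far_fin hr'2
  have f3 : c2 ^ (1 / r') ≠ ⊤ := ENNReal.rpow_ne_top_of_nonneg (by positivity) f2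
  refine ⟨c1 + c2 ^ (1 / r'), by finiteness, fun D hD hDi A x hA => ?_⟩
  rcases eq_or_ne A 0 with h0 | h0
  · have hms : MeasurableSet {y | D y ≤ A} := measurableSet_le hD measurable_const
    rw [setLIntegral_congr_fun hms (g := fun _ => 0)]
    · simp
    · intro y hy
      have : D y = 0 := by rw [h0] at hy; exact le_antisymm hy (zero_le)
      simp [this, hr0]
  set α := A.toReal with hα
  have hα0 : 0 < α := ENNReal.toReal_pos h0 hA
  have hAα : A = oR α := (ENNReal.ofReal_toReal hA).symm
  set R := α ^ (-(1/2) : ℝ) with hRdef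
  have hR : 0 < R := by positivity
  set U := (fun y : V2 => R⁻¹ • (x - y)) ⁻¹' (Metric.ball (0:V2) 1) with hU
  have hUm : MeasurableSet U := by
    have : Measurable fun y : V2 => R⁻¹ • (x - y) := by fun_prop
    exact this measurableSet_ball
  have hms : MeasurableSet {y | D y ≤ A} := measurableSet_le hD measurable_const
  rw [← lintegral_inter_add_diff (μ := volume) (A := {y | D y ≤ A}) (f := fun y => ‖x - y‖ₑ⁻¹ * D y ^ (1 / r)) hUm, add_mul]
  refine add_le_add ?_ ?_
  · calc ∫⁻ y in {y | D y ≤ A} ∩ U, ‖x - y‖ₑ⁻¹ * D y ^ (1 / r) ≤ ∫⁻ y in {y | D y ≤ A} ∩ U, A ^ (1 / r) * ‖x - y‖ₑ ^ (-(1:ℝ)) := by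
          refine setLIntegral_mono' (hms.inter hUm) fun y hy => ?_
          rw [ENNReal.rpow_neg_one, mul_comm]
          exact mul_le_mul_left (ENNReal.rpow_le_rpow hy.1 (by positivity)) _
      _ ≤ ∫⁻ y in U, A ^ (1 / r) * ‖x - y‖ₑ ^ (-(1:ℝ)) := lintegral_mono_set Set.inter_subset_right
      _ = A ^ (1 / r) * (oR (R ^ (2 - (1:ℝ))) * c1) := by
          rw [lintegral_const_mul' _ _ (ENNReal.rpow_ne_top_of_nonneg (by positivity) hA), hU, rad_scale _ measurableSet_ball _ _ hR]
      _ = c1 * A ^ (1 / r - 1 / 2) := by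
          rw [← mul_assoc, mul_comm]
          congr 1
          rw [hAα, ENNReal.ofReal_rpow_of_pos hα0, ENNReal.ofReal_rpow_of_pos hα0, ← ENNReal.ofReal_mul (by positivity)]
          congr 1
          rw [hRdef, ← Real.rpow_mul hα0.le, ← Real.rpow_add hα0]; congr 1; ring
  · calc ∫⁻ y in {y | D y ≤ A} \ U, ‖x - y‖ₑ⁻¹ * D y ^ (1 / r) ≤ ∫⁻ y in Uᶜ, ‖x - y‖ₑ⁻¹ * D y ^ (1 / r) :=
          lintegral_mono_set (by rw [Set.diff_eq]; exact Set.inter_subset_right)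
      _ ≤ (∫⁻ y in Uᶜ, ‖x - y‖ₑ⁻¹ ^ r') ^ (1 / r') * (∫⁻ y in Uᶜ, (D y ^ (1 / r)) ^ r) ^ (1 / r) :=
          ENNReal.lintegral_mul_le_Lp_mul_Lq _ hc (f := fun y => ‖x - y‖ₑ⁻¹) (g := fun y => D y ^ (1 / r)) (by fun_prop) (by fun_prop)
      _ ≤ (oR (R ^ (2 - r')) * c2) ^ (1 / r') * 1 := by
          refine mul_le_mul' (ENNReal.rpow_le_rpow (le_of_eq ?_) (by positivity)) ?_
          · have := rad_scale (Metric.ball (0:V2) 1)ᶜ measurableSet_ball.compl r' x hR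
            rw [Set.preimage_compl] at this
            rw [hc2, ← this]
            refine lintegral_congr fun y => ?_
            rw [ENNReal.rpow_neg, ENNReal.inv_rpow]
          · refine ENNReal.rpow_le_one ?_ (by positivity)
            refine le_trans (le_trans (setLIntegral_le_lintegral _ _) (le_of_eq (lintegral_congr fun y => ?_))) hDi
            rw [← ENNReal.rpow_mul, one_div_mul_cancel hr0.ne', ENNReal.rpow_one]
      _ = c2 ^ (1 / r') * A ^ (1 / r - 1 / 2) := by
          rw [mul_one, ENNReal.mul_rpow_of_nonneg _ _ (by positivity), mul_comm]
          congr 1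
          rw [hAα, ENNReal.ofReal_rpow_of_pos hα0, ENNReal.ofReal_rpow_of_pos (by positivity)]
          congr 1
          rw [hRdef, ← Real.rpow_mul hα0.le, ← Real.rpow_mul hα0.le]; congr 1
          have : (2 - r') * (1 / r') = 2 * (1 / r') - 1 := by field_simp
          rw [mul_assoc, this, hinv]; ring

lemma hls_norm {r r2 : ℝ} (h1 : 1 < r) (h2 : r < 2) (h3 : 1 < r2) (h4 : r2 < 2) (h5 : 1 / r + 1 / r2 = 3 / 2) :
    ∃ C : EN, C ≠ ⊤ ∧ ∀ (D E : V2 → EN), Measurable D → Measurable E → (∀ y, D y ≠ ⊤) → (∀ y, E y ≠ ⊤) →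
     ∫⁻ y, D y ≤ 1 → ∫⁻ y, E y ≤ 1 →
      ∫⁻ x, ∫⁻ y, E x ^ (1 / r2) * (‖x - y‖ₑ⁻¹ * D y ^ (1 / r)) ≤ C := by
  obtain ⟨C1, hC1, H1⟩ := hls_half h1 h2
  obtain ⟨C2, hC2, H2⟩ := hls_half h3 h4
  refine ⟨C1 + C2, by finiteness, fun D E hD hE hDf hEf hDi hEi => ?_⟩
  have hir : 1 / 2 < 1 / r := one_div_lt_one_div_of_lt (by linarith) h2
  have hir2 : 1 / 2 < 1 / r2 := one_div_lt_one_div_of_lt (by linarith) h4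
  have hmG : Measurable fun z : V2 × V2 => E z.1 ^ (1 / r2) * (‖z.1 - z.2‖ₑ⁻¹ * D z.2 ^ (1 / r)) := by fun_prop
  set S : Set (V2 × V2) := {z | D z.2 ≤ E z.1} with hS
  have hSm : MeasurableSet S := measurableSet_le (by fun_prop) (by fun_prop)
  rw [← lintegral_prod (fun z : V2 × V2 => E z.1 ^ (1 / r2) * (‖z.1 - z.2‖ₑ⁻¹ * D z.2 ^ (1 / r))) hmG.aemeasurable,
    ← lintegral_add_compl _ hSm]
  refine add_le_add ?_ ?_
  · rw [← lintegral_indicator hSm, lintegral_prod _ (hmG.indicator hSm).aemeasurable]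
    calc _ ≤ ∫⁻ x, C1 * E x := by
          refine lintegral_mono fun x => ?_
          have hms : MeasurableSet {y | D y ≤ E x} := measurableSet_le hD measurable_const
          calc ∫⁻ y, S.indicator (fun z : V2 × V2 => E z.1 ^ (1 / r2) * (‖z.1 - z.2‖ₑ⁻¹ * D z.2 ^ (1 / r))) (x, y)
              = ∫⁻ y in {y | D y ≤ E x}, E x ^ (1 / r2) * (‖x - y‖ₑ⁻¹ * D y ^ (1 / r)) := by
                rw [← lintegral_indicator hms]; rfl
            _ ≤ E x ^ (1 / r2) * (C1 * E x ^ (1 / r - 1 / 2)) := by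
                rw [lintegral_const_mul' _ _ (ENNReal.rpow_ne_top_of_nonneg (by positivity) (hEf x))]
                exact mul_le_mul_right (H1 D hD hDi (E x) x (hEf x)) _
            _ = C1 * E x := by
                rw [mul_left_comm, ← ENNReal.rpow_add_of_nonneg _ _ (by positivity) (by linarith)]
                rw [show 1 / r2 + (1 / r - 1 / 2) = 1 by linarith, ENNReal.rpow_one]
      _ ≤ C1 := by
          rw [lintegral_const_mul' _ _ hC1]
          exact mul_le_of_le_one_right' hEi
  · rw [← lintegral_indicator hSm.compl, lintegral_prod_symm _ (hmG.indicator hSm.compl).aemeasurable]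
    calc _ ≤ ∫⁻ y, C2 * D y := by
          refine lintegral_mono fun y => ?_
          have hms : MeasurableSet {x | E x ≤ D y} := measurableSet_le hE measurable_const
          calc ∫⁻ x, Sᶜ.indicator (fun z : V2 × V2 => E z.1 ^ (1 / r2) * (‖z.1 - z.2‖ₑ⁻¹ * D z.2 ^ (1 / r))) (x, y)
              ≤ ∫⁻ x in {x | E x ≤ D y}, D y ^ (1 / r) * (‖y - x‖ₑ⁻¹ * E x ^ (1 / r2)) := by
                rw [← lintegral_indicator hms]
                refine lintegral_mono fun x => ?_
                by_cases h : (x, y) ∈ Sᶜ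
                · have h' : x ∈ {x | E x ≤ D y} := by
                    simp only [hS, Set.mem_compl_iff, Set.mem_setOf_eq, not_le] at h; exact h.le
                  rw [Set.indicator_of_mem h, Set.indicator_of_mem h', ← edist_eq_enorm_sub, edist_comm, edist_eq_enorm_sub]
                  apply le_of_eq; ring
                · rw [Set.indicator_of_notMem h]; exact zero_le
            _ ≤ D y ^ (1 / r) * (C2 * D y ^ (1 / r2 - 1 / 2)) := by
                rw [lintegral_const_mul' _ _ (ENNReal.rpow_ne_top_of_nonneg (by positivity) (hDf y))]
                exact mul_le_mul_right (H2 E hE hEi (D y) y (hDf y)) _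
            _ = C2 * D y := by
                rw [mul_left_comm, ← ENNReal.rpow_add_of_nonneg _ _ (by positivity) (by linarith)]
                rw [show 1 / r + (1 / r2 - 1 / 2) = 1 by linarith, ENNReal.rpow_one]
      _ ≤ C2 := by
          rw [lintegral_const_mul' _ _ hC2]
          exact mul_le_of_le_one_right' hDi

lemma hls {r r2 : ℝ} (h1 : 1 < r) (h2 : r < 2) (h3 : 1 < r2) (h4 : r2 < 2) (h5 : 1 / r + 1 / r2 = 3 / 2) :
    ∃ C : EN, C ≠ ⊤ ∧ ∀ (F g : V2 → EN), Measurable F → Measurable g → (∀ y, F y ≠ ⊤) → (∀ y, g y ≠ ⊤) →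
     ∫⁻ y, F y ^ r ≠ ⊤ → ∫⁻ y, g y ^ r2 ≠ ⊤ →
      ∫⁻ x, g x * ∫⁻ y, ‖x - y‖ₑ⁻¹ * F y ≤ C * (∫⁻ y, g y ^ r2) ^ (1 / r2) * (∫⁻ y, F y ^ r) ^ (1 / r) := by
  obtain ⟨C, hC, H⟩ := hls_norm h1 h2 h3 h4 h5
  refine ⟨C, hC, fun F g hF hg hFf hgf hFi hgi => ?_⟩
  have hr0 : 0 < r := by linarith
  have hr20 : 0 < r2 := by linarith
  set a := ∫⁻ y, F y ^ r with ha
  set b := ∫⁻ y, g y ^ r2 with hb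
  rcases eq_or_ne a 0 with ha0 | ha0
  · have : ∀ᵐ y, F y = 0 := by
      have := (lintegral_eq_zero_iff (hF.pow_const r)).1 ha0
      filter_upwards [this] with y hy
      simpa [hr0, hr0.not_gt] using hy
    have e : ∀ x : V2, ∫⁻ y, ‖x - y‖ₑ⁻¹ * F y = 0 := fun x => by
      rw [lintegral_eq_zero_iff (by fun_prop)]
      filter_upwards [this] with y hy
      simp [hy]
    simp [e]
  rcases eq_or_ne b 0 with hb0 | hb0
  · have : ∀ᵐ y, g y = 0 := by
      have := (lintegral_eq_zero_iff (hg.pow_const r2)).1 hb0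
      filter_upwards [this] with y hy
      simpa [hr20, hr20.not_gt] using hy
    have e : ∫⁻ x, g x * ∫⁻ y, ‖x - y‖ₑ⁻¹ * F y = ∫⁻ x : V2, 0 := by
      apply lintegral_congr_ae
      filter_upwards [this] with y hy
      simp [hy]
    rw [e]; simp
  have h := H (fun y => a⁻¹ * F y ^ r) (fun y => b⁻¹ * g y ^ r2) (by fun_prop) (by fun_prop)
    (fun y => ENNReal.mul_ne_top (by simpa using ha0) (ENNReal.rpow_ne_top_of_nonneg hr0.le (hFf y)))
    (fun y => ENNReal.mul_ne_top (by simpa using hb0) (ENNReal.rpow_ne_top_of_nonneg hr20.le (hgf y)))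
    (by rw [lintegral_const_mul' _ _ (by simpa using ha0), ENNReal.inv_mul_cancel ha0 hFi])
    (by rw [lintegral_const_mul' _ _ (by simpa using hb0), ENNReal.inv_mul_cancel hb0 hgi])
  have ea : a ^ (1 / r) * (a⁻¹) ^ (1 / r) = 1 := by
    rw [← ENNReal.mul_rpow_of_nonneg _ _ (by positivity), ENNReal.mul_inv_cancel ha0 hFi, ENNReal.one_rpow]
  have eb : b ^ (1 / r2) * (b⁻¹) ^ (1 / r2) = 1 := by
    rw [← ENNReal.mul_rpow_of_nonneg _ _ (by positivity), ENNReal.mul_inv_cancel hb0 hgi, ENNReal.one_rpow]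
  have at1 : a ^ (1 / r) ≠ ⊤ := ENNReal.rpow_ne_top_of_nonneg (by positivity) hFi
  have bt1 : b ^ (1 / r2) ≠ ⊤ := ENNReal.rpow_ne_top_of_nonneg (by positivity) hgi
  have e1 : ∀ y, F y = a ^ (1 / r) * (a⁻¹ * F y ^ r) ^ (1 / r) := by
    intro y
    rw [ENNReal.mul_rpow_of_nonneg _ _ (by positivity), ← mul_assoc, ea, one_mul, ← ENNReal.rpow_mul, mul_one_div_cancel hr0.ne', ENNReal.rpow_one]
  have e2 : ∀ y, g y = b ^ (1 / r2) * (b⁻¹ * g y ^ r2) ^ (1 / r2) := by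
    intro y
    rw [ENNReal.mul_rpow_of_nonneg _ _ (by positivity), ← mul_assoc, eb, one_mul, ← ENNReal.rpow_mul, mul_one_div_cancel hr20.ne', ENNReal.rpow_one]
  calc ∫⁻ x, g x * ∫⁻ y, ‖x - y‖ₑ⁻¹ * F y
      = ∫⁻ x, ∫⁻ y, (b ^ (1 / r2) * a ^ (1 / r)) * ((b⁻¹ * g x ^ r2) ^ (1 / r2) * (‖x - y‖ₑ⁻¹ * (a⁻¹ * F y ^ r) ^ (1 / r))) := by
        refine lintegral_congr fun x => ?_
        rw [← lintegral_const_mul' _ _ (hgf x)]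
        refine lintegral_congr fun y => ?_
        conv_lhs => rw [e1 y, e2 x]
        ring
    _ = (b ^ (1 / r2) * a ^ (1 / r)) * ∫⁻ x, ∫⁻ y, ((b⁻¹ * g x ^ r2) ^ (1 / r2) * (‖x - y‖ₑ⁻¹ * (a⁻¹ * F y ^ r) ^ (1 / r))) := by
        rw [← lintegral_const_mul' _ _ (by finiteness)]
        refine lintegral_congr fun x => ?_
        rw [lintegral_const_mul' _ _ (by finiteness)]
    _ ≤ (b ^ (1 / r2) * a ^ (1 / r)) * C := mul_le_mul_right h _
    _ = _ := by ring

/-- The Schwartz derivative. -/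
def pdS (j : Fin 2) (u : SM) : SM :=
  SchwartzMap.evalCLM ℝ (ℝ × V2) ℂ ((0 : ℝ), EuclideanSpace.single j 1) (SchwartzMap.fderivCLM ℝ (ℝ × V2) ℂ u)

lemma pdS_coe (j : Fin 2) (u : SM) : ⇑(pdS j u) = pdx j ⇑u := by
  ext p; simp [pdS, pdx]

lemma sch_dec5 (u : SM) (t : ℝ) (x : V2) : ∃ M : ℝ, 0 ≤ M ∧ ∀ y,
    ‖u (t, x + y)‖ ≤ M * (1 + ‖y‖) ^ (-5 : ℝ) := by
  have h := fun x => u.one_add_le_sup_seminorm_apply (𝕜 := ℝ) (m := (5, 0)) (k := 5) (n := 0) le_rfl le_rfl x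
  set M := 2 ^ 5 * (Finset.Iic (5, 0)).sup (fun m => SchwartzMap.seminorm ℝ m.1 m.2) u
  have hM : 0 ≤ M := le_trans (by positivity) (h 0)
  refine ⟨M * (1 + ‖x‖) ^ 5, by positivity, fun y => ?_⟩
  have h1 := h (t, x + y)
  simp only [norm_iteratedFDeriv_zero] at h1
  have e3 : (1 + ‖y‖) ^ (-5 : ℝ) = ((1 + ‖y‖) ^ 5)⁻¹ := by rw [Real.rpow_neg (by positivity)]; norm_cast
  rw [e3, ← div_eq_mul_inv, le_div_iff₀ (by positivity)]
  have a2 : ‖x + y‖ ≤ ‖(t, x + y)‖ := norm_snd_le (t, x + y)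
  have a3 : ‖y‖ ≤ ‖x‖ + ‖x + y‖ := by
    calc ‖y‖ = ‖(x + y) - x‖ := by simp
      _ ≤ _ := (norm_sub_le _ _).trans (by linarith)
  have a4 : 1 + ‖y‖ ≤ (1 + ‖x‖) * (1 + ‖(t, x + y)‖) := by
    nlinarith [norm_nonneg x, norm_nonneg (x+y), norm_nonneg (t, x+y)]
  calc ‖u (t, x + y)‖ * (1 + ‖y‖) ^ 5 ≤ ‖u (t, x + y)‖ * ((1 + ‖x‖) * (1 + ‖(t, x + y)‖)) ^ 5 := by gcongr
    _ = ((1 + ‖(t, x + y)‖) ^ 5 * ‖u (t, x + y)‖) * (1 + ‖x‖) ^ 5 := by ring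
    _ ≤ _ := by gcongr

lemma int_gam (u : SM) (t : ℝ) (x : V2) {Γ : V2 → ℝ} (hc : Continuous Γ) {K : ℝ}
    (hK : ∀ y, |Γ y| ≤ K * (1 + ‖y‖) ^ 2) : Integrable (fun y => Γ y • u (t, x + y)) := by
  obtain ⟨M, hM, H⟩ := sch_dec5 u t x
  have hi := (integrable_one_add_norm (E := V2) (μ := volume) (r := 3) (by simp; norm_num)).const_mul (K * M)
  refine hi.mono' (by fun_prop) (.of_forall fun y => ?_)
  rw [norm_smul, Real.norm_eq_abs]
  have e : (1 + ‖y‖) ^ (-3 : ℝ) = (1 + ‖y‖) ^ 2 * (1 + ‖y‖) ^ (-5 : ℝ) := by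
    rw [← Real.rpow_natCast, ← Real.rpow_add (by positivity)]; norm_num
  rw [e]
  calc |Γ y| * ‖u (t, x + y)‖ ≤ (K * (1 + ‖y‖) ^ 2) * (M * (1 + ‖y‖) ^ (-5 : ℝ)) :=
        mul_le_mul (hK y) (H y) (norm_nonneg _) ((abs_nonneg _).trans (hK y))
    _ = _ := by ring

lemma slice_deriv (u : SM) (t : ℝ) (x y : V2) (j : Fin 2) :
    HasLineDerivAt ℝ (fun y => u (t, x + y)) (pdS j u (t, x + y)) y (EuclideanSpace.single j 1) := by
  have h1 : HasFDerivAt (fun y : V2 => (t, x + y)) (ContinuousLinearMap.inr ℝ ℝ V2) y := by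
    have := (hasFDerivAt_const t y).prodMk ((hasFDerivAt_id (𝕜 := ℝ) y).const_add x)
    exact this
  have h2 := (u.differentiable (t, x + y)).hasFDerivAt.comp y h1
  have h3 := h2.hasLineDerivAt (EuclideanSpace.single j 1)
  rw [pdS_coe]
  exact h3

lemma ibp (u : SM) (t : ℝ) (x : V2) (j : Fin 2) {Γ Γ' : V2 → ℝ} (hc : Continuous Γ)
    (hc' : Continuous Γ') {K : ℝ} (hK : ∀ y, |Γ y| ≤ K * (1 + ‖y‖) ^ 2) (hK' : ∀ y, |Γ' y| ≤ K * (1 + ‖y‖) ^ 2)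
    (hd : ∀ y, HasLineDerivAt ℝ Γ (Γ' y) y (EuclideanSpace.single j 1)) :
    ∫ y, Γ y • pdS j u (t, x + y) = - ∫ y, Γ' y • u (t, x + y) :=
  integral_bilinear_hasLineDerivAt_right_eq_neg_left_of_integrable (μ := volume)
    (B := ContinuousLinearMap.lsmul ℝ ℝ) (f := Γ) (f' := Γ') (g := fun y => u (t, x + y))
    (g' := fun y => pdS j u (t, x + y)) (v := EuclideanSpace.single j 1)
    (int_gam u t x hc' hK') (int_gam _ t x hc hK) (int_gam u t x hc hK) (fun y _ => hd y)
    (fun y _ => slice_deriv u t x y j)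

lemma nsq_line (y : V2) (τ : ℝ) (j : Fin 2) :
    ‖y + τ • EuclideanSpace.single j (1:ℝ)‖ ^ 2 = ‖y‖ ^ 2 + 2 * τ * y j + τ ^ 2 := by
  rw [norm_add_sq_real, inner_smul_right, norm_smul]
  simp [EuclideanSpace.inner_single_right]
  ring

lemma nsq_d (y : V2) (j : Fin 2) : HasDerivAt (fun τ : ℝ => ‖y + τ • EuclideanSpace.single j (1:ℝ)‖ ^ 2) (2 * y j) 0 := by
  simp only [nsq_line]
  have h := ((((hasDerivAt_id (0:ℝ)).const_mul 2).mul_const (y j)).const_add (‖y‖ ^ 2)).add ((hasDerivAt_id (0:ℝ)).pow 2)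
  refine h.congr_deriv ?_
  simp

lemma G_d {c : ℝ} (hc : 0 < c) (y : V2) (j : Fin 2) :
    HasLineDerivAt ℝ (fun y : V2 => Real.log (1 + c * ‖y‖ ^ 2)) (2 * c * y j / (1 + c * ‖y‖ ^ 2)) y (EuclideanSpace.single j 1) := by
  have h := (((nsq_d y j).const_mul c).const_add 1).log (by positivity)
  refine h.congr_deriv ?_
  simp; ring

lemma G_dd {c : ℝ} (hc : 0 < c) (y : V2) (j : Fin 2) :
    HasLineDerivAt ℝ (fun y : V2 => 2 * c * y j / (1 + c * ‖y‖ ^ 2))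
      (2 * c / (1 + c * ‖y‖ ^ 2) - 4 * c ^ 2 * y j ^ 2 / (1 + c * ‖y‖ ^ 2) ^ 2) y (EuclideanSpace.single j 1) := by
  have h0 : HasDerivAt (fun τ : ℝ => 2 * c * (y + τ • EuclideanSpace.single j (1:ℝ)) j) (2 * c) 0 := by
    have h := ((hasDerivAt_id (0:ℝ)).const_add (y j)).const_mul (2 * c)
    simpa using h
  have h := h0.div (((nsq_d y j).const_mul c).const_add 1) (by positivity)
  refine h.congr_deriv ?_
  have : 1 + c * ‖y‖ ^ 2 ≠ 0 := by positivity
  simp; field_simp; ring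

lemma coord_le (y : V2) (j : Fin 2) : |y j| ≤ ‖y‖ := by
  simpa using PiLp.norm_apply_le y j

lemma G_b {c : ℝ} (hc : 0 < c) (y : V2) : |Real.log (1 + c * ‖y‖ ^ 2)| ≤ 6 * c * (1 + ‖y‖) ^ 2 := by
  rw [abs_of_nonneg (Real.log_nonneg (by nlinarith [sq_nonneg ‖y‖]))]
  have := Real.log_le_sub_one_of_pos (x := 1 + c * ‖y‖ ^ 2) (by positivity)
  have h := norm_nonneg y
  nlinarith [mul_nonneg hc.le h, mul_nonneg hc.le (sq_nonneg ‖y‖)]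

lemma Gd_b' {c : ℝ} (hc : 0 < c) (y : V2) (j : Fin 2) : |2 * c * y j / (1 + c * ‖y‖ ^ 2)| * ‖y‖ ≤ 2 := by
  rw [abs_div, abs_of_pos (a := 1 + c * ‖y‖ ^ 2) (by positivity), abs_mul, abs_of_pos (a := 2 * c) (by positivity), div_mul_eq_mul_div, div_le_iff₀ (by positivity)]
  have h := norm_nonneg y
  have := mul_le_mul_of_nonneg_right (coord_le y j) h
  nlinarith

lemma Gd_b {c : ℝ} (hc : 0 < c) (y : V2) (j : Fin 2) : |2 * c * y j / (1 + c * ‖y‖ ^ 2)| ≤ 6 * c * (1 + ‖y‖) ^ 2 := by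
  rw [abs_div, abs_of_pos (a := 1 + c * ‖y‖ ^ 2) (by positivity), abs_mul, abs_of_pos (a := 2 * c) (by positivity)]
  have h := norm_nonneg y
  refine (div_le_self (by positivity) (by nlinarith [sq_nonneg ‖y‖])).trans ?_
  nlinarith [coord_le y j, mul_nonneg hc.le h, mul_nonneg hc.le (sq_nonneg ‖y‖)]

lemma Gdd_b {c : ℝ} (hc : 0 < c) (y : V2) (j : Fin 2) :
    |2 * c / (1 + c * ‖y‖ ^ 2) - 4 * c ^ 2 * y j ^ 2 / (1 + c * ‖y‖ ^ 2) ^ 2| ≤ 6 * c * (1 + ‖y‖) ^ 2 := by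
  have h := norm_nonneg y
  have hD : 1 ≤ 1 + c * ‖y‖ ^ 2 := by nlinarith [sq_nonneg ‖y‖]
  have h1 : 2 * c / (1 + c * ‖y‖ ^ 2) ≤ 2 * c := div_le_self (by positivity) hD
  have h1' : 0 ≤ 2 * c / (1 + c * ‖y‖ ^ 2) := by positivity
  have h2' : 0 ≤ 4 * c ^ 2 * y j ^ 2 / (1 + c * ‖y‖ ^ 2) ^ 2 := by positivity
  have h2 : 4 * c ^ 2 * y j ^ 2 / (1 + c * ‖y‖ ^ 2) ^ 2 ≤ 4 * c := by
    rw [div_le_iff₀ (by positivity)]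
    have h3 : y j ^ 2 ≤ ‖y‖ ^ 2 := by rw [← sq_abs]; gcongr; exact coord_le y j
    have h4 : c * y j ^ 2 ≤ (1 + c * ‖y‖ ^ 2) ^ 2 := by nlinarith
    nlinarith
  have h5 : 6 * c ≤ 6 * c * (1 + ‖y‖) ^ 2 := by nlinarith [mul_nonneg hc.le h, mul_nonneg hc.le (sq_nonneg ‖y‖)]
  rw [abs_le]; constructor <;> linarith

lemma nsq2 (y : V2) : ‖y‖ ^ 2 = y 0 ^ 2 + y 1 ^ 2 := by
  rw [EuclideanSpace.norm_sq_eq]; simp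

lemma lap_id {c : ℝ} (hc : 0 < c) (a F0 F1 : SM)
    (h : ∀ p, pdS 0 (pdS 0 a) p + pdS 1 (pdS 1 a) p = pdS 0 F0 p + pdS 1 F1 p) (t : ℝ) (x : V2) :
    ∫ y : V2, (4 * c / (1 + c * ‖y‖ ^ 2) ^ 2) • a (t, x + y) =
      - ((∫ y : V2, (2 * c * y 0 / (1 + c * ‖y‖ ^ 2)) • F0 (t, x + y)) +
        ∫ y : V2, (2 * c * y 1 / (1 + c * ‖y‖ ^ 2)) • F1 (t, x + y)) := by
  have hne : ∀ y : V2, 1 + c * ‖y‖ ^ 2 ≠ 0 := fun y => by positivity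
  have cG : Continuous fun y : V2 => Real.log (1 + c * ‖y‖ ^ 2) := by
    exact Continuous.log (by fun_prop) hne
  have cD : ∀ j : Fin 2, Continuous fun y : V2 => 2 * c * y j / (1 + c * ‖y‖ ^ 2) := fun j =>
    Continuous.div (by fun_prop) (by fun_prop) hne
  have cH : ∀ j : Fin 2, Continuous fun y : V2 => 2 * c / (1 + c * ‖y‖ ^ 2) - 4 * c ^ 2 * y j ^ 2 / (1 + c * ‖y‖ ^ 2) ^ 2 := fun j =>
    (Continuous.div (by fun_prop) (by fun_prop) hne).sub (Continuous.div (by fun_prop) (by fun_prop) fun y => pow_ne_zero _ (hne y))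
  have i1 : ∀ (u : SM) j, ∫ y : V2, Real.log (1 + c * ‖y‖ ^ 2) • pdS j u (t, x + y) = - ∫ y : V2, (2 * c * y j / (1 + c * ‖y‖ ^ 2)) • u (t, x + y) :=
    fun u j => ibp u t x j cG (cD j) (G_b hc) (fun y => Gd_b hc y j) (fun y => G_d hc y j)
  have i2 : ∀ (u : SM) j, ∫ y : V2, (2 * c * y j / (1 + c * ‖y‖ ^ 2)) • pdS j u (t, x + y) = - ∫ y : V2, (2 * c / (1 + c * ‖y‖ ^ 2) - 4 * c ^ 2 * y j ^ 2 / (1 + c * ‖y‖ ^ 2) ^ 2) • u (t, x + y) :=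
    fun u j => ibp u t x j (cD j) (cH j) (fun y => Gd_b hc y j) (fun y => Gdd_b hc y j) (fun y => G_dd hc y j)
  have ig : ∀ (u : SM), Integrable fun y => Real.log (1 + c * ‖y‖ ^ 2) • u (t, x + y) :=
    fun u => int_gam u t x cG (G_b hc)
  have ih : ∀ j, Integrable fun y : V2 => (2 * c / (1 + c * ‖y‖ ^ 2) - 4 * c ^ 2 * y j ^ 2 / (1 + c * ‖y‖ ^ 2) ^ 2) • a (t, x + y) :=
    fun j => int_gam a t x (cH j) (fun y => Gdd_b hc y j)
  calc _ = (∫ y : V2, (2 * c / (1 + c * ‖y‖ ^ 2) - 4 * c ^ 2 * y 0 ^ 2 / (1 + c * ‖y‖ ^ 2) ^ 2) • a (t, x + y)) +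
        ∫ y : V2, (2 * c / (1 + c * ‖y‖ ^ 2) - 4 * c ^ 2 * y 1 ^ 2 / (1 + c * ‖y‖ ^ 2) ^ 2) • a (t, x + y) := by
          rw [← integral_add (ih 0) (ih 1)]
          congr 1; ext y
          rw [← add_smul]
          congr 1
          have e := nsq2 y
          have e2 : 2 * c / (1 + c * ‖y‖ ^ 2) - 4 * c ^ 2 * y 0 ^ 2 / (1 + c * ‖y‖ ^ 2) ^ 2 + (2 * c / (1 + c * ‖y‖ ^ 2) - 4 * c ^ 2 * y 1 ^ 2 / (1 + c * ‖y‖ ^ 2) ^ 2) = (4 * c * (1 + c * ‖y‖ ^ 2) - 4 * c ^ 2 * (y 0 ^ 2 + y 1 ^ 2)) / (1 + c * ‖y‖ ^ 2) ^ 2 := by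
            field_simp [hne y]; ring
          rw [e2, ← e]; congr 1; ring
    _ = (∫ y : V2, Real.log (1 + c * ‖y‖ ^ 2) • pdS 0 (pdS 0 a) (t, x + y)) + ∫ y : V2, Real.log (1 + c * ‖y‖ ^ 2) • pdS 1 (pdS 1 a) (t, x + y) := by
          rw [i1, i1, i2, i2, neg_neg, neg_neg]
    _ = (∫ y : V2, Real.log (1 + c * ‖y‖ ^ 2) • pdS 0 F0 (t, x + y)) + ∫ y : V2, Real.log (1 + c * ‖y‖ ^ 2) • pdS 1 F1 (t, x + y) := by
          rw [← integral_add (ig _) (ig _), ← integral_add (ig _) (ig _)]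
          simp only [← smul_add, h]
    _ = _ := by rw [i1, i1]; ring

/-- The unnormalised profile. -/
def prof (z : V2) : ℝ := 4 / (1 + ‖z‖ ^ 2) ^ 2

lemma prof_int : Integrable prof := by
  have h := (integrable_rpow_neg_one_add_norm_sq (E := V2) (μ := volume) (r := 4) (by simp; norm_num)).const_mul 4
  refine h.congr (.of_forall fun z => ?_)
  have : (1 + ‖z‖ ^ 2) ^ (-4 / 2 : ℝ) = ((1 + ‖z‖ ^ 2) ^ 2)⁻¹ := by
    rw [show (-4 / 2 : ℝ) = - (2:ℕ) by norm_num, Real.rpow_neg (by positivity), Real.rpow_natCast]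
  show 4 * (1 + ‖z‖ ^ 2) ^ (-4 / 2 : ℝ) = prof z
  rw [this, prof, div_eq_mul_inv]

lemma prof_pos : 0 < ∫ z, prof z := by
  rw [integral_pos_iff_support_of_nonneg (fun z => by unfold prof; positivity) prof_int]
  have : Function.support prof = Set.univ := by
    ext z; simp only [Function.mem_support, Set.mem_univ, iff_true]; unfold prof; positivity
  rw [this]; simp

lemma prof_lim : Filter.Tendsto (fun x : V2 ↦ ‖x‖ ^ 2 * prof x) (Bornology.cobounded V2) (nhds 0) := by
  have h1 : Filter.Tendsto (fun x : V2 => 4 / ‖x‖) (Bornology.cobounded V2) (nhds 0) :=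
    tendsto_norm_cobounded_atTop.const_div_atTop 4
  refine tendsto_of_tendsto_of_tendsto_of_le_of_le' tendsto_const_nhds h1 (.of_forall fun x => by unfold prof; positivity) ?_
  filter_upwards [tendsto_norm_cobounded_atTop.eventually_ge_atTop 1] with x hx
  unfold prof
  rw [mul_div_assoc', div_le_div_iff₀ (by positivity) (by positivity)]
  have : 0 < ‖x‖ := by linarith
  have h3 : ‖x‖ ≤ ‖x‖ ^ 2 := by nlinarith
  nlinarith [sq_nonneg (‖x‖^2), mul_nonneg (sq_nonneg ‖x‖) (sub_nonneg.2 h3)]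

lemma prof_tend (a : SM) (t : ℝ) (x : V2) :
    Filter.Tendsto (fun c : ℝ => ∫ y : V2, (4 * c ^ 2 / (1 + c ^ 2 * ‖y‖ ^ 2) ^ 2) • a (t, x + y)) Filter.atTop
      (nhds ((∫ z, prof z) • a (t, x))) := by
  set c0 := ∫ z, prof z with hc0
  have hp := prof_pos
  have h_1 : ∀ z, 0 ≤ c0⁻¹ * prof z := fun z => by
    have h0 : 0 ≤ prof z := by unfold prof; positivity
    exact mul_nonneg (inv_nonneg.2 hp.le) h0
  have h_2 : ∫ z, c0⁻¹ * prof z = 1 := by rw [integral_const_mul, ← hc0]; exact inv_mul_cancel₀ hp.ne'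
  have h_3 : Filter.Tendsto (fun x : V2 ↦ ‖x‖ ^ (Module.finrank ℝ V2) * (c0⁻¹ * prof x)) (Bornology.cobounded V2) (nhds 0) := by
    have := prof_lim.const_mul c0⁻¹
    rw [mul_zero] at this
    refine this.congr fun x => ?_
    rw [finrank_euclideanSpace, Fintype.card_fin]; ring
  have h_4 : Integrable fun y => a (t, x + y) := by
    have := int_gam a t x (Γ := fun _ => 1) continuous_const (K := 1) (fun y => by rw [abs_one]; nlinarith [norm_nonneg y])
    simpa only [one_smul] using this
  have h_5 : ContinuousAt (fun y => a (t, x + y)) 0 := by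
    have : Continuous fun y => a (t, x + y) := a.continuous.comp (by fun_prop)
    exact this.continuousAt
  have h := tendsto_integral_comp_smul_smul_of_integrable (μ := (volume : Measure V2)) (φ := fun z => c0⁻¹ * prof z)
    h_1 h_2 h_3 (g := fun y => a (t, x + y)) h_4 h_5
  have h2 := h.const_smul c0
  simp only [add_zero] at h2
  refine h2.congr fun c => ?_
  rw [← integral_smul]
  congr 1; ext y
  rw [smul_smul]; congr 1
  simp only [finrank_euclideanSpace, Fintype.card_fin, prof, norm_smul, mul_pow, Real.norm_eq_abs, sq_abs]
  have hc0' : c0 ≠ 0 := hp.ne'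
  field_simp

lemma repr_est : ∃ C : EN, C ≠ ⊤ ∧ ∀ a F0 F1 : SM,
    (∀ p, pdS 0 (pdS 0 a) p + pdS 1 (pdS 1 a) p = pdS 0 F0 p + pdS 1 F1 p) → ∀ t x,
    ‖a (t, x)‖ₑ ≤ C * ∫⁻ y, ‖x - y‖ₑ⁻¹ * (‖F0 (t, y)‖ₑ + ‖F1 (t, y)‖ₑ) := by
  have hp := prof_pos
  set c0 := ∫ z, prof z with hc0
  refine ⟨oR c0⁻¹ * 2, by finiteness, fun a F0 F1 h t x => ?_⟩
  set R := ∫⁻ y, ‖x - y‖ₑ⁻¹ * (‖F0 (t, y)‖ₑ + ‖F1 (t, y)‖ₑ) with hR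
  have hb : ∀ c : ℝ, 0 < c → ∀ (y : V2) j, ‖2 * c ^ 2 * y j / (1 + c ^ 2 * ‖y‖ ^ 2)‖ₑ ≤ 2 * ‖y‖ₑ⁻¹ := by
    intro c hc y j
    rw [← div_eq_mul_inv]
    refine ENNReal.le_div_iff_mul_le (by simp) (by simp) |>.2 ?_
    rw [← ofReal_norm, ← ofReal_norm, ← ENNReal.ofReal_mul (by positivity)]
    exact (ENNReal.ofReal_le_ofReal (Gd_b' (by positivity) y j)).trans (by simp)
  have h1 : ∀ c : ℝ, 0 < c → ‖∫ y : V2, (4 * c ^ 2 / (1 + c ^ 2 * ‖y‖ ^ 2) ^ 2) • a (t, x + y)‖ₑ ≤ 2 * R := by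
    intro c hc
    rw [lap_id (by positivity) a F0 F1 h t x, enorm_neg]
    have e : 2 * R = (∫⁻ y, 2 * ‖y‖ₑ⁻¹ * ‖F0 (t, x + y)‖ₑ) + ∫⁻ y, 2 * ‖y‖ₑ⁻¹ * ‖F1 (t, x + y)‖ₑ := by
      have hm : Measurable fun y : V2 => F0 (t, x + y) := (F0.continuous.comp (by fun_prop)).measurable
      have hm2 : Measurable fun y : V2 => 2 * ‖y‖ₑ⁻¹ * ‖F0 (t, x + y)‖ₑ := (measurable_enorm.inv.const_mul 2).mul hm.enorm
      rw [hR, ← lintegral_add_left_eq_self _ x, ← lintegral_add_left hm2, ← lintegral_const_mul' _ _ (by simp)]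
      congr 1; ext y
      simp; ring
    rw [e]
    refine (enorm_add_le _ _).trans (add_le_add ?_ ?_)
    all_goals
      refine (enorm_integral_le_lintegral_enorm _).trans (lintegral_mono fun y => ?_)
      rw [enorm_smul]
      exact mul_le_mul_left (hb c hc y _) _
  have h2 := (prof_tend a t x).enorm
  have h3 : ‖c0 • a (t, x)‖ₑ ≤ 2 * R := le_of_tendsto h2 (by
    filter_upwards [Filter.eventually_gt_atTop 0] with c hc using h1 c hc)
  rw [enorm_smul] at h3
  calc ‖a (t, x)‖ₑ = oR c0⁻¹ * (‖c0‖ₑ * ‖a (t, x)‖ₑ) := by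
        rw [← mul_assoc, Real.enorm_of_nonneg hp.le, ← ENNReal.ofReal_mul (by positivity), inv_mul_cancel₀ hp.ne']; simp
    _ ≤ oR c0⁻¹ * (2 * R) := mul_le_mul_right h3 _
    _ = _ := by ring

lemma ft_q {q : ℝ} (hq : 2 < q) : ∃ C : EN, C ≠ ⊤ ∧ ∀ (a W b : V2 → EN), Measurable a → Measurable W →
    Measurable b → (∀ y, a y ≠ ⊤) → (∀ y, W y ≠ ⊤) → ∫⁻ y, a y ^ q ≠ ⊤ → ∀ E C1 : EN, E ≠ ⊤ → C1 ≠ ⊤ →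
    ∫⁻ y, W y ^ (2:ℝ) ≤ E ^ (2:ℝ) →
    (∀ x, a x ≤ C1 * ((∫⁻ y, ‖x - y‖ₑ⁻¹ * (a y * W y)) + b x)) →
    (∫⁻ y, a y ^ q) ^ (1 / q) ≤ C1 * (C * E * (∫⁻ y, a y ^ q) ^ (1 / q) + (∫⁻ y, b y ^ q) ^ (1 / q)) := by
  have hq0 : 0 < q := by linarith
  have hq1 : 0 < q - 1 := by linarith
  set r2 := q / (q - 1) with hr2
  set r := (1 / q + 1 / 2)⁻¹ with hr
  have hr' : 1 / r = 1 / q + 1 / 2 := by rw [hr]; simp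
  have hqi : 1 / q < 1 / 2 := by apply one_div_lt_one_div_of_lt <;> linarith
  have hqp : 0 < 1 / q := by positivity
  have hrpos : 0 < r := by positivity
  have h1r : 1 < r := (one_lt_inv₀ (by positivity)).2 (by linarith)
  have h2r : r < 2 := by rw [hr]; apply inv_lt_of_inv_lt₀ (by norm_num); linarith
  have h1r2 : 1 < r2 := by rw [hr2, one_lt_div hq1]; linarith
  have h2r2 : r2 < 2 := by rw [hr2, div_lt_iff₀ hq1]; linarith
  have hr2' : 1 / r2 = 1 - 1 / q := by rw [hr2]; field_simp
  obtain ⟨C, hC, H⟩ := hls h1r h2r h1r2 h2r2 (by rw [hr', hr2']; ring)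
  refine ⟨C, hC, fun a W b ma mW mb fa fW fi E C1 hE hC1 hW hrep => ?_⟩
  set X := (∫⁻ y, a y ^ q) ^ (1 / q) with hX
  set B := (∫⁻ y, b y ^ q) ^ (1 / q) with hB
  have hXt : X ≠ ⊤ := ENNReal.rpow_ne_top_of_nonneg hqp.le fi
  rcases eq_or_ne X 0 with hX0 | hX0
  · rw [hX0]; exact zero_le
  have hXq : ∫⁻ y, a y ^ q = X ^ (q - 1) * X := by
    rw [hX, ← ENNReal.rpow_mul, ← ENNReal.rpow_add_of_nonneg _ _ (by positivity) hqp.le,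
      show 1 / q * (q - 1) + 1 / q = 1 by field_simp; ring, ENNReal.rpow_one]
  have hg : ∀ y, (a y ^ (q - 1)) ^ r2 = a y ^ q := fun y => by
    rw [← ENNReal.rpow_mul, hr2, mul_div_cancel₀ _ hq1.ne']
  have hgi : (∫⁻ y, (a y ^ (q - 1)) ^ r2) ^ (1 / r2) = X ^ (q - 1) := by
    simp only [hg]
    rw [hX, ← ENNReal.rpow_mul, hr2']; congr 1; field_simp
  have hFW : (∫⁻ y, (a y * W y) ^ r) ^ (1 / r) ≤ X * E := by
    have h := ENNReal.lintegral_Lp_mul_le_Lq_mul_Lr (p := r) (q := q) (r := 2) hrpos (by linarith) hr' volume ma.aemeasurable mW.aemeasurable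
    refine h.trans ?_
    refine mul_le_mul' le_rfl ?_
    refine (ENNReal.rpow_le_rpow hW (by norm_num)).trans ?_
    rw [← ENNReal.rpow_mul]; norm_num
  have hFi : ∫⁻ y, (a y * W y) ^ r ≠ ⊤ := by
    intro h
    rw [h, ENNReal.top_rpow_of_pos (by positivity)] at hFW
    exact ENNReal.mul_ne_top hXt hE (top_le_iff.1 hFW)
  have t1 := H (fun y => a y * W y) (fun y => a y ^ (q - 1)) (ma.mul mW) (ma.pow_const _)
    (fun y => ENNReal.mul_ne_top (fa y) (fW y)) (fun y => ENNReal.rpow_ne_top_of_nonneg hq1.le (fa y)) hFi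
    (by simp only [hg]; exact fi)
  rw [hgi] at t1
  have t2 : ∫⁻ y, a y ^ (q - 1) * b y ≤ X ^ (q - 1) * B := by
    have hc : r2.HolderConjugate q := by
      rw [Real.holderConjugate_iff]; refine ⟨h1r2, ?_⟩
      rw [← one_div, ← one_div, hr2']; ring
    have h := ENNReal.lintegral_mul_le_Lp_mul_Lq volume hc (ma.pow_const (q - 1)).aemeasurable mb.aemeasurable
    rw [hgi] at h
    exact h
  have hmm : Measurable fun x => a x ^ (q - 1) * b x := (ma.pow_const _).mul mb
  have key : X ^ (q - 1) * X ≤ X ^ (q - 1) * (C1 * (C * E * X + B)) := by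
    rw [← hXq]
    calc ∫⁻ y, a y ^ q = ∫⁻ y, a y ^ (q - 1) * a y := by
          congr 1; ext y
          conv_rhs => rw [← ENNReal.rpow_one (a y), ← ENNReal.rpow_mul, one_mul]
          rw [← ENNReal.rpow_add_of_nonneg _ _ hq1.le zero_le_one]; congr 1; ring
      _ ≤ ∫⁻ x, C1 * (a x ^ (q - 1) * (∫⁻ y, ‖x - y‖ₑ⁻¹ * (a y * W y)) + a x ^ (q - 1) * b x) := by
          refine lintegral_mono fun x => (mul_le_mul_right (hrep x) _).trans (le_of_eq (by ring))
      _ = C1 * ((∫⁻ x, a x ^ (q - 1) * (∫⁻ y, ‖x - y‖ₑ⁻¹ * (a y * W y))) + ∫⁻ x, a x ^ (q - 1) * b x) := by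
          rw [lintegral_const_mul' _ _ hC1, lintegral_add_right _ hmm]
      _ ≤ C1 * (C * X ^ (q - 1) * (X * E) + X ^ (q - 1) * B) := by
          refine mul_le_mul_right (add_le_add (t1.trans (mul_le_mul_right hFW _)) t2) _
      _ = _ := by ring
  have hp0 : X ^ (q - 1) ≠ 0 := by simp [hX0, hXt]
  have hpt : X ^ (q - 1) ≠ ⊤ := ENNReal.rpow_ne_top_of_nonneg hq1.le hXt
  exact (ENNReal.mul_le_mul_iff_right hp0 hpt).1 key

lemma kap_one (z : V2) : 1 ≤ kap z := le_self_add
lemma kap_half (z : V2) : ‖z‖ₑ ^ (-(1/2) : ℝ) ≤ kap z := le_add_self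

lemma ft_near : ∃ C : EN, C ≠ ⊤ ∧ ∀ (W : V2 → EN), Measurable W → ∀ (E : EN) (x : V2),
    ∫⁻ y, kap (x - y) * W y ^ 2 ≤ E ^ 2 →
    ∫⁻ y in Metric.ball x 1, ‖x - y‖ₑ⁻¹ * W y ≤ C * E := by
  refine ⟨(∫⁻ x in Metric.ball (0 : V2) 1, ‖x‖ₑ ^ (-(3/2):ℝ)) ^ (1/2:ℝ), ?_, fun W mW E x hE => ?_⟩
  · exact ENNReal.rpow_ne_top_of_nonneg (by norm_num) (near_fin (by norm_num))
  apply le_of_esq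
  rw [mul_pow, ehalf_sq]
  have h := lint_cs (volume.restrict (Metric.ball x 1)) (f := fun y => ‖x - y‖ₑ ^ (-(3/4):ℝ)) (g := fun y => ‖x - y‖ₑ ^ (-(1/4):ℝ) * W y)
    (by fun_prop) (by fun_prop)
  have e1 : ∀ y : V2, ‖x - y‖ₑ⁻¹ * W y ≤ ‖x - y‖ₑ ^ (-(3/4):ℝ) * (‖x - y‖ₑ ^ (-(1/4):ℝ) * W y) := fun y => by
    rw [← mul_assoc]
    refine mul_le_mul_left (le_of_eq ?_) _
    rw [← ENNReal.rpow_neg_one]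
    rcases eq_or_ne (x - y) 0 with h0 | h0
    · rw [h0]; simp [ENNReal.zero_rpow_of_neg]
    · rw [← ENNReal.rpow_add _ _ (by simpa using h0) (by simp)]; norm_num
  refine (pow_le_pow_left' (lintegral_mono e1) 2).trans (h.trans (mul_le_mul' (le_of_eq ?_) ?_))
  · rw [← lintegral_indicator measurableSet_ball, ← lintegral_indicator measurableSet_ball,
      ← lintegral_sub_left_eq_self ((Metric.ball (0 : V2) 1).indicator fun x => ‖x‖ₑ ^ (-(3/2):ℝ)) x]
    congr 1; ext y
    simp only [Set.indicator, Metric.mem_ball, dist_eq_norm, sub_zero, norm_sub_rev x y, ← ENNReal.rpow_natCast, ← ENNReal.rpow_mul, enorm_sub_rev x y]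
    norm_num
  · refine (setLIntegral_le_lintegral _ _).trans (le_trans (lintegral_mono fun y => ?_) hE)
    rw [mul_pow]
    refine mul_le_mul_left (le_trans (le_of_eq ?_) (kap_half (x - y))) _
    rw [← ENNReal.rpow_natCast, ← ENNReal.rpow_mul]; norm_num

lemma ft_far {q : ℝ} (hq : 2 < q) : ∃ C : EN, C ≠ ⊤ ∧ ∀ (a W : V2 → EN), Measurable a → Measurable W → ∀ (E : EN) (x : V2),
    ∫⁻ y, W y ^ 2 ≤ E ^ 2 →
    ∫⁻ y in (Metric.ball x 1)ᶜ, ‖x - y‖ₑ⁻¹ * (a y * W y) ≤ C * E * (∫⁻ y, a y ^ q) ^ (1 / q) := by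
  have hqi : 1 / q < 1 / 2 := by apply one_div_lt_one_div_of_lt <;> linarith
  have hqp : 0 < 1 / q := by positivity
  set m := (1 / 2 - 1 / q)⁻¹ with hm
  have hm' : 1 / m = 1 / 2 - 1 / q := by rw [hm]; simp
  have hm2 : 2 < m := by rw [hm]; apply lt_inv_of_lt_inv₀ (by linarith); linarith
  refine ⟨(∫⁻ x in (Metric.ball (0 : V2) 1)ᶜ, ‖x‖ₑ ^ (-m)) ^ (1/m), ?_, fun a W ma mW E x hE => ?_⟩
  · exact ENNReal.rpow_ne_top_of_nonneg (by positivity) (far_fin hm2)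
  set μ := volume.restrict (Metric.ball x 1)ᶜ
  have h := ENNReal.lintegral_mul_le_Lp_mul_Lq μ (p := 2) (q := 2) (by rw [Real.holderConjugate_iff]; norm_num)
    (f := W) (g := fun y => ‖x - y‖ₑ⁻¹ * a y) (by fun_prop) (by fun_prop)
  have h2 := ENNReal.lintegral_Lp_mul_le_Lq_mul_Lr (p := 2) (q := m) (r := q) (by norm_num) hm2 (by rw [hm']; ring) μ
    (f := fun y => ‖x - y‖ₑ⁻¹) (g := a) (by fun_prop) (by fun_prop)
  have h3 : (∫⁻ y, W y ^ (2:ℝ) ∂μ) ^ (1 / 2 : ℝ) ≤ E := by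
    have : ∫⁻ y, W y ^ (2:ℝ) ∂μ ≤ E ^ 2 := by
      refine (setLIntegral_le_lintegral _ _).trans (le_trans (le_of_eq ?_) hE)
      congr 1; ext y; norm_cast
    exact (ENNReal.rpow_le_rpow this (by norm_num)).trans (le_of_eq (esq_half E))
  have h4 : ∫⁻ y, ‖x - y‖ₑ⁻¹ ^ m ∂μ = ∫⁻ x in (Metric.ball (0 : V2) 1)ᶜ, ‖x‖ₑ ^ (-m) := by
    have ms : MeasurableSet (Metric.ball (0:V2) 1)ᶜ := measurableSet_ball.compl
    have ms' : MeasurableSet (Metric.ball (x:V2) 1)ᶜ := measurableSet_ball.compl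
    rw [← lintegral_indicator ms, ← lintegral_indicator ms',
      ← lintegral_sub_left_eq_self ((Metric.ball (0 : V2) 1)ᶜ.indicator fun x => ‖x‖ₑ ^ (-m)) x]
    congr 1; ext y
    simp only [Set.indicator, Set.mem_compl_iff, Metric.mem_ball, dist_eq_norm, sub_zero, norm_sub_rev x y, enorm_sub_rev x y, ENNReal.inv_rpow, ENNReal.rpow_neg]
  calc ∫⁻ y, ‖x - y‖ₑ⁻¹ * (a y * W y) ∂μ = ∫⁻ y, (W * fun y => ‖x - y‖ₑ⁻¹ * a y) y ∂μ := by
        congr 1; ext y; simp only [Pi.mul_apply]; ring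
    _ ≤ E * ((∫⁻ x in (Metric.ball (0 : V2) 1)ᶜ, ‖x‖ₑ ^ (-m)) ^ (1/m) * (∫⁻ y, a y ^ q) ^ (1 / q)) := by
        refine h.trans (mul_le_mul' h3 ?_)
        refine h2.trans ?_
        rw [h4]
        exact mul_le_mul_right (ENNReal.rpow_le_rpow (setLIntegral_le_lintegral _ _) hqp.le) _
    _ = _ := by ring

lemma absorb_half {X k B : EN} (hX : X ≠ ⊤) (hk : k ≤ 1 / 2) (h : X ≤ k * X + B) : X ≤ 2 * B := by
  have h1 : X ≤ X / 2 + B := h.trans (add_le_add_left (by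
    calc k * X ≤ 1 / 2 * X := mul_le_mul_left hk _
      _ = X / 2 := by rw [one_div, ENNReal.div_eq_inv_mul]) _)
  have h2 : X / 2 ≤ B := by
    have e : X / 2 + X / 2 ≤ X / 2 + B := by rwa [ENNReal.add_halves]
    exact (ENNReal.add_le_add_iff_left (ENNReal.div_ne_top hX (by norm_num))).1 e
  calc X = 2 * (X / 2) := (ENNReal.mul_div_cancel (by norm_num) (by norm_num)).symm
    _ ≤ _ := mul_le_mul_right h2 _

lemma fixed_time {q : ℝ} (hq : 2 < q) (C1 : EN) (hC1 : C1 ≠ ⊤) : ∃ C : EN, C ≠ ⊤ ∧ ∃ δ : EN, δ ≠ 0 ∧ δ ≠ ⊤ ∧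
    ∀ (a W b : V2 → EN), Measurable a → Measurable W →
    Measurable b → ∀ S : EN, S ≠ ⊤ → (∀ y, a y ≤ S) → (∀ y, W y ≠ ⊤) → ∫⁻ y, a y ^ q ≠ ⊤ →
    (∀ x, ∫⁻ y, kap (x - y) * W y ^ 2 ≤ δ ^ 2) →
    (∀ x, a x ≤ C1 * ((∫⁻ y, ‖x - y‖ₑ⁻¹ * (a y * W y)) + b x)) → ∀ N, (∀ x, b x ≤ N) →
    ∀ x, a x ≤ C * (N + (∫⁻ y, b y ^ q) ^ (1 / q)) := by
  obtain ⟨K1, hK1, H1⟩ := ft_q hq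
  obtain ⟨K2, hK2, H2⟩ := ft_near
  obtain ⟨K3, hK3, H3⟩ := ft_far hq
  set K := C1 * (K1 + K2) + 1 with hK
  have hKt : K ≠ ⊤ := by finiteness
  have hK0 : K ≠ 0 := by simp [hK]
  set δ : EN := (2 * K)⁻¹ with hδ
  have hδt : δ ≠ ⊤ := by simp [hδ, hK0]
  have hδ0 : δ ≠ 0 := by simp only [hδ, ne_eq, ENNReal.inv_eq_zero]; finiteness
  have hKδ : K * δ ≤ 1 / 2 := by
    rw [hδ, ENNReal.mul_inv (by simp) (by simp), mul_comm, mul_assoc, ENNReal.inv_mul_cancel hK0 hKt]; simp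
  refine ⟨2 * C1 * (K3 * δ * (2 * C1) + 1), by finiteness, δ, hδ0, hδt, fun a W b ma mW mb S hS haS fW fi hkap hrep N hN x => ?_⟩
  have hW2 : ∫⁻ y, W y ^ 2 ≤ δ ^ 2 := by
    refine le_trans (lintegral_mono fun y => ?_) (hkap 0)
    exact le_mul_of_one_le_left zero_le (kap_one _)
  set X := (∫⁻ y, a y ^ q) ^ (1 / q) with hX
  set B := (∫⁻ y, b y ^ q) ^ (1 / q) with hB
  have fa : ∀ y, a y ≠ ⊤ := fun y => ne_top_of_le_ne_top hS (haS y)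
  have hXB : X ≤ 2 * (C1 * B) := by
    refine absorb_half (k := C1 * K1 * δ) (ENNReal.rpow_ne_top_of_nonneg (by positivity) fi) ?_ ?_
    · refine le_trans (mul_le_mul_left ?_ _) hKδ
      rw [hK, mul_add, add_assoc]; exact le_self_add
    · have := H1 a W b ma mW mb fa fW fi δ C1 hδt hC1 (by exact_mod_cast hW2) hrep
      refine this.trans (le_of_eq (by ring))
  set S' := ⨆ y, a y with hS'
  have hS't : S' ≠ ⊤ := ne_top_of_le_ne_top hS (iSup_le haS)
  have hm : ∀ x, ∫⁻ y, ‖x - y‖ₑ⁻¹ * (a y * W y) ≤ K2 * δ * S' + K3 * δ * X := by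
    intro x
    rw [← lintegral_add_compl _ (measurableSet_ball (x := x) (ε := 1))]
    refine add_le_add ?_ (H3 a W ma mW δ x hW2)
    calc ∫⁻ y in Metric.ball x 1, ‖x - y‖ₑ⁻¹ * (a y * W y) ≤ ∫⁻ y in Metric.ball x 1, S' * (‖x - y‖ₑ⁻¹ * W y) := by
          refine lintegral_mono fun y => ?_
          calc ‖x - y‖ₑ⁻¹ * (a y * W y) ≤ ‖x - y‖ₑ⁻¹ * (S' * W y) := by gcongr; exact le_iSup a y
            _ = _ := by ring
      _ = S' * ∫⁻ y in Metric.ball x 1, ‖x - y‖ₑ⁻¹ * W y := lintegral_const_mul' _ _ hS't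
      _ ≤ S' * (K2 * δ) := mul_le_mul_right (H2 W mW δ x (hkap x)) _
      _ = _ := by ring
  have hSB : S' ≤ 2 * (C1 * (K3 * δ * X + N)) := by
    refine absorb_half (k := C1 * K2 * δ) hS't ?_ ?_
    · refine le_trans (mul_le_mul_left ?_ _) hKδ
      rw [hK, mul_add, add_right_comm]; exact le_add_self
    · refine iSup_le fun x => (hrep x).trans ((mul_le_mul_right (add_le_add (hm x) (hN x)) _).trans (le_of_eq (by ring)))
  calc a x ≤ S' := le_iSup a x
    _ ≤ 2 * (C1 * (K3 * δ * X + N)) := hSB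
    _ ≤ 2 * (C1 * (K3 * δ * (2 * (C1 * B)) + N)) := by gcongr
    _ = 2 * C1 * (K3 * δ * (2 * C1) * B + 1 * N) := by ring
    _ ≤ 2 * C1 * ((K3 * δ * (2 * C1) + 1) * B + (K3 * δ * (2 * C1) + 1) * N) := by
        gcongr
        · exact le_self_add
        · exact le_add_self
    _ = _ := by ring

lemma kB_fin : ∫⁻ z : V2, ‖z‖ₑ ^ (-(5/2):ℝ) * kap z ^ (-(3/2):ℝ) ≠ ⊤ := by
  rw [← lintegral_add_compl _ (measurableSet_ball (x := (0:V2)) (ε := 1))]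
  refine ENNReal.add_ne_top.2 ⟨ne_top_of_le_ne_top (near_fin (a := 7/4) (by norm_num)) (lintegral_mono fun z => ?_),
    ne_top_of_le_ne_top (far_fin (b := 5/2) (by norm_num)) (lintegral_mono fun z => ?_)⟩
  · rcases eq_or_ne z 0 with h0 | h0
    · rw [h0]; simp [ENNReal.zero_rpow_of_neg]
    · have := erpow_anti (a := -(3/2)) (by norm_num) (kap_half z)
      refine (mul_le_mul_right this _).trans (le_of_eq ?_)
      rw [← ENNReal.rpow_mul, ← ENNReal.rpow_add _ _ (by simpa using h0) (by simp)]; norm_num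
  · have := erpow_anti (a := -(3/2)) (by norm_num) (kap_one z)
    exact (mul_le_mul_right this _).trans (le_of_eq (by simp))

lemma kap_ne_top {z : V2} (h : z ≠ 0) : kap z ≠ ⊤ := by
  unfold kap
  have : ‖z‖ₑ ≠ 0 := by simpa using h
  have h2 : ‖z‖ₑ ^ (-(1/2):ℝ) ≠ ⊤ := by simp [this, h]
  finiteness

lemma ker_fac {z : V2} (h : z ≠ 0) (w : EN) : ‖z‖ₑ⁻¹ * w =
    (kap z * w) ^ (3/5:ℝ) * (‖z‖ₑ ^ (-(5/2):ℝ) * kap z ^ (-(3/2):ℝ) * w) ^ (2/5:ℝ) := by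
  have k0 : kap z ≠ 0 := (lt_of_lt_of_le one_pos (kap_one z)).ne'
  have kt := kap_ne_top h
  rw [ENNReal.mul_rpow_of_nonneg _ _ (by norm_num), ENNReal.mul_rpow_of_nonneg _ _ (by norm_num), ENNReal.mul_rpow_of_nonneg _ _ (by norm_num),
    ← ENNReal.rpow_mul, ← ENNReal.rpow_mul]
  have e1 : kap z ^ (3/5:ℝ) * kap z ^ (-(3/2) * (2/5) : ℝ) = 1 := by
    rw [← ENNReal.rpow_add _ _ k0 kt]; norm_num
  have e2 : w ^ (3/5:ℝ) * w ^ (2/5:ℝ) = w := by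
    rw [← ENNReal.rpow_add_of_nonneg _ _ (by norm_num) (by norm_num)]; norm_num
  have e3 : ‖z‖ₑ ^ (-(5/2) * (2/5) : ℝ) = ‖z‖ₑ⁻¹ := by rw [← ENNReal.rpow_neg_one]; norm_num
  calc _ = ‖z‖ₑ⁻¹ * (kap z ^ (3/5:ℝ) * kap z ^ (-(3/2) * (2/5) : ℝ)) * (w ^ (3/5:ℝ) * w ^ (2/5:ℝ)) := by rw [e1, e2, mul_one]
    _ = _ := by rw [e3]; ring

lemma lemB {s θ : ℝ} (hs : 1 / 4 < s) (hθ : 1 / 2 < θ) : ∃ C : EN, C ≠ ⊤ ∧ ∀ (u : SM) t,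
    ∫⁻ x, BB u t x ^ (5/2:ℝ) ≤ (C * HN s θ u ^ 2) ^ (5/2:ℝ) := by
  obtain ⟨C, hC, H⟩ := hardy hs hθ
  set K := ∫⁻ z : V2, ‖z‖ₑ ^ (-(5/2):ℝ) * kap z ^ (-(3/2):ℝ) with hK
  have hKt : K ≠ ⊤ := kB_fin
  refine ⟨C * K ^ (2/5:ℝ), ENNReal.mul_ne_top hC (ENNReal.rpow_ne_top_of_nonneg (by norm_num) hKt), fun u t => ?_⟩
  set h := C * HN s θ u ^ 2 with hh
  have mu : Measurable fun y : V2 => ‖u (t, y)‖ₑ := by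
    have : Continuous fun y : V2 => u (t, y) := u.continuous.comp (by fun_prop)
    exact this.measurable.enorm
  have mk := kap_meas
  set k : V2 → EN := fun z => ‖z‖ₑ ^ (-(5/2):ℝ) * kap z ^ (-(3/2):ℝ) with hk
  have mkk : Measurable k := by fun_prop
  have hL2 : ∫⁻ y, ‖u (t, y)‖ₑ ^ 2 ≤ h :=
    (lintegral_mono fun y => le_mul_of_one_le_left zero_le (kap_one _)).trans (H u t 0)
  have hB : ∀ x, BB u t x ^ (5/2:ℝ) ≤ h ^ (3/2:ℝ) * ∫⁻ y, k (x - y) * ‖u (t, y)‖ₑ ^ 2 := by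
    intro x
    have hm1 : Measurable fun y => kap (x - y) * ‖u (t, y)‖ₑ ^ 2 := by fun_prop
    have hm2 : Measurable fun y => k (x - y) * ‖u (t, y)‖ₑ ^ 2 := by fun_prop
    have hc : Real.HolderConjugate (5/3) (5/2) := by rw [Real.holderConjugate_iff]; norm_num
    have h1 := ENNReal.lintegral_mul_le_Lp_mul_Lq volume hc 
      (f := fun y => (kap (x - y) * ‖u (t, y)‖ₑ ^ 2) ^ (3/5:ℝ)) (g := fun y => (k (x - y) * ‖u (t, y)‖ₑ ^ 2) ^ (2/5:ℝ))
      (hm1.pow_const (3/5)).aemeasurable (hm2.pow_const (2/5)).aemeasurable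
    have p1 : ∀ w : EN, (w ^ (3/5:ℝ)) ^ (5/3:ℝ) = w := fun w => by rw [← ENNReal.rpow_mul]; norm_num
    have p2 : ∀ w : EN, (w ^ (2/5:ℝ)) ^ (5/2:ℝ) = w := fun w => by rw [← ENNReal.rpow_mul]; norm_num
    simp only [p1, p2] at h1
    rw [show (1 / (5/3) : ℝ) = 3/5 by norm_num, show (1 / (5/2) : ℝ) = 2/5 by norm_num] at h1
    have h2 : BB u t x ≤ h ^ (3/5:ℝ) * (∫⁻ y, k (x - y) * ‖u (t, y)‖ₑ ^ 2) ^ (2/5:ℝ) := by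
      refine le_trans (le_of_eq ?_) (h1.trans (mul_le_mul_left (ENNReal.rpow_le_rpow (H u t x) (by norm_num)) _))
      unfold BB
      refine lintegral_congr_ae ?_
      have : ∀ᵐ y : V2, y ≠ x := by simp [ae_iff, measure_singleton]
      filter_upwards [this] with y hy
      exact ker_fac (sub_ne_zero.2 hy.symm) _
    refine (ENNReal.rpow_le_rpow h2 (by norm_num)).trans (le_of_eq ?_)
    rw [ENNReal.mul_rpow_of_nonneg _ _ (by norm_num), ← ENNReal.rpow_mul, ← ENNReal.rpow_mul]
    norm_num
  have hT : ∫⁻ x, ∫⁻ y, k (x - y) * ‖u (t, y)‖ₑ ^ 2 ≤ K * h := by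
    rw [lintegral_lintegral_swap (by
      have : Measurable fun z : V2 × V2 => k (z.1 - z.2) * ‖u (t, z.2)‖ₑ ^ 2 :=
        (mkk.comp (measurable_fst.sub measurable_snd)).mul ((mu.comp measurable_snd).pow_const 2)
      exact this.aemeasurable)]
    have : ∀ y : V2, ∫⁻ x, k (x - y) * ‖u (t, y)‖ₑ ^ 2 = K * ‖u (t, y)‖ₑ ^ 2 := fun y => by
      rw [lintegral_mul_const' _ _ (by finiteness), lintegral_sub_right_eq_self k y]
    simp only [this]
    rw [lintegral_const_mul' _ _ hKt]
    exact mul_le_mul_right hL2 _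
  have hm3 : Measurable fun x => ∫⁻ y, k (x - y) * ‖u (t, y)‖ₑ ^ 2 :=
    Measurable.lintegral_prod_right' (f := fun z : V2 × V2 => k (z.1 - z.2) * ‖u (t, z.2)‖ₑ ^ 2)
      ((mkk.comp (measurable_fst.sub measurable_snd)).mul ((mu.comp measurable_snd).pow_const 2))
  calc ∫⁻ x, BB u t x ^ (5/2:ℝ) ≤ ∫⁻ x, h ^ (3/2:ℝ) * ∫⁻ y, k (x - y) * ‖u (t, y)‖ₑ ^ 2 := lintegral_mono hB
    _ = h ^ (3/2:ℝ) * ∫⁻ x, ∫⁻ y, k (x - y) * ‖u (t, y)‖ₑ ^ 2 := lintegral_const_mul _ hm3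
    _ ≤ h ^ (3/2:ℝ) * (K * h) := mul_le_mul_right hT _
    _ = (C * K ^ (2/5:ℝ) * HN s θ u ^ 2) ^ (5/2:ℝ) := by
        have e : C * K ^ (2/5:ℝ) * HN s θ u ^ 2 = h * K ^ (2/5:ℝ) := by rw [hh]; ring
        rw [e]
        clear_value h
        rw [ENNReal.mul_rpow_of_nonneg _ _ (by norm_num), ← ENNReal.rpow_mul]
        have e2 : h ^ (5/2:ℝ) = h ^ (3/2:ℝ) * h := by
          conv_rhs => rw [← ENNReal.rpow_one h, ← ENNReal.rpow_mul, one_mul]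
          rw [← ENNReal.rpow_add_of_nonneg _ _ (by norm_num) (by norm_num)]; norm_num
        rw [e2]; norm_num; ring

lemma sum_pow_int {α ι : Type*} [Fintype ι] [MeasurableSpace α] (μ : Measure α) (x : ι → α → EN) (hx : ∀ e, Measurable (x e))
    {P : ℝ} (hP : 1 ≤ P) (K : EN) (h : ∀ e, ∫⁻ a, x e a ^ P ∂μ ≤ K ^ P) :
    ∫⁻ a, (∑ e, x e a) ^ P ∂μ ≤ ((Fintype.card ι : EN) * K) ^ P := by
  calc ∫⁻ a, (∑ e, x e a) ^ P ∂μ ≤ ∫⁻ a, (Fintype.card ι : EN) ^ (P - 1) * ∑ e, x e a ^ P ∂μ :=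
        lintegral_mono fun a => ENNReal.rpow_sum_le_const_mul_sum_rpow Finset.univ (fun e => x e a) hP
    _ = (Fintype.card ι : EN) ^ (P - 1) * ∑ e, ∫⁻ a, x e a ^ P ∂μ := by
        rw [lintegral_const_mul' _ _ (ENNReal.rpow_ne_top_of_nonneg (by linarith) (by simp)), lintegral_finsetSum _ fun e _ => (hx e).pow_const _]
    _ ≤ (Fintype.card ι : EN) ^ (P - 1) * ∑ _e : ι, K ^ P := mul_le_mul_right (Finset.sum_le_sum fun e _ => h e) _
    _ = (Fintype.card ι : EN) ^ (P - 1) * ((Fintype.card ι : EN) ^ (1:ℝ) * K ^ P) := by simp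
    _ = _ := by
        rw [← mul_assoc, ← ENNReal.rpow_add_of_nonneg _ _ (by linarith) zero_le_one, ENNReal.mul_rpow_of_nonneg _ _ (by linarith)]
        simp

section fam
variable {ι : Type*} [Fintype ι]

/-- Sum of moduli of a family. -/
def US (u : ι → SM) (p : ℝ × V2) : EN := ∑ e, ‖u e p‖ₑ
/-- Sum of potentials. -/
def BS (u : ι → SM) (t : ℝ) (x : V2) : EN := ∑ e, BB (u e) t x
/-- Sum of suprema. -/
def NS (u : ι → SM) (t : ℝ) : EN := ∑ e, NN (u e) t
/-- Sum of norms. -/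
def HS (s θ : ℝ) (u : ι → SM) : EN := ∑ e, HN s θ (u e)

lemma HN_le_HS (s θ : ℝ) (u : ι → SM) (e : ι) : HN s θ (u e) ≤ HS s θ u :=
  Finset.single_le_sum (f := fun e => HN s θ (u e)) (fun _ _ => zero_le) (Finset.mem_univ e)

lemma smeas (u : SM) : Measurable ⇑u := u.continuous.measurable

lemma US_meas (u : ι → SM) : Measurable (US u) := by
  unfold US
  exact Finset.measurable_fun_sum _ fun e _ => (smeas (u e)).enorm

lemma BS_meas (u : ι → SM) (t : ℝ) : Measurable (BS u t) := by
  unfold BS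
  refine Finset.measurable_fun_sum _ fun e _ => ?_
  exact Measurable.comp (g := fun p : ℝ × V2 => BB (u e) p.1 p.2) (f := fun x => (t, x)) (BB_meas (smeas (u e))) measurable_prodMk_left

lemma NS_meas (u : ι → SM) : Measurable (NS u) := by
  unfold NS
  exact Finset.measurable_fun_sum _ fun e _ => NN_meas (smeas (u e))

lemma BS_le_NS (u : ι → SM) (t : ℝ) (x : V2) : BS u t x ≤ NS u t :=
  Finset.sum_le_sum fun e _ => BB_le_NN (smeas (u e)) t x

lemma US_sq (u : ι → SM) (p : ℝ × V2) : US u p ^ 2 ≤ (Fintype.card ι : EN) * ∑ e, ‖u e p‖ₑ ^ 2 := by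
  have := ENNReal.rpow_sum_le_const_mul_sum_rpow Finset.univ (fun e => ‖u e p‖ₑ) (p := 2) (by norm_num)
  norm_num at this
  exact this

lemma US_ker (u : ι → SM) (k : V2 → EN) (hk : Measurable k) (t : ℝ) (x : V2) :
    ∫⁻ y, k (x - y) * US u (t, y) ^ 2 ≤ (Fintype.card ι : EN) * ∑ e, ∫⁻ y, k (x - y) * ‖u e (t, y)‖ₑ ^ 2 := by
  have hm : ∀ e, Measurable fun y => k (x - y) * ‖u e (t, y)‖ₑ ^ 2 := fun e =>
    (hk.comp (measurable_const.sub measurable_id)).mul (((smeas (u e)).comp measurable_prodMk_left).enorm.pow_const 2)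
  rw [← lintegral_finsetSum _ fun e _ => hm e, ← lintegral_const_mul' _ _ (by simp)]
  refine lintegral_mono fun y => (mul_le_mul_right (US_sq u (t, y)) _).trans (le_of_eq ?_)
  rw [← Finset.mul_sum]; ring

lemma US_kap {s θ : ℝ} (hs : 1 / 4 < s) (hθ : 1 / 2 < θ) : ∃ C : EN, C ≠ ⊤ ∧ ∀ (u : ι → SM) t x,
    ∫⁻ y, kap (x - y) * US u (t, y) ^ 2 ≤ (C * HS s θ u) ^ 2 := by
  obtain ⟨C, hC, H⟩ := hardy hs hθ
  refine ⟨((Fintype.card ι : EN) * ((Fintype.card ι : EN) * C)) ^ (1/2:ℝ), ?_, fun u t x => ?_⟩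
  · exact ENNReal.rpow_ne_top_of_nonneg (by norm_num) (by finiteness)
  rw [mul_pow, ehalf_sq]
  refine (US_ker u kap kap_meas t x).trans ?_
  rw [mul_assoc]
  refine mul_le_mul_right ?_ _
  calc ∑ e, ∫⁻ y, kap (x - y) * ‖u e (t, y)‖ₑ ^ 2 ≤ ∑ _e : ι, C * HS s θ u ^ 2 :=
        Finset.sum_le_sum fun e _ => (H (u e) t x).trans (mul_le_mul_right (pow_le_pow_left' (HN_le_HS s θ u e) 2) _)
    _ = _ := by simp; ring

lemma BS_int {s θ : ℝ} (hs : 1 / 4 < s) (hθ : 1 / 2 < θ) : ∃ C : EN, C ≠ ⊤ ∧ ∀ (u : ι → SM) t,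
    ∫⁻ x, BS u t x ^ (5/2:ℝ) ≤ (C * HS s θ u ^ 2) ^ (5/2:ℝ) := by
  obtain ⟨C, hC, H⟩ := lemB hs hθ
  refine ⟨(Fintype.card ι : EN) * C, by finiteness, fun u t => ?_⟩
  rw [mul_assoc]
  refine sum_pow_int volume (fun e x => BB (u e) t x) (fun e => Measurable.comp (g := fun p : ℝ × V2 => BB (u e) p.1 p.2) (f := fun x => (t, x)) (BB_meas (smeas (u e))) measurable_prodMk_left) (by norm_num) _ fun e => (H (u e) t).trans ?_
  exact ENNReal.rpow_le_rpow (mul_le_mul_right (pow_le_pow_left' (HN_le_HS s θ u e) 2) _) (by norm_num)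

lemma NS_int {s θ P : ℝ} (hs : 1 / 4 < s) (hθ : 1 / 2 < θ) (hP : 2 < P) (hP2 : 1 - 2 * s < 1 / P) :
    ∃ C : EN, C ≠ ⊤ ∧ ∀ (u : ι → SM), ∫⁻ t, NS u t ^ P ≤ (C * HS s θ u ^ 2) ^ P := by
  obtain ⟨C, hC, H⟩ := lemA hs hθ hP hP2
  refine ⟨(Fintype.card ι : EN) * C, by finiteness, fun u => ?_⟩
  rw [mul_assoc]
  refine sum_pow_int volume (fun e t => NN (u e) t) (fun e => NN_meas (smeas (u e))) (by linarith) _ fun e => (H (u e)).trans ?_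
  exact ENNReal.rpow_le_rpow (mul_le_mul_right (pow_le_pow_left' (HN_le_HS s θ u e) 2) _) (by linarith)

lemma BS_q {s θ q : ℝ} (hs : 1 / 4 < s) (hθ : 1 / 2 < θ) (hq : 5 / 2 ≤ q) : ∃ C : EN, C ≠ ⊤ ∧ ∀ (u : ι → SM) t,
    ∫⁻ x, BS u t x ^ q ≤ NS u t ^ (q - 5 / 2) * (C * HS s θ u ^ 2) ^ (5/2:ℝ) := by
  obtain ⟨C, hC, H⟩ := BS_int (ι := ι) hs hθ
  refine ⟨C, hC, fun u t => ?_⟩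
  calc ∫⁻ x, BS u t x ^ q ≤ ∫⁻ x, NS u t ^ (q - 5/2) * BS u t x ^ (5/2:ℝ) := by
        refine lintegral_mono fun x => ?_
        calc BS u t x ^ q = BS u t x ^ (q - 5/2) * BS u t x ^ (5/2:ℝ) := by
              rw [← ENNReal.rpow_add_of_nonneg _ _ (by linarith) (by norm_num)]; congr 1; ring
          _ ≤ _ := mul_le_mul_left (ENNReal.rpow_le_rpow (BS_le_NS u t x) (by linarith)) _
    _ = NS u t ^ (q - 5/2) * ∫⁻ x, BS u t x ^ (5/2:ℝ) := lintegral_const_mul _ ((BS_meas u t).pow_const _)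
    _ ≤ _ := mul_le_mul_right (H u t) _

end fam

section fam2
variable {ι κ : Type*} [Fintype ι] [Fintype κ]

/-- Mixed potential of two families. -/
def bf (u : ι → SM) (v : κ → SM) (t : ℝ) (x : V2) : EN :=
  ∫⁻ y, ‖x - y‖ₑ⁻¹ * (US u (t, y) * US v (t, y))

lemma USt_meas (u : ι → SM) (t : ℝ) : Measurable fun y => US u (t, y) :=
  (US_meas u).comp measurable_prodMk_left

lemma kinv_meas : Measurable fun z : V2 => ‖z‖ₑ⁻¹ := measurable_id.enorm.inv

lemma bf_meas (u : ι → SM) (v : κ → SM) (t : ℝ) : Measurable (bf u v t) := by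
  unfold bf
  exact Measurable.lintegral_prod_right' (f := fun z : V2 × V2 => ‖z.1 - z.2‖ₑ⁻¹ * (US u (t, z.2) * US v (t, z.2)))
    ((kinv_meas.comp (measurable_fst.sub measurable_snd)).mul
      (((USt_meas u t).comp measurable_snd).mul ((USt_meas v t).comp measurable_snd)))

lemma bf_sq (u : ι → SM) (v : κ → SM) (t : ℝ) (x : V2) :
    bf u v t x ^ 2 ≤ ((Fintype.card ι : EN) * BS u t x) * ((Fintype.card κ : EN) * BS v t x) := by
  have mk : Measurable fun y : V2 => (‖x - y‖ₑ⁻¹) ^ (1/2:ℝ) :=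
    (kinv_meas.comp (measurable_const.sub measurable_id)).pow_const _
  have m1 : Measurable fun y : V2 => (‖x - y‖ₑ⁻¹) ^ (1/2:ℝ) * US u (t, y) := mk.mul (USt_meas u t)
  have m2 : Measurable fun y : V2 => (‖x - y‖ₑ⁻¹) ^ (1/2:ℝ) * US v (t, y) := mk.mul (USt_meas v t)
  have h := lint_cs volume (f := fun y : V2 => (‖x - y‖ₑ⁻¹) ^ (1/2:ℝ) * US u (t, y))
    (g := fun y : V2 => (‖x - y‖ₑ⁻¹) ^ (1/2:ℝ) * US v (t, y)) m1.aemeasurable m2.aemeasurable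
  have e1 : bf u v t x = ∫⁻ y : V2, ((‖x - y‖ₑ⁻¹) ^ (1/2:ℝ) * US u (t, y)) * ((‖x - y‖ₑ⁻¹) ^ (1/2:ℝ) * US v (t, y)) := by
    unfold bf
    refine lintegral_congr fun y => ?_
    conv_lhs => rw [← ehalf_sq (‖x - y‖ₑ⁻¹)]
    ring
  rw [e1]
  refine h.trans (mul_le_mul' ?_ ?_)
  · simp only [mul_pow, ehalf_sq]
    exact US_ker u (fun z => ‖z‖ₑ⁻¹) kinv_meas t x
  · simp only [mul_pow, ehalf_sq]
    exact US_ker v (fun z => ‖z‖ₑ⁻¹) kinv_meas t x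

lemma bf_sup (u : ι → SM) (v : κ → SM) (t : ℝ) (x : V2) :
    bf u v t x ≤ ((Fintype.card ι : EN) * Fintype.card κ) ^ (1/2:ℝ) * (NS u t * NS v t) ^ (1/2:ℝ) := by
  rw [← ENNReal.mul_rpow_of_nonneg _ _ (by norm_num), ← esq_half (bf u v t x)]
  refine ENNReal.rpow_le_rpow ((bf_sq u v t x).trans ?_) (by norm_num)
  calc _ ≤ ((Fintype.card ι : EN) * NS u t) * ((Fintype.card κ : EN) * NS v t) := by
        gcongr <;> exact BS_le_NS _ _ _
    _ = _ := by ring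

lemma prod_int {α : Type*} [MeasurableSpace α] (μ : Measure α) {F G : α → EN} (hF : Measurable F) (hG : Measurable G)
    (P : ℝ) (hP : 0 ≤ P) : ∫⁻ a, (F a * G a) ^ (P / 2) ∂μ ≤ ((∫⁻ a, F a ^ P ∂μ) * ∫⁻ a, G a ^ P ∂μ) ^ (1/2:ℝ) := by
  have h := lint_cs μ (f := fun a => F a ^ (P/2)) (g := fun a => G a ^ (P/2)) (hF.pow_const _).aemeasurable (hG.pow_const _).aemeasurable
  have e : ∀ w : EN, (w ^ (P/2)) ^ 2 = w ^ P := fun w => by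
    rw [← ENNReal.rpow_natCast, ← ENNReal.rpow_mul]; congr 1; push_cast; ring
  simp only [e] at h
  rw [← esq_half (∫⁻ a, (F a * G a) ^ (P / 2) ∂μ)]
  refine ENNReal.rpow_le_rpow (le_trans (le_of_eq ?_) h) (by norm_num)
  congr 1
  exact lintegral_congr fun a => ENNReal.mul_rpow_of_nonneg _ _ (by linarith)

lemma alg_q {q : ℝ} (hq : 5 / 2 ≤ q) (c N1 N2 C1 C2 H1 H2 : EN) :
    (c ^ (q/2) * ((N1 ^ (q - 5/2) * (C1 * H1 ^ 2) ^ (5/2:ℝ)) * (N2 ^ (q - 5/2) * (C2 * H2 ^ 2) ^ (5/2:ℝ))) ^ (1/2:ℝ)) ^ (1/q) =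
      (c ^ (1/2:ℝ) * (C1 * C2) ^ (5/(4*q))) * ((N1 * N2) ^ ((1 - (5/2)/q)/2) * (H1 * H2) ^ ((5/2)/q)) := by
  have q0 : 0 < q := by linarith
  have e0 : (N1 ^ (q - 5/2) * (C1 * H1 ^ 2) ^ (5/2:ℝ)) * (N2 ^ (q - 5/2) * (C2 * H2 ^ 2) ^ (5/2:ℝ)) =
      (N1 * N2) ^ (q - 5/2) * ((C1 * C2) ^ (5/2:ℝ) * ((H1 * H2) ^ (2:ℝ)) ^ (5/2:ℝ)) := by
    rw [ENNReal.mul_rpow_of_nonneg N1 N2 (by linarith), ← ENNReal.mul_rpow_of_nonneg (C1 * C2) _ (by norm_num)]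
    have : C1 * C2 * (H1 * H2) ^ (2:ℝ) = (C1 * H1 ^ 2) * (C2 * H2 ^ 2) := by
      rw [ENNReal.rpow_two]; ring
    rw [this, ENNReal.mul_rpow_of_nonneg (C1 * H1 ^ 2) _ (by norm_num)]; ring
  rw [e0, ENNReal.mul_rpow_of_nonneg (c ^ (q/2)) _ (by positivity), ENNReal.mul_rpow_of_nonneg ((N1 * N2) ^ (q - 5/2)) _ (by norm_num),
    ENNReal.mul_rpow_of_nonneg ((C1 * C2) ^ (5/2:ℝ)) _ (by norm_num), ENNReal.mul_rpow_of_nonneg (((N1 * N2) ^ (q - 5/2)) ^ (1/2:ℝ)) _ (by positivity),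
    ENNReal.mul_rpow_of_nonneg (((C1 * C2) ^ (5/2:ℝ)) ^ (1/2:ℝ)) _ (by positivity)]
  simp only [← ENNReal.rpow_mul]
  rw [show q / 2 * (1 / q) = 1/2 by field_simp, show (q - 5/2) * (1/2) * (1/q) = (1 - (5/2)/q)/2 by field_simp,
    show (5/2 * (1/2) * (1/q):ℝ) = 5/(4*q) by field_simp; norm_num, show (2 * (5/2) * (1/2) * (1/q) : ℝ) = (5/2)/q by field_simp]
  ring

lemma bf_q {s θ q : ℝ} (hs : 1 / 4 < s) (hθ : 1 / 2 < θ) (hq : 5 / 2 ≤ q) : ∃ C : EN, C ≠ ⊤ ∧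
    ∀ (u : ι → SM) (v : κ → SM) t,
    (∫⁻ x, bf u v t x ^ q) ^ (1/q) ≤ C * ((NS u t * NS v t) ^ ((1 - (5/2)/q)/2) * (HS s θ u * HS s θ v) ^ ((5/2)/q)) := by
  obtain ⟨C1, hC1, H1⟩ := BS_q (ι := ι) hs hθ hq
  obtain ⟨C2, hC2, H2⟩ := BS_q (ι := κ) hs hθ hq
  have q0 : 0 < q := by linarith
  set c : EN := (Fintype.card ι : EN) * Fintype.card κ with hc
  have hct : c ≠ ⊤ := by rw [hc]; finiteness
  refine ⟨c ^ (1/2:ℝ) * (C1 * C2) ^ (5/(4*q)), ENNReal.mul_ne_top (ENNReal.rpow_ne_top_of_nonneg (by norm_num) hct)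
    (ENNReal.rpow_ne_top_of_nonneg (by positivity) (by finiteness)), fun u v t => ?_⟩
  rw [← alg_q hq]
  refine ENNReal.rpow_le_rpow ?_ (by positivity)
  have hb : ∀ x, bf u v t x ^ q ≤ c ^ (q/2) * (BS u t x * BS v t x) ^ (q/2) := fun x => by
    rw [← ENNReal.mul_rpow_of_nonneg _ _ (by positivity)]
    have : bf u v t x ^ q = (bf u v t x ^ 2) ^ (q/2) := by
      rw [← ENNReal.rpow_natCast, ← ENNReal.rpow_mul]; congr 1; push_cast; ring
    rw [this]
    refine ENNReal.rpow_le_rpow ((bf_sq u v t x).trans (le_of_eq ?_)) (by positivity)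
    rw [hc]; ring
  refine (lintegral_mono hb).trans ?_
  rw [lintegral_const_mul' _ _ (ENNReal.rpow_ne_top_of_nonneg (by positivity) hct)]
  refine mul_le_mul_right ((prod_int volume (BS_meas u t) (BS_meas v t) q q0.le).trans ?_) _
  exact ENNReal.rpow_le_rpow (mul_le_mul' (H1 u t) (H2 v t)) (by norm_num)

lemma NS_prod {s θ P : ℝ} (hs : 1 / 4 < s) (hθ : 1 / 2 < θ) (hP : 2 < P) (hP2 : 1 - 2 * s < 1 / P) :
    ∃ C : EN, C ≠ ⊤ ∧ ∀ (u : ι → SM) (v : κ → SM),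
      ∫⁻ t, (NS u t * NS v t) ^ (P/2) ≤ (C * (HS s θ u * HS s θ v)) ^ P := by
  obtain ⟨C1, hC1, H1⟩ := NS_int (ι := ι) hs hθ hP hP2
  obtain ⟨C2, hC2, H2⟩ := NS_int (ι := κ) hs hθ hP hP2
  refine ⟨(C1 * C2) ^ (1/2:ℝ), ENNReal.rpow_ne_top_of_nonneg (by norm_num) (by finiteness), fun u v => ?_⟩
  refine (prod_int volume (NS_meas u) (NS_meas v) P (by linarith)).trans ?_
  refine (ENNReal.rpow_le_rpow (mul_le_mul' (H1 u) (H2 v)) (by norm_num)).trans (le_of_eq ?_)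
  rw [← ENNReal.mul_rpow_of_nonneg _ _ (by linarith), ← ENNReal.rpow_mul, mul_comm P, ENNReal.rpow_mul]
  congr 1
  rw [show C1 * HS s θ u ^ 2 * (C2 * HS s θ v ^ 2) = (C1 * C2) * (HS s θ u * HS s θ v) ^ 2 by ring,
    ENNReal.mul_rpow_of_nonneg _ _ (by norm_num), esq_half]

/-- Time integration of the fixed-time bound. -/
lemma time_int {s θ p q : ℝ} (hs : 1 / 4 < s) (hθ : 1 / 2 < θ) (hp : 2 < p) (hp2 : 1 - 2 * s < 1 / p) (hq : 5 / 2 ≤ q)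
    (hpq : 2 < p * (1 - (5/2)/q)) : ∃ C : EN, C ≠ ⊤ ∧ ∀ (u : ι → SM) (v : κ → SM),
      (∫⁻ t, ((NS u t * NS v t) ^ (1/2:ℝ) + (NS u t * NS v t) ^ ((1 - (5/2)/q)/2) * (HS s θ u * HS s θ v) ^ ((5/2)/q)) ^ p) ≤
        (C * (HS s θ u * HS s θ v)) ^ p := by
  have q0 : 0 < q := by linarith
  have hl : (5/2)/q ≤ 1 := by rw [div_le_one q0]; exact hq
  have hl0 : 0 < (5/2)/q := by positivity
  have hp3 : 1 - 2 * s < 1 / (p * (1 - (5/2)/q)) := hp2.trans_le (one_div_le_one_div_of_le (by linarith) (by nlinarith))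
  obtain ⟨C1, hC1, H1⟩ := NS_prod (ι := ι) (κ := κ) hs hθ hp hp2
  obtain ⟨C2, hC2, H2⟩ := NS_prod (ι := ι) (κ := κ) hs hθ hpq hp3
  set l := (5/2)/q with hldef
  refine ⟨2 * (C1 + C2 ^ (1 - l)), ENNReal.mul_ne_top (by simp) (ENNReal.add_ne_top.2 ⟨hC1, ENNReal.rpow_ne_top_of_nonneg (by linarith) hC2⟩), fun u v => ?_⟩
  set h := HS s θ u * HS s θ v with hh
  have mX : Measurable fun t => NS u t * NS v t := (NS_meas u).mul (NS_meas v)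
  have := sum_pow_int volume (fun (e : Fin 2) t => if e = 0 then (NS u t * NS v t) ^ (1/2:ℝ) else (NS u t * NS v t) ^ ((1 - l)/2) * h ^ l)
    (fun e => by
      rcases eq_or_ne e 0 with he | he
      · simp only [he, if_true]; exact mX.pow_const _
      · simp only [he, if_false]; exact (mX.pow_const _).mul_const _) (P := p) (by linarith) ((C1 + C2 ^ (1 - l)) * h) (fun e => by
      rcases eq_or_ne e 0 with he | he
      · simp only [he, if_true, ← ENNReal.rpow_mul]
        rw [show 1/2 * p = p/2 by ring]
        exact (H1 u v).trans (ENNReal.rpow_le_rpow (mul_le_mul_left le_self_add _) (by linarith))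
      · simp only [he, if_false]
        have e1 : ∀ t, ((NS u t * NS v t) ^ ((1 - l)/2) * h ^ l) ^ p = (NS u t * NS v t) ^ ((p * (1 - l))/2) * h ^ (l * p) := fun t => by
          rw [ENNReal.mul_rpow_of_nonneg _ _ (by linarith), ← ENNReal.rpow_mul, ← ENNReal.rpow_mul]
          congr 2; ring
        simp only [e1]
        rw [lintegral_mul_const _ (mX.pow_const _)]
        refine (mul_le_mul_left (H2 u v) _).trans ?_
        have hn1 : 0 ≤ p * (1 - l) := by linarith
        have hn2 : 0 ≤ l * p := by nlinarith
        calc (C2 * h) ^ (p * (1 - l)) * h ^ (l * p) = C2 ^ (p * (1 - l)) * (h ^ (p * (1 - l)) * h ^ (l * p)) := by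
              rw [ENNReal.mul_rpow_of_nonneg C2 h hn1, mul_assoc]
          _ = (C2 ^ (1 - l) * h) ^ p := by
              rw [← ENNReal.rpow_add_of_nonneg _ _ hn1 hn2, ENNReal.mul_rpow_of_nonneg _ h (by linarith), ← ENNReal.rpow_mul]
              congr 2 <;> ring
          _ ≤ _ := ENNReal.rpow_le_rpow (mul_le_mul_left le_add_self _) (by linarith))
  simp only [Fin.sum_univ_two, if_true, Fintype.card_fin, one_ne_zero, if_false] at this
  rw [mul_assoc]
  exact_mod_cast this

end fam2

section mat
variable {n : ℕ}

/-- Flattened matrix. -/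
def flat (A : Fin n → Fin n → SM) : Fin n × Fin n → SM := fun e => A e.1 e.2
/-- Flattened gradient. -/
def flatG (f : Fin n → Fin n → SM) : Fin 2 × Fin n × Fin n → SM :=
  fun e => pdS e.1 (f e.2.1 e.2.2)
/-- Commutator of Schwartz matrices. -/
def scomm (U V : Fin n → Fin n → SM) (i k : Fin n) : SM :=
  (∑ l, SchwartzMap.pairing (ContinuousLinearMap.mul ℝ ℂ) (U i l) (V l k)) -
    ∑ l, SchwartzMap.pairing (ContinuousLinearMap.mul ℝ ℂ) (V i l) (U l k)

lemma scomm_coe (U V : Fin n → Fin n → SM) (i k : Fin n) :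
    ⇑(scomm U V i k) = mcomm (cF U) (cF V) i k := by
  ext p
  simp [scomm, mcomm, cF, SchwartzMap.sum_apply]

lemma pdf_eq (j : Fin 2) (f : Fin n → Fin n → SM) : pdf j f = cF (fun i k => pdS j (f i k)) := by
  funext i k
  exact (pdS_coe j (f i k)).symm

lemma pdS_add (j : Fin 2) (u v : SM) : pdS j (u + v) = pdS j u + pdS j v := by
  simp [pdS]

lemma pdS_neg (j : Fin 2) (u : SM) : pdS j (-u) = -pdS j u := by
  simp [pdS]

lemma mE_eq (A : Fin n → Fin n → SM) (p : ℝ × V2) : mE (cF A) p = US (flat A) p := by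
  simp only [mE, US, flat, cF, Fintype.sum_prod_type]; rfl

lemma HNM_eq (s θ : ℝ) (A : Fin n → Fin n → SM) : HNM s θ (cF A) = HS s θ (flat A) := by
  simp only [HNM, HS, flat, cF, Fintype.sum_prod_type]

lemma flatG_US (f : Fin n → Fin n → SM) (p : ℝ × V2) :
    US (flatG f) p = US (flat fun i k => pdS 0 (f i k)) p + US (flat fun i k => pdS 1 (f i k)) p := by
  simp only [US, flat, flatG, Fintype.sum_prod_type, Fin.sum_univ_two]

lemma flatG_HS (s θ : ℝ) (f : Fin n → Fin n → SM) :
    HS s θ (flatG f) ≤ 2 * gradN s θ f := by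
  have e : HS s θ (flatG f) = HNM s θ (pdf 0 f) + HNM s θ (pdf 1 f) := by
    rw [pdf_eq, pdf_eq, HNM_eq, HNM_eq]
    simp only [HS, flat, flatG, Fintype.sum_prod_type, Fin.sum_univ_two]
  rw [e, two_mul]
  unfold gradN
  refine add_le_add ?_ ?_
  · conv_lhs => rw [← esq_half (HNM s θ (pdf 0 f))]
    exact ENNReal.rpow_le_rpow le_self_add (by norm_num)
  · conv_lhs => rw [← esq_half (HNM s θ (pdf 1 f))]
    exact ENNReal.rpow_le_rpow le_add_self (by norm_num)

lemma prod_bd (U V : Fin n → Fin n → SM) (i k : Fin n) (p : ℝ × V2) :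
    ‖∑ l, U i l p * V l k p‖ₑ ≤ US (flat U) p * US (flat V) p := by
  have hV : ∀ l, ‖V l k p‖ₑ ≤ US (flat V) p := fun l =>
    Finset.single_le_sum (f := fun e => ‖flat V e p‖ₑ) (fun _ _ => zero_le) (Finset.mem_univ (l, k))
  have hU : ∑ l, ‖U i l p‖ₑ ≤ US (flat U) p := by
    unfold US flat
    rw [Fintype.sum_prod_type]
    exact Finset.single_le_sum (f := fun i => ∑ l, ‖U i l p‖ₑ) (fun _ _ => zero_le) (Finset.mem_univ i)
  calc ‖∑ l, U i l p * V l k p‖ₑ ≤ ∑ l, ‖U i l p * V l k p‖ₑ := enorm_sum_le _ _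
    _ ≤ ∑ l, ‖U i l p‖ₑ * US (flat V) p := Finset.sum_le_sum fun l _ => by
        rw [enorm_mul]; exact mul_le_mul_right (hV l) _
    _ = (∑ l, ‖U i l p‖ₑ) * US (flat V) p := (Finset.sum_mul _ _ _).symm
    _ ≤ _ := mul_le_mul_left hU _

lemma scomm_bd (U V : Fin n → Fin n → SM) (i k : Fin n) (p : ℝ × V2) :
    ‖scomm U V i k p‖ₑ ≤ 2 * (US (flat U) p * US (flat V) p) := by
  rw [scomm_coe]
  unfold mcomm cF
  refine enorm_sub_le.trans ?_
  rw [two_mul]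
  refine add_le_add (prod_bd U V i k p) ((prod_bd V U i k p).trans (le_of_eq (mul_comm _ _)))

lemma ell_bd : ∃ C : EN, C ≠ ⊤ ∧ ∀ A0 f φ : Fin n → Fin n → SM, EllipticEq A0 f φ → ∀ t x,
    US (flat A0) (t, x) ≤ C * ((∫⁻ y, ‖x - y‖ₑ⁻¹ * (US (flat A0) (t, y) * US (flatG f) (t, y))) + bf (flatG f) (flat φ) t x) := by
  obtain ⟨C, hC, H⟩ := repr_est
  refine ⟨(Fintype.card (Fin n × Fin n) : EN) * (C * 2), by finiteness, fun A0 f φ hE t x => ?_⟩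
  have key : ∀ i k, ‖A0 i k (t, x)‖ₑ ≤ C * 2 * ((∫⁻ y, ‖x - y‖ₑ⁻¹ * (US (flat A0) (t, y) * US (flatG f) (t, y))) + bf (flatG f) (flat φ) t x) := by
    intro i k
    set D0 := fun i k => pdS 0 (f i k) with hD0
    set D1 := fun i k => pdS 1 (f i k) with hD1
    refine (H (A0 i k) (-scomm A0 D1 i k + scomm D0 φ i k) (scomm A0 D0 i k + scomm D1 φ i k) ?_ t x).trans ?_
    · intro p
      have := hE i k p
      rw [pdf_eq, pdf_eq, ← scomm_coe, ← scomm_coe, ← scomm_coe, ← scomm_coe] at this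
      simp only [← pdS_coe] at this
      rw [this, pdS_add, pdS_add, pdS_neg]
      simp only [SchwartzMap.add_apply, SchwartzMap.neg_apply]
      ring
    · rw [mul_assoc]
      refine mul_le_mul_right ?_ _
      unfold bf
      have m1 : Measurable fun y => ‖x - y‖ₑ⁻¹ * (US (flat A0) (t, y) * US (flatG f) (t, y)) :=
        (kinv_meas.comp (measurable_const.sub measurable_id)).mul ((USt_meas _ t).mul (USt_meas _ t))
      rw [← lintegral_add_left m1, ← lintegral_const_mul' _ _ (by simp)]
      refine lintegral_mono fun y => ?_
      have b1 : ‖(-scomm A0 D1 i k + scomm D0 φ i k) (t, y)‖ₑ ≤ 2 * (US (flat A0) (t, y) * US (flat D1) (t, y)) + 2 * (US (flat D0) (t, y) * US (flat φ) (t, y)) := by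
        rw [SchwartzMap.add_apply, SchwartzMap.neg_apply]
        refine (enorm_add_le _ _).trans (add_le_add ?_ (scomm_bd _ _ _ _ _))
        rw [enorm_neg]; exact scomm_bd _ _ _ _ _
      have b2 : ‖(scomm A0 D0 i k + scomm D1 φ i k) (t, y)‖ₑ ≤ 2 * (US (flat A0) (t, y) * US (flat D0) (t, y)) + 2 * (US (flat D1) (t, y) * US (flat φ) (t, y)) := by
        rw [SchwartzMap.add_apply]
        exact (enorm_add_le _ _).trans (add_le_add (scomm_bd _ _ _ _ _) (scomm_bd _ _ _ _ _))
      refine (mul_le_mul_right (add_le_add b1 b2) _).trans (le_of_eq ?_)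
      rw [flatG_US]; ring
  calc US (flat A0) (t, x) ≤ ∑ _e : Fin n × Fin n, C * 2 * ((∫⁻ y, ‖x - y‖ₑ⁻¹ * (US (flat A0) (t, y) * US (flatG f) (t, y))) + bf (flatG f) (flat φ) t x) :=
        Finset.sum_le_sum fun e _ => key e.1 e.2
    _ = _ := by rw [Finset.sum_const, nsmul_eq_mul, Finset.card_univ]; ring

end mat

section fin
variable {ι : Type*} [Fintype ι]

lemma US_bdd (u : ι → SM) : ∃ M : EN, M ≠ ⊤ ∧ ∀ p, US u p ≤ M := by
  choose M hM H using fun e => sch_bdd (u e)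
  exact ⟨∑ e, M e, ENNReal.sum_ne_top.2 fun e _ => hM e, fun p => Finset.sum_le_sum fun e _ => H e p⟩

lemma US_int (u : ι → SM) {q : ℝ} (hq : 1 ≤ q) (t : ℝ) : ∫⁻ y, US u (t, y) ^ q ≠ ⊤ := by
  choose M hM H using fun e => sch_decay (u e)
  set K := ∑ e, M e with hK
  have hKt : K ≠ ⊤ := ENNReal.sum_ne_top.2 fun e _ => hM e
  have h1 : ∀ y, US u (t, y) ≤ K * (oR ((1 + |t|) ^ (-2:ℝ)) * oR ((1 + ‖y‖) ^ (-3:ℝ))) := fun y => by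
    rw [hK, Finset.sum_mul]
    exact Finset.sum_le_sum fun e _ => H e t y
  obtain ⟨S, hS, hb⟩ := US_bdd u
  have h2 : ∀ y, US u (t, y) ^ q ≤ (S ^ (q - 1) * K * oR ((1 + |t|) ^ (-2:ℝ))) * oR ((1 + ‖y‖) ^ (-3:ℝ)) := fun y => by
    calc US u (t, y) ^ q = US u (t, y) ^ (q - 1) * US u (t, y) ^ (1:ℝ) := by
          rw [← ENNReal.rpow_add_of_nonneg _ _ (by linarith) zero_le_one]; congr 1; ring
      _ ≤ S ^ (q - 1) * (K * (oR ((1 + |t|) ^ (-2:ℝ)) * oR ((1 + ‖y‖) ^ (-3:ℝ)))) := by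
          rw [ENNReal.rpow_one]
          exact mul_le_mul' (ENNReal.rpow_le_rpow (hb _) (by linarith)) (h1 y)
      _ = _ := by ring
  have hSq : S ^ (q - 1) ≠ ⊤ := ENNReal.rpow_ne_top_of_nonneg (by linarith) hS
  have hc : S ^ (q - 1) * K * oR ((1 + |t|) ^ (-2:ℝ)) ≠ ⊤ := by finiteness
  refine ne_top_of_le_ne_top ?_ (lintegral_mono h2)
  rw [lintegral_const_mul' _ _ hc]
  exact ENNReal.mul_ne_top hc (jap2_fin (by norm_num))

end fin

lemma main_aux (n : ℕ) {s θ p : ℝ} (hs0 : 1 / 4 < s) (hθ : 1 / 2 < θ)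
    (hp : 2 < p) (hp1 : 1 - 2 * s < 1 / p) : ∃ ε C : EN, ε ≠ 0 ∧ ε ≠ ⊤ ∧ C ≠ ⊤ ∧ ∀ A0 f φ : Fin n → Fin n → SM,
      EllipticEq A0 f φ → gradN s θ f ≤ ε →
        Ltp p (fun t => ⨆ x : V2, mE (cF A0) (t, x)) ≤ C * (HNM s θ (cF φ) * gradN s θ f) := by
  obtain ⟨q, hq, hpq⟩ : ∃ q : ℝ, 5 / 2 ≤ q ∧ 2 < p * (1 - (5/2)/q) := by
    have hp' : 0 < p - 2 := by linarith
    refine ⟨5 * p / (p - 2), ?_, ?_⟩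
    · rw [le_div_iff₀ hp']; linarith
    · have : p * (1 - (5/2)/(5 * p / (p - 2))) = p - (p - 2)/2 := by field_simp
      rw [this]; linarith
  obtain ⟨C1, hC1, H1⟩ := ell_bd (n := n)
  obtain ⟨C2, hC2, δ, hδ0, hδt, H2⟩ := fixed_time (q := q) (by linarith) C1 hC1
  obtain ⟨C3, hC3, H3⟩ := US_kap (ι := Fin 2 × Fin n × Fin n) hs0 hθ
  obtain ⟨C4, hC4, H4⟩ := bf_q (ι := Fin 2 × Fin n × Fin n) (κ := Fin n × Fin n) hs0 hθ hq
  obtain ⟨C5, hC5, H5⟩ := time_int (ι := Fin 2 × Fin n × Fin n) (κ := Fin n × Fin n) hs0 hθ hp hp1 hq hpq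
  set c : EN := ((Fintype.card (Fin 2 × Fin n × Fin n) : EN) * Fintype.card (Fin n × Fin n)) ^ (1/2:ℝ) with hc
  have hct : c ≠ ⊤ := ENNReal.rpow_ne_top_of_nonneg (by norm_num) (by finiteness)
  refine ⟨δ / (2 * C3 + 1), C2 * (c + C4) * C5 * 2, ENNReal.div_ne_zero.2 ⟨hδ0, by finiteness⟩, ENNReal.div_ne_top hδt (by simp), by finiteness, fun A0 f φ hE hg => ?_⟩
  set W := flatG f with hW
  set F := flat φ with hF
  have hsmall : C3 * HS s θ W ≤ δ := by
    calc C3 * HS s θ W ≤ C3 * (2 * (δ / (2 * C3 + 1))) := mul_le_mul_right ((flatG_HS s θ f).trans (mul_le_mul_right hg _)) _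
      _ = (2 * C3) * (δ / (2 * C3 + 1)) := by ring
      _ ≤ (2 * C3 + 1) * (δ / (2 * C3 + 1)) := mul_le_mul_left le_self_add _
      _ ≤ δ := ENNReal.mul_div_le
  have hpt : ∀ t, (⨆ x : V2, mE (cF A0) (t, x)) ≤ (C2 * (c + C4)) *
      ((NS W t * NS F t) ^ (1/2:ℝ) + (NS W t * NS F t) ^ ((1 - (5/2)/q)/2) * (HS s θ W * HS s θ F) ^ ((5/2)/q)) := by
    intro t
    refine iSup_le fun x => ?_
    rw [mE_eq]
    obtain ⟨S, hS, hSb⟩ := US_bdd (flat A0)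
    obtain ⟨S', hS', hSb'⟩ := US_bdd W
    have h := H2 (fun y => US (flat A0) (t, y)) (fun y => US W (t, y)) (bf W F t) (USt_meas _ t) (USt_meas _ t) (bf_meas _ _ t)
      S hS (fun y => hSb _) (fun y => ne_top_of_le_ne_top hS' (hSb' _)) (US_int _ (by linarith) t)
      (fun x => (H3 W t x).trans (pow_le_pow_left' hsmall 2)) (fun x => H1 A0 f φ hE t x) _ (fun x => bf_sup W F t x) x
    refine h.trans ?_
    rw [mul_assoc]
    refine mul_le_mul_right ((add_le_add_right (H4 W F t) _).trans ?_) _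
    rw [mul_add]
    exact add_le_add (mul_le_mul_left le_self_add _) (mul_le_mul_left le_add_self _)
  unfold Ltp
  have p0 : 0 < p := by linarith
  have hD : C2 * (c + C4) ≠ ⊤ := by finiteness
  calc (∫⁻ t, (⨆ x : V2, mE (cF A0) (t, x)) ^ p) ^ p⁻¹ ≤ ((C2 * (c + C4) * (C5 * (HS s θ W * HS s θ F))) ^ p) ^ p⁻¹ := by
        refine ENNReal.rpow_le_rpow ?_ (by positivity)
        refine (lintegral_mono fun t => ENNReal.rpow_le_rpow (hpt t) p0.le).trans ?_
        simp only [ENNReal.mul_rpow_of_nonneg (C2 * (c + C4)) _ p0.le]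
        rw [lintegral_const_mul' _ _ (ENNReal.rpow_ne_top_of_nonneg p0.le hD)]
        exact mul_le_mul_right (H5 W F) _
    _ = C2 * (c + C4) * (C5 * (HS s θ W * HS s θ F)) := by
        rw [← ENNReal.rpow_mul, mul_inv_cancel₀ p0.ne', ENNReal.rpow_one]
    _ ≤ C2 * (c + C4) * (C5 * (2 * gradN s θ f * HS s θ F)) :=
        mul_le_mul_right (mul_le_mul_right (mul_le_mul_left (flatG_HS s θ f) _) _) _
    _ = _ := by rw [HNM_eq]; ring



theorem elliptic_LpLinf_estimate (n : ℕ) (hn : 1 ≤ n)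
    (s θ p : ℝ) (hs0 : 1 / 4 < s) (hs1 : s < 1 / 2) (hθ : 1 / 2 < θ)
    (hp1 : 1 - 2 * s < 1 / p) (hp2 : 1 / p < 1 / 2) :
    ∃ ε₀ C : ℝ, 0 < ε₀ ∧ 0 < C ∧
      ∀ A0 f φ : Fin n → Fin n → SchwartzMap (ℝ × V2) ℂ,
        EllipticEq A0 f φ →
        gradN s θ f ≤ ENNReal.ofReal ε₀ →
        Ltp p (fun t => ⨆ x : V2, mE (cF A0) (t, x)) ≤
          ENNReal.ofReal C * (HNM s θ (cF φ) * gradN s θ f) := by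
  have h0 : 0 < 1 / p := by linarith
  have p0 : 0 < p := by simpa using h0
  have hp : 2 < p := by
    rw [one_div_lt_one_div p0 (by norm_num)] at hp2; exact hp2
  obtain ⟨ε, C, hε0, hεt, hC, H⟩ := main_aux n hs0 hθ hp hp1
  refine ⟨ε.toReal, C.toReal + 1, ENNReal.toReal_pos hε0 hεt, by positivity, fun A0 f φ hE hg => ?_⟩
  rw [ENNReal.ofReal_toReal hεt] at hg
  refine (H A0 f φ hE hg).trans (mul_le_mul_left ?_ _)
  rw [ENNReal.ofReal_add (by positivity) zero_le_one, ENNReal.ofReal_toReal hC]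
  exact le_self_add
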